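/- There exists a constant c = c(r) ∈ ℕ depending only on r such that whenever p > c and q ≡ 1 (mod r), the adelic Galois representation of φ is surjective; concretely: for every nonzero ideal 𝔞 of A and every A/𝔞-module automorphism g of the torsion module φ[𝔞], there exists σ ∈ Gal(F̄/F) whose restriction to φ[𝔞] equals g. (Equivalently, ρ_φ : Gal(F^sep/F) → lim_𝔞 Aut(φ[𝔞]) ≅ GL_r(Â) is surjective, where Â = lim_𝔞 A/𝔞.) -/

import Mathlib

open Polynomial

noncomputable section

/-- `F̄`: a fixed algebraic closure of `F = 𝔽_q(T)`. -/
abbrev Kbar (Fq : Type) [Field Fq] := AlgebraicClosure (RatFunc Fq)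

/-- `φ` is (encodes) the rank-`r` Drinfeld `𝔽_q[T]`-module over `𝔽_q(T)` given by
`φ_T = T + τ^{r-1} + T^{q-1} τ^r`: it is a ring homomorphism from `A = 𝔽_q[T]` to the
additive endomorphisms of `F̄` which is `𝔽_q`-linear (the condition on `C c`) and sends
`T` to `x ↦ T·x + x^{q^{r-1}} + T^{q-1}·x^{q^r}`. -/
def IsDrinfeldPhi (Fq : Type) [Field Fq] (q r : ℕ)
    (φ : Polynomial Fq →+* AddMonoid.End (Kbar Fq)) : Prop :=
  (∀ (c : Fq) (x : Kbar Fq),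
      φ (C c) x = algebraMap (RatFunc Fq) (Kbar Fq) (RatFunc.C c) * x) ∧
  (∀ x : Kbar Fq, φ X x =
      algebraMap (RatFunc Fq) (Kbar Fq) RatFunc.X * x + x ^ q ^ (r - 1) +
        algebraMap (RatFunc Fq) (Kbar Fq) RatFunc.X ^ (q - 1) * x ^ q ^ r)

/-- The `a`-torsion `φ[a] ⊆ F̄`. -/
def phiTorsion (Fq : Type) [Field Fq] (φ : Polynomial Fq →+* AddMonoid.End (Kbar Fq))
    (a : Polynomial Fq) : Set (Kbar Fq) := {x | φ a x = 0}

/-- `g` is an `A/(a)`-module automorphism of `φ[a]`: a bijection of `φ[a]` with itself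
which is additive and commutes with the `A`-action through `φ`. -/
def IsTorsionAut (Fq : Type) [Field Fq] (φ : Polynomial Fq →+* AddMonoid.End (Kbar Fq))
    (a : Polynomial Fq) (g : Kbar Fq → Kbar Fq) : Prop :=
  Set.BijOn g (phiTorsion Fq φ a) (phiTorsion Fq φ a) ∧
  (∀ x ∈ phiTorsion Fq φ a, ∀ y ∈ phiTorsion Fq φ a, g (x + y) = g x + g y) ∧
  (∀ b : Polynomial Fq, ∀ x ∈ phiTorsion Fq φ a, g (φ b x) = φ b (g x))

namespace DrinfeldAdelic

section Operators

variable {k : Type*} [Field k]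

lemma aeval_end_divX {M : Type*} [AddCommGroup M] [Module k M] (T : Module.End k M) (a : k[X])
    (x : M) : aeval T a x = T (aeval T a.divX x) + a.coeff 0 • x := by
  have h := congrArg (fun p => aeval T p x) (X_mul_divX_add a)
  rw [map_add, map_mul, aeval_X, aeval_C] at h
  exact h.symm

lemma aeval_end_semiconj {M M' : Type*} [AddCommGroup M] [Module k M] [AddCommGroup M']
    [Module k M'] {T : Module.End k M} {T' : Module.End k M'} (h : M →ₗ[k] M')
    (hc : ∀ x, h (T x) = T' (h x)) (a : k[X]) (x : M) :
    h (aeval T a x) = aeval T' a (h x) := by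
  induction a using Polynomial.induction_on' with
  | add p q hp hq => simp [hp, hq]
  | monomial n c =>
    have : ∀ y, h ((T ^ n) y) = (T' ^ n) (h y) := by
      induction n with
      | zero => simp
      | succ n ih => intro y; simp [pow_succ, ih, hc]
    simp [aeval_monomial, this, Module.algebraMap_end_apply]

/-- Induction along `a ↦ a.divX`. -/
lemma divX_induction {P : k[X] → Prop} (h0 : P 0) (h1 : ∀ c : k, c ≠ 0 → P (C c))
    (h2 : ∀ a : k[X], 0 < a.natDegree → P a.divX → P a) (a : k[X]) : P a := by
  induction hn : a.natDegree using Nat.strong_induction_on generalizing a with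
  | _ n ih =>
    rcases Nat.eq_zero_or_pos a.natDegree with h | h
    · rw [eq_C_of_natDegree_eq_zero h]
      by_cases hc : a.coeff 0 = 0
      · simpa [hc] using h0
      · exact h1 _ hc
    · refine h2 a h (ih _ ?_ _ rfl)
      rw [natDegree_divX_eq_natDegree_tsub_one]; omega

lemma divX_ne_zero_of_natDegree_pos {a : k[X]} (h : 0 < a.natDegree) : a.divX ≠ 0 := by
  intro h0
  have := divX_eq_zero_iff.1 h0
  rw [this, natDegree_C] at h
  exact lt_irrefl _ h

variable {S : Type*} [CommRing S] [Algebra k S]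

lemma derivative_aeval_of_op {T : Module.End k S[X]} {θ : S}
    (hT : ∀ P, derivative (T P) = C θ * derivative P) (a : k[X]) (P : S[X]) :
    derivative (aeval T a P) = C (aeval θ a) * derivative P := by
  induction a using divX_induction generalizing P with
  | h0 => simp
  | h1 c _ =>
    simp [Module.algebraMap_end_apply, Algebra.smul_def, Polynomial.algebraMap_apply]
  | h2 a _ ih =>
    rw [aeval_end_divX, derivative_add, hT, ih]
    have h := congrArg (fun p => C (aeval θ p)) (X_mul_divX_add a)
    simp only [map_add, map_mul, aeval_X, aeval_C] at h
    rw [← h, Algebra.smul_def, Polynomial.algebraMap_apply, derivative_C_mul]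
    ring

lemma natDegree_aeval_of_op [IsDomain S] {T : Module.End k S[X]} {N : ℕ} (hN : 1 < N)
    (hT : ∀ P, 0 < natDegree P → natDegree (T P) = N * natDegree P) {a : k[X]} (ha : a ≠ 0) :
    natDegree (aeval T a X) = N ^ natDegree a := by
  have hinj := (algebraMap k S).injective
  induction a using divX_induction with
  | h0 => exact absurd rfl ha
  | h1 c hc =>
    have : algebraMap k S c ≠ 0 := by simpa using hc
    simp [Module.algebraMap_end_apply, Algebra.smul_def, Polynomial.algebraMap_apply, this]
  | h2 a hd ih =>
    have ih := ih (divX_ne_zero_of_natDegree_pos hd)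
    rw [aeval_end_divX]
    have h1 : natDegree (T (aeval T a.divX X)) = N ^ natDegree a := by
      rw [hT _ (by rw [ih]; positivity), ih, natDegree_divX_eq_natDegree_tsub_one, ← pow_succ']
      congr 1; omega
    rw [natDegree_add_eq_left_of_natDegree_lt, h1]
    rw [h1]
    calc natDegree (a.coeff 0 • (X : S[X])) ≤ 1 := by
          rw [Algebra.smul_def, Polynomial.algebraMap_apply]
          exact (natDegree_C_mul_le _ _).trans natDegree_X_le
      _ < N ^ natDegree a := Nat.one_lt_pow hd.ne' hN

variable [Fintype k]

variable (k S) in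
/-- The `q`-power Frobenius as a linear map. -/
def frob : Module.End k S := (FiniteField.frobeniusAlgHom k S).toLinearMap

local notation "q" => Fintype.card k

lemma frob_apply (x : S) : frob k S x = x ^ q := rfl

lemma frob_pow_apply (n : ℕ) (x : S) : (frob k S ^ n) x = x ^ q ^ n := by
  induction n generalizing x with
  | zero => simp
  | succ n ih => rw [pow_succ, Module.End.mul_apply, ih, frob_apply, ← pow_mul, pow_succ']

variable (k) in
/-- The operator `θ + τ^{r-1} + θ^{q-1} τ^r`. -/
def drin (r : ℕ) (θ : S) : Module.End k S :=
  θ • 1 + frob k S ^ (r - 1) + θ ^ (q - 1) • frob k S ^ r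

variable (k) in
/-- The Carlitz operator `θ + τ`. -/
def carl (θ : S) : Module.End k S := θ • 1 + frob k S

lemma drin_apply (r : ℕ) (θ x : S) :
    drin k r θ x = θ * x + x ^ q ^ (r - 1) + θ ^ (q - 1) * x ^ q ^ r := by
  simp [drin, frob_pow_apply]

lemma carl_apply (θ x : S) : carl k θ x = θ * x + x ^ q := by
  simp [carl, frob_apply]

variable {S' : Type*} [CommRing S'] [Algebra k S']

lemma map_aeval_drin (h : S →ₐ[k] S') (r : ℕ) {θ : S} {θ' : S'} (hθ : h θ = θ') (a : k[X]) (x : S) :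
    h (aeval (drin k r θ) a x) = aeval (drin k r θ') a (h x) :=
  aeval_end_semiconj h.toLinearMap (by intro x; simp [drin_apply, hθ]) a x

lemma map_aeval_carl (h : S →ₐ[k] S') {θ : S} {θ' : S'} (hθ : h θ = θ') (a : k[X]) (x : S) :
    h (aeval (carl k θ) a x) = aeval (carl k θ') a (h x) :=
  aeval_end_semiconj h.toLinearMap (by intro x; simp [carl_apply, hθ]) a x

lemma one_lt_card : 1 < q := Fintype.one_lt_card

lemma card_cast_eq_zero : ((q : ℕ) : S) = 0 := by
  have : ((q : ℕ) : k) = 0 := FiniteField.cast_card_eq_zero k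
  rw [← map_natCast (algebraMap k S), this, map_zero]

lemma derivative_drin {r : ℕ} (hr : 2 ≤ r) (θ : S) (P : S[X]) :
    derivative (drin k r (C θ) P) = C θ * derivative P := by
  have h : ∀ n, n ≠ 0 → ((q ^ n : ℕ) : S[X]) = 0 := by
    intro n hn
    rw [Nat.cast_pow, card_cast_eq_zero, zero_pow hn]
  rw [drin_apply, ← C_pow]
  simp only [derivative_add, derivative_C_mul, derivative_pow]
  simp only [map_natCast]
  rw [h r (by omega), h (r - 1) (by omega)]
  simp

lemma derivative_carl (θ : S) (P : S[X]) :
    derivative (carl k (C θ) P) = C θ * derivative P := by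
  rw [carl_apply]
  simp only [derivative_add, derivative_C_mul, derivative_pow]
  simp only [map_natCast]
  rw [card_cast_eq_zero]
  simp

lemma natDegree_drin [IsDomain S] {r : ℕ} (hr : 1 ≤ r) {θ : S} (hθ : θ ≠ 0) {P : S[X]}
    (hP : 0 < natDegree P) : natDegree (drin k r (C θ) P) = q ^ r * natDegree P := by
  have hq := one_lt_card (k := k)
  rw [drin_apply, ← C_pow]
  have h1 : natDegree (C (θ ^ (q - 1)) * P ^ q ^ r) = q ^ r * natDegree P := by
    rw [natDegree_C_mul (pow_ne_zero _ hθ), natDegree_pow]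
  rw [natDegree_add_eq_right_of_natDegree_lt, h1]
  rw [h1]
  have h2 : q ^ (r - 1) < q ^ r := Nat.pow_lt_pow_right hq (by omega)
  have h3 : 1 ≤ q ^ (r - 1) := Nat.one_le_pow _ _ (by omega)
  refine lt_of_le_of_lt (natDegree_add_le _ _) (max_lt ?_ ?_)
  · rw [natDegree_C_mul hθ]; nlinarith
  · rw [natDegree_pow]; nlinarith

lemma natDegree_drin_zero [IsDomain S] {r : ℕ} (P : S[X]) :
    natDegree (drin k r (0 : S[X]) P) = q ^ (r - 1) * natDegree P := by
  have hq := one_lt_card (k := k)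
  rw [drin_apply, zero_pow (by omega)]
  simp

lemma natDegree_carl [IsDomain S] {θ : S} {P : S[X]}
    (hP : 0 < natDegree P) : natDegree (carl k (C θ) P) = q * natDegree P := by
  have hq := one_lt_card (k := k)
  rw [carl_apply, natDegree_add_eq_right_of_natDegree_lt, natDegree_pow]
  rw [natDegree_pow]
  refine lt_of_le_of_lt (natDegree_C_mul_le _ _) ?_
  nlinarith

lemma monic_aeval_carl [IsDomain S] (θ : S) {a : k[X]} (ha : a.Monic) :
    (aeval (carl k (C θ)) a X).Monic := by
  have hq := one_lt_card (k := k)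
  induction a using divX_induction with
  | h0 => exact absurd ha not_monic_zero
  | h1 c hc =>
    have : c = 1 := by simpa [Monic, leadingCoeff_C] using ha
    simp [this, monic_X]
  | h2 a hd ih =>
    have hm : a.divX.Monic := by
      rw [Monic, leadingCoeff, natDegree_divX_eq_natDegree_tsub_one, coeff_divX,
        Nat.sub_add_cancel hd]
      exact ha
    have ih := ih hm
    have hdeg := natDegree_aeval_of_op (S := S) hq (fun P hP => natDegree_carl (k := k) (θ := θ) hP)
      hm.ne_zero
    set P := aeval (carl k (C θ)) a.divX X
    have hP0 : 0 < natDegree P := by rw [hdeg]; positivity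
    rw [aeval_end_divX, carl_apply, add_right_comm]
    refine Monic.add_of_right (ih.pow _) ?_
    apply degree_lt_degree
    rw [natDegree_pow]
    refine lt_of_le_of_lt (natDegree_add_le _ _) (max_lt ?_ ?_)
    · refine lt_of_le_of_lt (natDegree_C_mul_le _ _) ?_
      change natDegree P < q * natDegree P
      nlinarith
    · refine lt_of_le_of_lt (b := 1) ?_ ?_
      · rw [Algebra.smul_def, Polynomial.algebraMap_apply]
        exact (natDegree_C_mul_le _ _).trans natDegree_X_le
      · change 1 < q * natDegree P
        nlinarith

end Operators
section Torsion
variable {k : Type*} [Field k] [Fintype k] {E : Type*} [Field E] [Algebra k E]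
local notation "q" => Fintype.card k

lemma eval_aeval_drin {S : Type*} [CommRing S] [Algebra k S] (r : ℕ) (θ x : S) (a : k[X]) :
    (aeval (drin k r (C θ)) a (X : S[X])).eval x = aeval (drin k r θ) a x := by
  have := map_aeval_drin (k := k) ((Polynomial.aeval (R := S) x).restrictScalars k) r
    (θ := C θ) (θ' := θ) (by simp) a X
  simpa [coe_aeval_eq_eval] using this

variable (k) in
/-- The `a`-torsion of the Drinfeld module. -/
abbrev tors (r : ℕ) (θ : E) (a : k[X]) : Submodule k E := LinearMap.ker (aeval (drin k r θ) a)

lemma aeval_drin_ne_zero {r : ℕ} (hr : 1 ≤ r) {θ : E} (hθ : θ ≠ 0) {a : k[X]} (ha : a ≠ 0) :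
    aeval (drin k r (C θ)) a (X : E[X]) ≠ 0 := by
  have hq := one_lt_card (k := k)
  have := natDegree_aeval_of_op (S := E) (Nat.one_lt_pow (by omega) hq : 1 < q ^ r)
    (fun P hP => natDegree_drin (k := k) (θ := θ) hr hθ hP) ha
  intro h
  rw [h, natDegree_zero] at this
  have h2 : 0 < (q ^ r) ^ natDegree a := by positivity
  omega

lemma finite_tors {r : ℕ} (hr : 1 ≤ r) {θ : E} (hθ : θ ≠ 0) {a : k[X]} (ha : a ≠ 0) :
    Finite (tors k r θ a) := by
  refine (Set.Finite.subset ((aeval (drin k r (C θ)) a (X : E[X])).rootSet_finite E)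
    (t := (tors k r θ a : Set E)) ?_).to_subtype
  intro x hx
  rw [mem_rootSet]
  refine ⟨aeval_drin_ne_zero hr hθ ha, ?_⟩
  rw [coe_aeval_eq_eval, eval_aeval_drin]
  exact hx

lemma card_tors [IsAlgClosed E] {r : ℕ} (hr : 2 ≤ r) {θ : E} (hθ : θ ≠ 0) {a : k[X]}
    (ha : aeval θ a ≠ 0) : Nat.card (tors k r θ a) = q ^ (r * natDegree a) := by
  classical
  have hq := one_lt_card (k := k)
  have ha0 : a ≠ 0 := by rintro rfl; simp at ha
  set P := aeval (drin k r (C θ)) a (X : E[X])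
  have hP := aeval_drin_ne_zero (by omega : 1 ≤ r) hθ ha0
  have hsep : P.Separable := by
    rw [Polynomial.Separable, derivative_aeval_of_op (fun P => derivative_drin hr θ P)]
    rw [derivative_X, mul_one]
    exact (isCoprime_one_right.of_isCoprime_of_dvd_right (isUnit_C.2 (IsUnit.mk0 _ ha)).dvd)
  have := natDegree_aeval_of_op (S := E) (Nat.one_lt_pow (by omega) hq : 1 < q ^ r)
    (fun P hP => natDegree_drin (k := k) (θ := θ) (by omega) hθ hP) ha0
  rw [pow_mul, ← this, ← card_rootSet_eq_natDegree (K := E) hsep (IsAlgClosed.splits_domain _),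
    ← Nat.card_eq_fintype_card]
  refine Nat.card_congr (Equiv.setCongr ?_)
  ext x
  rw [mem_rootSet, coe_aeval_eq_eval, eval_aeval_drin]
  exact ⟨fun h => ⟨hP, h⟩, fun h => h.2⟩

end Torsion

section MatrixGroups
open Matrix

variable {R : Type*} [CommRing R]

lemma exists_pow_isIdempotentElem {M : Type*} [Monoid M] [Finite M] (u : M) :
    ∃ N, 0 < N ∧ IsIdempotentElem (u ^ N) := by
  obtain ⟨a, b, hab, h⟩ := Finite.exists_ne_map_eq_of_infinite (fun n : ℕ => u ^ n)
  wlog hlt : a < b generalizing a b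
  · exact this b a hab.symm h.symm (by omega)
  change u ^ a = u ^ b at h
  have h1 : ∀ j, u ^ (a + j * (b - a)) = u ^ a := by
    intro j
    induction j with
    | zero => simp
    | succ j ih =>
      have : a + (j + 1) * (b - a) = b + j * (b - a) := by
        rw [add_mul, one_mul]; omega
      rw [this, pow_add, ← h, ← pow_add, ih]
  refine ⟨(a + 1) * (b - a), Nat.mul_pos (by omega) (by omega), ?_⟩
  rw [IsIdempotentElem, ← pow_add]
  have h2 : a ≤ (a + 1) * (b - a) := by
    calc a ≤ (a + 1) * 1 := by omega
      _ ≤ _ := Nat.mul_le_mul_left _ (by omega)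
  obtain ⟨c, hc⟩ := Nat.exists_eq_add_of_le h2
  calc u ^ ((a + 1) * (b - a) + (a + 1) * (b - a))
      = u ^ (a + (a + 1) * (b - a)) * u ^ c := by
        rw [← pow_add]; congr 1; omega
    _ = u ^ ((a + 1) * (b - a)) := by rw [h1, ← pow_add, ← hc]

/-- Finite commutative rings have stable rank one. -/
lemma exists_isUnit_add_mul [Finite R] {u v s t : R} (h : s * u + t * v = 1) :
    ∃ y, IsUnit (u + y * v) := by
  obtain ⟨N, hN, he⟩ := exists_pow_isIdempotentElem u
  refine ⟨1 - u ^ N, ?_⟩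
  by_contra hu
  obtain ⟨M, hM, hmem⟩ := exists_max_ideal_of_mem_nonunits hu
  have hMp := hM.isPrime
  by_cases h1 : u ∈ M
  · have h2 : u ^ N * v ∈ M := M.mul_mem_right _ (M.pow_mem_of_mem h1 _ hN)
    have h3 : v ∈ M := by
      have := M.add_mem (M.sub_mem hmem h1) h2
      convert this using 1; ring
    exact hM.ne_top ((Ideal.eq_top_iff_one _).2 (h ▸ M.add_mem (M.mul_mem_left _ h1) (M.mul_mem_left _ h3)))
  · have h2 : u ^ N * (1 - u ^ N) ∈ M := by
      rw [mul_sub, mul_one, he.eq, sub_self]; exact M.zero_mem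
    have h3 : 1 - u ^ N ∈ M := (hMp.mem_or_mem h2).resolve_left
      fun h => h1 (hMp.mem_of_pow_mem _ h)
    apply h1
    have := M.sub_mem hmem (M.mul_mem_right v h3)
    simpa using this

variable {n : Type*} [Fintype n] [DecidableEq n]

lemma one_add_vecMulVec_mul {v v' f f' : n → R} (h : f ⬝ᵥ v' = 0) :
    (1 + vecMulVec v f) * (1 + vecMulVec v' f') = 1 + vecMulVec v f + vecMulVec v' f' := by
  rw [mul_add, mul_one, add_mul, one_mul, vecMulVec_mul_vecMulVec, h]
  simp

section Elim
variable {G : Submonoid (Matrix n n R)}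

lemma rowOp_mem (hG : ∀ i j, i ≠ j → ∀ c, transvection i j c ∈ G) (m : n) {c : n → R}
    (hc : c m = 0) : 1 + vecMulVec (Pi.single m 1) c ∈ G := by
  have key : ∀ s : Finset n, m ∉ s →
      1 + vecMulVec (Pi.single m 1) (∑ i ∈ s, Pi.single i (c i)) ∈ G := by
    intro s
    induction s using Finset.induction_on with
    | empty => intro _; simp
    | insert a s ha ih =>
      intro hm
      rw [Finset.mem_insert, not_or] at hm
      have h1 := G.mul_mem (hG m a hm.1 (c a)) (ih hm.2)
      have h2 : transvection m a (c a) = 1 + vecMulVec (Pi.single m 1) (Pi.single a (c a)) := by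
        rw [transvection]
        congr 1
        ext i j
        simp only [single_apply, vecMulVec_apply, Pi.single_apply, ite_mul, one_mul, zero_mul,
          eq_comm (a := m), eq_comm (a := a), ite_and]
      rw [h2, one_add_vecMulVec_mul (by simp [hm.1]), add_assoc,
        ← vecMulVec_add] at h1
      rwa [Finset.sum_insert ha]
  have := key (Finset.univ.erase m) (by simp)
  convert this using 3
  ext j
  simp only [Finset.sum_apply, Pi.single_apply]
  by_cases hj : j = m
  · subst hj; simp [hc]
  · simp [hj]

lemma colOp_mem (hG : ∀ i j, i ≠ j → ∀ c, transvection i j c ∈ G) (m : n) {v : n → R}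
    (hv : v m = 0) : 1 + vecMulVec v (Pi.single m 1) ∈ G := by
  have key : ∀ s : Finset n, m ∉ s →
      1 + vecMulVec (∑ i ∈ s, Pi.single i (v i)) (Pi.single m 1) ∈ G := by
    intro s
    induction s using Finset.induction_on with
    | empty => intro _; simp
    | insert a s ha ih =>
      intro hm
      rw [Finset.mem_insert, not_or] at hm
      have h1 := G.mul_mem (ih hm.2) (hG a m (Ne.symm hm.1) (v a))
      have h2 : transvection a m (v a) = 1 + vecMulVec (Pi.single a (v a)) (Pi.single m 1) := by
        rw [transvection]
        congr 1
        ext i j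
        simp only [single_apply, vecMulVec_apply, Pi.single_apply, mul_ite, mul_one, mul_zero,
          eq_comm (a := m), eq_comm (a := a), ite_and]
        split_ifs <;> rfl
      rw [h2, one_add_vecMulVec_mul (by simp [hm.1]), add_assoc,
        ← add_vecMulVec] at h1
      rwa [Finset.sum_insert ha, add_comm (Pi.single a (v a) : n → R)]
  have := key (Finset.univ.erase m) (by simp)
  convert this using 3
  ext j
  simp only [Finset.sum_apply, Pi.single_apply]
  by_cases hj : j = m
  · subst hj; simp [hv]
  · simp [hj]

lemma mem_of_rowOp_mul_mem (hG : ∀ i j, i ≠ j → ∀ c, transvection i j c ∈ G) (m : n) {c : n → R}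
    (hc : c m = 0) {g : Matrix n n R} (h : (1 + vecMulVec (Pi.single m 1) c) * g ∈ G) : g ∈ G := by
  have h1 := G.mul_mem (rowOp_mem hG m (c := -c) (by simp [hc])) h
  rw [← mul_assoc, one_add_vecMulVec_mul (by simp [hc]), add_assoc, ← vecMulVec_add] at h1
  simpa using h1

lemma mem_of_colOp_mul_mem (hG : ∀ i j, i ≠ j → ∀ c, transvection i j c ∈ G) (m : n) {v : n → R}
    (hv : v m = 0) {g : Matrix n n R} (h : (1 + vecMulVec v (Pi.single m 1)) * g ∈ G) : g ∈ G := by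
  have h1 := G.mul_mem (colOp_mem hG m (v := -v) (by simp [hv])) h
  rw [← mul_assoc, one_add_vecMulVec_mul (by simp [hv]), add_assoc, ← add_vecMulVec] at h1
  simpa using h1

lemma det_one_add_vecMulVec {v f : n → R} : (1 + vecMulVec v f).det = 1 + f ⬝ᵥ v := by
  rw [vecMulVec_eq Unit, det_one_add_replicateCol_mul_replicateRow]

lemma one_add_vecMulVec_mulVec (v f w : n → R) :
    (1 + vecMulVec v f) *ᵥ w = w + (f ⬝ᵥ w) • v := by
  rw [add_mulVec, one_mulVec, vecMulVec_mulVec]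
  ext i; simp

/-- Over a finite commutative ring, a group containing all transvections contains `SL_n`. -/
lemma mem_of_transvections_mem [Finite R] (hG : ∀ i j, i ≠ j → ∀ c, transvection i j c ∈ G)
    {g : Matrix n n R} (hg : g.det = 1) : g ∈ G := by
  have key : ∀ N, ∀ s : Finset n, sᶜ.card = N → ∀ g : Matrix n n R, g.det = 1 →
      (∀ j ∈ s, g *ᵥ Pi.single j 1 = Pi.single j 1) → g ∈ G := by
    intro N
    induction N with
    | zero =>
      intro s hs g _ hfix
      have hs : s = Finset.univ := by simpa using hs
      have : g = 1 := by
        refine Matrix.ext_of_mulVec_single fun j => ?_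
        rw [hfix j (by simp [hs]), one_mulVec]
      rw [this]; exact G.one_mem
    | succ N ih =>
      intro s hs g hdet hfix
      obtain ⟨k, hk⟩ : sᶜ.Nonempty := Finset.card_pos.1 (by omega)
      have hks : k ∉ s := by simpa using hk
      -- a group element whose `k`-th column has `k`-th entry one
      have clear : ∀ g : Matrix n n R, g.det = 1 →
          (∀ j ∈ s, g *ᵥ Pi.single j 1 = Pi.single j 1) → g k k = 1 → g ∈ G := by
        intro g hdet hfix hkk
        set w := g *ᵥ Pi.single k 1 with hw
        have hwk : w k = 1 := by rw [hw, mulVec_single_one]; exact hkk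
        refine mem_of_colOp_mul_mem hG k (v := Pi.single k 1 - w) (by simp [hwk]) ?_
        refine ih (insert k s) ?_ _ ?_ ?_
        · rw [Finset.compl_insert, Finset.card_erase_of_mem hk, hs]; rfl
        · rw [det_mul, hdet, det_one_add_vecMulVec]; simp [hwk]
        · intro j hj
          rw [← mulVec_mulVec, one_add_vecMulVec_mulVec]
          rcases Finset.mem_insert.1 hj with rfl | hj
          · rw [← hw]; simp [hwk]
          · rw [hfix j hj]
            have : k ≠ j := by rintro rfl; exact hks hj
            simp [this]
      have hadj : ∀ j ∈ s, adjugate g k j = 0 := by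
        intro j hj
        have h1 : adjugate g *ᵥ (g *ᵥ Pi.single j 1) = Pi.single j 1 := by
          rw [mulVec_mulVec, adjugate_mul, hdet, one_smul, one_mulVec]
        rw [hfix j hj, mulVec_single_one] at h1
        have := congrFun h1 k
        rw [Matrix.col_apply] at this
        rw [this, Pi.single_apply, if_neg]
        rintro rfl; exact hks hj
      have hadjk : adjugate g k ⬝ᵥ g.col k = 1 := by
        have := congrFun (congrFun (adjugate_mul g) k) k
        rw [hdet, one_smul, one_apply_eq, mul_apply] at this
        exact this
      rcases em (∃ m, m ∉ s ∧ m ≠ k) with ⟨m, hms, hmk⟩ | hno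
      · -- make the entry at `m` a unit
        set c := Function.update (adjugate g k) m 0 with hc
        have hcm : c m = 0 := by simp [hc]
        have hcs : ∀ j ∈ s, c j = 0 := by
          intro j hj
          rw [hc, Function.update_of_ne (by rintro rfl; exact hms hj)]
          exact hadj j hj
        have hsum : adjugate g k m * g m k + 1 * (c ⬝ᵥ g.col k) = 1 := by
          rw [one_mul, ← hadjk]
          simp only [dotProduct, hc]
          rw [← Finset.add_sum_erase _ _ (Finset.mem_univ m),
            ← Finset.add_sum_erase (a := m) _ (fun i => adjugate g k i * g.col k i) (Finset.mem_univ m)]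
          simp only [Function.update_self, zero_mul, zero_add, col_apply]
          congr 1
          refine Finset.sum_congr rfl fun i hi => ?_
          rw [Function.update_of_ne (Finset.ne_of_mem_erase hi)]
        obtain ⟨y, hy⟩ := exists_isUnit_add_mul hsum
        refine mem_of_rowOp_mul_mem hG m (c := y • c) (by simp [hcm]) ?_
        set g' := (1 + vecMulVec (Pi.single m 1) (y • c)) * g with hg'
        have hcol : ∀ j, g' *ᵥ Pi.single j 1 =
            g *ᵥ Pi.single j 1 + (y * (c ⬝ᵥ g *ᵥ Pi.single j 1)) • Pi.single m 1 := by
          intro j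
          rw [hg', ← mulVec_mulVec, one_add_vecMulVec_mulVec, smul_dotProduct, smul_eq_mul]
        have hdet' : g'.det = 1 := by
          rw [hg', det_mul, hdet, det_one_add_vecMulVec]; simp [hcm]
        have hfix' : ∀ j ∈ s, g' *ᵥ Pi.single j 1 = Pi.single j 1 := by
          intro j hj
          rw [hcol, hfix j hj]; simp [hcs j hj]
        have hu : IsUnit (g' m k) := by
          have := congrFun (hcol k) m
          rw [mulVec_single_one, mulVec_single_one] at this
          simp only [col_apply, Pi.add_apply, Pi.smul_apply, Pi.single_eq_same, smul_eq_mul,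
            mul_one] at this
          rw [this]; exact hy
        obtain ⟨u, hu⟩ := hu
        refine mem_of_rowOp_mul_mem hG k (c := Pi.single m ((1 - g' k k) * ↑u⁻¹)) (by simp [hmk.symm]) ?_
        refine clear _ ?_ ?_ ?_
        · rw [det_mul, hdet', det_one_add_vecMulVec]; simp [hmk]
        · intro j hj
          rw [← mulVec_mulVec, one_add_vecMulVec_mulVec, hfix' j hj]
          have : m ≠ j := by rintro rfl; exact hms hj
          simp [this]
        · have : ((1 + vecMulVec (Pi.single k 1) (Pi.single m ((1 - g' k k) * (↑u⁻¹ : R)))) * g') *ᵥ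
              Pi.single k 1 = g' *ᵥ Pi.single k 1 + ((1 - g' k k)) • Pi.single k 1 := by
            rw [← mulVec_mulVec, one_add_vecMulVec_mulVec, mulVec_single_one]
            congr 2
            simp [← hu, mul_assoc]
          have := congrFun this k
          rw [mulVec_single_one, mulVec_single_one] at this
          simp only [col_apply, Pi.add_apply, Pi.smul_apply, Pi.single_eq_same, smul_eq_mul,
            mul_one] at this
          rw [this]; ring
      · refine clear g hdet hfix ?_
        have hg1 : g = (1 : Matrix n n R).updateCol k (g.col k) := by
          ext i j
          by_cases hj : j = k
          · subst hj; simp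
          · rw [updateCol_ne hj]
            have hjs : j ∈ s := by
              by_contra h; exact hno ⟨j, h, hj⟩
            have := congrFun (hfix j hjs) i
            rw [mulVec_single_one] at this
            rw [col_apply] at this
            rw [this, one_apply, Pi.single_apply]
        have : cramer (1 : Matrix n n R) (g.col k) k = 1 := by
          rw [cramer_apply, ← hg1, hdet]
        simpa using this
  exact key _ ∅ rfl g hg (by simp)

end Elim

/-- The functionals `f` all of whose transvections `1 + v ⊗ f` lie in `G`. -/
def transvFunctionals (G : Submonoid (Matrix n n R)) : Set (n → R) :=
  {f | ∀ v, f ⬝ᵥ v = 0 → 1 + vecMulVec v f ∈ G}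

lemma transvFunctionals_glue {G : Submonoid (Matrix n n R)} {e : R} (he : IsIdempotentElem e)
    {f f' : n → R} (hf : f ∈ transvFunctionals G) (hf' : f' ∈ transvFunctionals G) :
    e • f + (1 - e) • f' ∈ transvFunctionals G := by
  have he0 : e * (1 - e) = 0 := by rw [mul_sub, mul_one, he.eq, sub_self]
  have he1 : (1 - e) * (1 - e) = 1 - e := he.one_sub.eq
  intro v hv
  rw [add_dotProduct, smul_dotProduct, smul_dotProduct, smul_eq_mul, smul_eq_mul] at hv
  have h1 : f ⬝ᵥ (e • v) = 0 := by
    rw [dotProduct_smul, smul_eq_mul]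
    linear_combination e * hv - (f ⬝ᵥ v) * he.eq - (f' ⬝ᵥ v) * he0
  have h2 : f' ⬝ᵥ ((1 - e) • v) = 0 := by
    rw [dotProduct_smul, smul_eq_mul]
    linear_combination (1 - e) * hv - (f' ⬝ᵥ v) * he1 - (f ⬝ᵥ v) * he0
  have := G.mul_mem (hf _ h1) (hf' _ h2)
  convert this using 1
  have h3 : (f ⬝ᵥ (1 - e) • v) * e = 0 := by
    rw [dotProduct_smul, smul_eq_mul]
    linear_combination (f ⬝ᵥ v) * he0
  rw [mul_add, mul_one, add_mul, one_mul, vecMulVec_mul_vecMulVec, smul_vecMulVec,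
    smul_vecMulVec, smul_vecMulVec, vecMulVec_add, vecMulVec_smul, vecMulVec_smul, vecMulVec_smul,
    smul_smul, mul_comm e, h3, zero_smul, add_zero, add_assoc]

lemma mem_of_isUnit_det_transvFunctionals [Finite R] {G : Submonoid (Matrix n n R)}
    {F : Matrix n n R} (hF : ∀ i, F i ∈ transvFunctionals G) (hdet : IsUnit F.det)
    {g : Matrix n n R} (hg : g.det = 1) : g ∈ G := by
  have h1 : F * F⁻¹ = 1 := mul_nonsing_inv _ hdet
  have h2 : F⁻¹ * F = 1 := nonsing_inv_mul _ hdet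
  let G' : Submonoid (Matrix n n R) :=
    { carrier := {h | F⁻¹ * h * F ∈ G}
      one_mem' := by simp [h2]
      mul_mem' := by
        intro a b ha hb
        have := G.mul_mem ha hb
        have e : F⁻¹ * a * F * (F⁻¹ * b * F) = F⁻¹ * (a * b) * F := by
          calc _ = F⁻¹ * a * (F * F⁻¹) * b * F := by simp only [mul_assoc]
            _ = _ := by rw [h1, mul_one]; simp only [mul_assoc]
        rwa [e] at this }
  have hG' : ∀ i j, i ≠ j → ∀ c, transvection i j c ∈ G' := by
    intro i j hij c
    change F⁻¹ * transvection i j c * F ∈ G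
    have e : F⁻¹ * transvection i j c * F = 1 + vecMulVec (F⁻¹ *ᵥ Pi.single i c) (F j) := by
      have : transvection i j c = 1 + vecMulVec (Pi.single i c) (Pi.single j 1) := by
        rw [transvection]
        congr 1
        ext a b
        simp only [single_apply, vecMulVec_apply, Pi.single_apply, mul_ite, mul_one, mul_zero,
          eq_comm (a := i), eq_comm (a := j), ite_and]
        split_ifs <;> rfl
      rw [this, mul_add, add_mul, mul_one, h2, mul_vecMulVec, vecMulVec_mul, single_one_vecMul]
      rfl
    rw [e]
    apply hF j
    have : (F *ᵥ (F⁻¹ *ᵥ Pi.single i c)) j = 0 := by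
      rw [mulVec_mulVec, h1, one_mulVec, Pi.single_apply, if_neg hij.symm]
    exact this
  have h3 : F * g * F⁻¹ ∈ G' := by
    refine mem_of_transvections_mem hG' ?_
    rw [det_mul, det_mul, hg, mul_one, ← det_mul, h1, det_one]
  have h4 : F⁻¹ * (F * g * F⁻¹) * F ∈ G := h3
  have e : F⁻¹ * (F * g * F⁻¹) * F = g := by
    calc _ = (F⁻¹ * F) * g * (F⁻¹ * F) := by simp only [mul_assoc]
      _ = g := by rw [h2, one_mul, mul_one]
  rwa [e] at h4

lemma exists_det_notMem_of_span_eq_top {s : Set (n → R)} (hs : Submodule.span R s = ⊤)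
    (M : Ideal R) [hM : M.IsMaximal] : ∃ F : Matrix n n R, (∀ i, F i ∈ s) ∧ F.det ∉ M := by
  let _ := Ideal.Quotient.field M
  set π := Ideal.Quotient.mk M
  let s' : Set (n → R ⧸ M) := (fun f i => π (f i)) '' s
  have hs' : Submodule.span (R ⧸ M) s' = ⊤ := by
    have h1 : ∀ f : n → R, (fun i => π (f i)) ∈ Submodule.span (R ⧸ M) s' := by
      intro f
      have hf : f ∈ Submodule.span R s := hs ▸ Submodule.mem_top
      induction hf using Submodule.span_induction with
      | mem x hx => exact Submodule.subset_span ⟨x, hx, rfl⟩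
      | zero =>
        convert Submodule.zero_mem _ using 1
        ext i; simp
      | add x y _ _ hx hy =>
        have := Submodule.add_mem _ hx hy
        convert this using 1
        ext i; simp
      | smul a x _ hx =>
        have := Submodule.smul_mem _ (π a) hx
        convert this using 1
        ext i; simp
    rw [eq_top_iff]
    intro y _
    choose f hf using fun i => Ideal.Quotient.mk_surjective (I := M) (y i)
    have := h1 f
    convert this using 1
    ext i; exact (hf i).symm
  obtain ⟨f, hf, -, hli⟩ := Submodule.exists_fun_fin_finrank_span_eq (R ⧸ M) s'
  have hcard : Module.finrank (R ⧸ M) (Submodule.span (R ⧸ M) s') = Fintype.card n := by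
    rw [hs', finrank_top, Module.finrank_fintype_fun_eq_card]
  let ε : n ≃ Fin (Module.finrank (R ⧸ M) (Submodule.span (R ⧸ M) s')) :=
    Fintype.equivOfCardEq (by simp [hcard])
  choose F hFs hF using fun i => hf (ε i)
  refine ⟨F, hFs, fun hmem => ?_⟩
  have hli' : LinearIndependent (R ⧸ M) (Matrix.row (fun i => f (ε i)) : n → n → R ⧸ M) :=
    hli.comp ε ε.injective
  have hli' : IsUnit (Matrix.of fun i => f (ε i)) := linearIndependent_rows_iff_isUnit.1 hli'
  rw [isUnit_iff_isUnit_det] at hli'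
  have e : Matrix.of (fun i => f (ε i)) = Matrix.map (Matrix.of F) π := by
    ext i j
    change f (ε i) j = π (F i j)
    rw [← hF i]
  rw [e] at hli'
  have : (Matrix.map (Matrix.of F) π).det = π (Matrix.det (Matrix.of F)) := (RingHom.map_det π (Matrix.of F)).symm
  have hz : π (Matrix.det (Matrix.of F)) = 0 := Ideal.Quotient.eq_zero_iff_mem.2 hmem
  rw [this, hz] at hli'
  exact not_isUnit_zero hli'

lemma mem_of_span_transvFunctionals [Finite R] {G : Submonoid (Matrix n n R)}
    (hs : Submodule.span R (transvFunctionals G) = ⊤)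
    {g : Matrix n n R} (hg : g.det = 1) : g ∈ G := by
  classical
  have : Finite (Matrix n n R) := inferInstanceAs (Finite (n → n → R))
  let good : Matrix n n R → ℕ := fun F => Set.ncard {M : MaximalSpectrum R | F.det ∉ M.asIdeal}
  have hne : ({F : Matrix n n R | ∀ i, F i ∈ transvFunctionals G}).Nonempty :=
    ⟨0, fun i v _ => by
      change 1 + vecMulVec v (0 : n → R) ∈ G
      simp⟩
  obtain ⟨F, hF, hmax⟩ := Set.exists_max_image _ good (Set.toFinite _) hne
  refine mem_of_isUnit_det_transvFunctionals hF ?_ hg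
  by_contra hu
  obtain ⟨M, hM, hmem⟩ := exists_max_ideal_of_mem_nonunits hu
  obtain ⟨F', hF', hF'M⟩ := exists_det_notMem_of_span_eq_top hs M
  obtain ⟨N, hN, he⟩ := exists_pow_isIdempotentElem F.det
  set e := F.det ^ N
  have hglue : ∀ i, (e • F + (1 - e) • F') i ∈ transvFunctionals G :=
    fun i => transvFunctionals_glue he (hF i) (hF' i)
  refine absurd (hmax _ hglue) (not_le.2 ?_)
  have hmod0 : ∀ P : Ideal R, P.IsMaximal → F.det ∈ P →
      ((e • F + (1 - e) • F').det ∈ P ↔ F'.det ∈ P) := by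
    intro P hP h
    have h0 : Ideal.Quotient.mk P e = 0 :=
      Ideal.Quotient.eq_zero_iff_mem.2 (P.pow_mem_of_mem h _ hN)
    rw [← Ideal.Quotient.eq_zero_iff_mem, ← Ideal.Quotient.eq_zero_iff_mem, RingHom.map_det,
      RingHom.map_det]
    suffices (Ideal.Quotient.mk P).mapMatrix (e • F + (1 - e) • F') =
      (Ideal.Quotient.mk P).mapMatrix F' by rw [this]
    ext i j
    simp [h0]
  have hmod1 : ∀ P : Ideal R, P.IsMaximal → F.det ∉ P →
      (e • F + (1 - e) • F').det ∉ P := by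
    intro P hP h
    have hPp := hP.isPrime
    have h0 : Ideal.Quotient.mk P e = 1 := by
      rw [← sub_eq_zero, ← map_one (Ideal.Quotient.mk P), ← map_sub,
        Ideal.Quotient.eq_zero_iff_mem]
      have : e * (e - 1) ∈ P := by rw [mul_sub, mul_one, he.eq, sub_self]; exact P.zero_mem
      exact (hPp.mem_or_mem this).resolve_left fun h' => h (hPp.mem_of_pow_mem _ h')
    rw [← Ideal.Quotient.eq_zero_iff_mem, RingHom.map_det]
    rw [← Ideal.Quotient.eq_zero_iff_mem, RingHom.map_det] at h
    suffices (Ideal.Quotient.mk P).mapMatrix (e • F + (1 - e) • F') =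
      (Ideal.Quotient.mk P).mapMatrix F by rwa [this]
    ext i j
    simp [h0]
  have hfin : Finite (MaximalSpectrum R) := inferInstance
  refine Set.ncard_lt_ncard ?_ (Set.toFinite _)
  refine ⟨fun P hP => hmod1 _ P.isMaximal hP, fun hsub => ?_⟩
  exact hsub (a := ⟨M, hM⟩) (fun h => hF'M ((hmod0 M hM hmem).1 h)) hmem

lemma exists_inverse_mem [Finite R] {G : Submonoid (Matrix n n R)} (hu : ∀ g ∈ G, IsUnit g)
    {g : Matrix n n R} (hg : g ∈ G) : ∃ h ∈ G, g * h = 1 ∧ h * g = 1 := by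
  have : Finite (Matrix n n R) := inferInstanceAs (Finite (n → n → R))
  obtain ⟨N, hN, he⟩ := exists_pow_isIdempotentElem g
  have h1 : g ^ N = 1 := by
    have := ((hu g hg).pow N).mul_left_cancel (b := g ^ N) (c := 1) (by rw [he.eq, mul_one])
    exact this
  obtain ⟨m, rfl⟩ := Nat.exists_eq_succ_of_ne_zero hN.ne'
  exact ⟨g ^ m, G.pow_mem hg m, by rw [← pow_succ', h1], by rw [← pow_succ, h1]⟩

lemma vecMulVec_conj {k k' : Matrix n n R} (h : k' * k = 1) (v f : n → R) :
    1 + vecMulVec v (f ᵥ* k) = k' * (1 + vecMulVec (k *ᵥ v) f) * k := by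
  rw [mul_add, add_mul, mul_one, h, mul_vecMulVec, vecMulVec_mul, mulVec_mulVec, h, one_mulVec]

/-- A group of invertible matrices over a finite ring contains `SL_n` (`n ≥ 3`) as soon as it
contains enough transvections along `f` on one factor, transvections along `f` up to an
uncontrolled contribution of the first factor on the other, and the orbit of `f` spans. -/
lemma mem_of_transvections [Finite R] (hn : 3 ≤ Fintype.card n) {G : Submonoid (Matrix n n R)}
    (hu : ∀ g ∈ G, IsUnit g) {e : R} (he : IsIdempotentElem e) (f : n → R)
    (H1 : ∀ v, f ⬝ᵥ v = 0 → e • v = v → 1 + vecMulVec v f ∈ G)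
    (H2 : ∀ v, f ⬝ᵥ v = 0 → ∃ g ∈ G, (1 - e) • g = (1 - e) • (1 + vecMulVec v f))
    (H3 : Submodule.span R {x | ∃ g ∈ G, f ᵥ* g = x} = ⊤)
    {g : Matrix n n R} (hg : g.det = 1) : g ∈ G := by
  have he0 : e * (1 - e) = 0 := by rw [mul_sub, mul_one, he.eq, sub_self]
  have he0' : (1 - e) * e = 0 := by rw [mul_comm, he0]
  have he1 : (1 - e) * (1 - e) = 1 - e := he.one_sub.eq
  have split : ∀ a b c d : Matrix n n R,
      (e • a + (1 - e) • b) * (e • c + (1 - e) • d) = e • (a * c) + (1 - e) • (b * d) := by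
    intro a b c d
    simp only [add_mul, mul_add, smul_mul_assoc, mul_smul_comm, smul_add, smul_smul, he0, he0', he1, he.eq,
      zero_smul, add_zero, zero_add]
  have self : ∀ a : Matrix n n R, e • a + (1 - e) • a = a := by
    intro a; rw [← add_smul]; simp
  have hmix : ∀ {x y x' y' : Matrix n n R}, (1 - e) • x = (1 - e) • x' → (1 - e) • y = (1 - e) • y' →
      (1 - e) • (x * y) = (1 - e) • (x' * y') := by
    intro x y x' y' hx hy
    rw [← smul_mul_assoc, hx, smul_mul_assoc, ← mul_smul_comm, hy, mul_smul_comm]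
  let G2 : Submonoid (Matrix n n R) :=
    { carrier := {g | e • g + (1 - e) • (1 : Matrix n n R) ∈ G}
      one_mem' := by
        change _ ∈ G
        rw [self]; exact G.one_mem
      mul_mem' := by
        intro a b ha hb
        have := G.mul_mem ha hb
        rwa [split, mul_one] at this }
  let G1 : Submonoid (Matrix n n R) :=
    { carrier := {g | ∃ h ∈ G, (1 - e) • h = (1 - e) • g}
      one_mem' := ⟨1, G.one_mem, rfl⟩
      mul_mem' := by
        rintro a b ⟨x, hx, hxa⟩ ⟨y, hy, hyb⟩
        exact ⟨x * y, G.mul_mem hx hy, hmix hxa hyb⟩ }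
  have hG2 : ∀ g : Matrix n n R, g.det = 1 → g ∈ G2 := by
    intro g hg
    refine mem_of_span_transvFunctionals ?_ hg
    refine eq_top_iff.2 (H3 ▸ Submodule.span_mono ?_)
    rintro _ ⟨k, hk, rfl⟩ v hv
    obtain ⟨k', hk', h1, h2⟩ := exists_inverse_mem hu hk
    change e • (1 + vecMulVec v (f ᵥ* k)) + (1 - e) • (1 : Matrix n n R) ∈ G
    have h3 : e • (1 + vecMulVec v (f ᵥ* k)) + (1 - e) • (1 : Matrix n n R) =
        1 + vecMulVec (e • v) (f ᵥ* k) := by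
      rw [smul_add, add_right_comm, self, smul_vecMulVec]
    rw [h3, vecMulVec_conj h2]
    refine G.mul_mem (G.mul_mem hk' (H1 _ ?_ ?_)) hk
    · rw [dotProduct_mulVec, dotProduct_smul, hv, smul_zero]
    · rw [mulVec_smul, smul_smul, he.eq]
  have hG1 : ∀ g : Matrix n n R, g.det = 1 → g ∈ G1 := by
    intro g hg
    refine mem_of_span_transvFunctionals ?_ hg
    refine eq_top_iff.2 (H3 ▸ Submodule.span_mono ?_)
    rintro _ ⟨k, hk, rfl⟩ v hv
    obtain ⟨k', hk', h1, h2⟩ := exists_inverse_mem hu hk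
    obtain ⟨g, hg, hgv⟩ := H2 (k *ᵥ v) (by rw [dotProduct_mulVec, hv])
    refine ⟨k' * g * k, G.mul_mem (G.mul_mem hk' hg) hk, ?_⟩
    rw [vecMulVec_conj h2, ← smul_mul_assoc, ← mul_smul_comm, hgv, mul_smul_comm, smul_mul_assoc]
  refine mem_of_transvections_mem (fun i j hij c => ?_) hg
  obtain ⟨l, hl⟩ : ∃ l, l ∉ ({i, j} : Finset n) := by
    by_contra! h
    have : Fintype.card n ≤ ({i, j} : Finset n).card := Finset.card_le_card fun x _ => h x
    have := Finset.card_le_two (a := i) (b := j)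
    omega
  have hil : i ≠ l := by rintro rfl; simp at hl
  have hlj : l ≠ j := by rintro rfl; simp at hl
  obtain ⟨a, ha, haA⟩ := hG1 _ (det_transvection_of_ne i l hil c)
  obtain ⟨b, hb, hbB⟩ := hG1 _ (det_transvection_of_ne l j hlj 1)
  obtain ⟨a', ha', haa, haa'⟩ := exists_inverse_mem hu ha
  obtain ⟨b', hb', hbb, hbb'⟩ := exists_inverse_mem hu hb
  set E := transvection i j c with hE
  have hEdet : E.det = 1 := det_transvection_of_ne i j hij c
  have hcomm : transvection i l c * transvection l j 1 = E * transvection l j 1 * transvection i l c := by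
    simp only [hE, transvection, mul_add, add_mul, mul_one, one_mul, single_mul_single_same,
      single_mul_single_of_ne _ _ _ _ hij.symm,
      single_mul_single_of_ne _ _ _ _ hlj.symm, add_zero]
    abel
  set d := a * b * a' * b' with hd
  have hdG : d ∈ G := G.mul_mem (G.mul_mem (G.mul_mem ha hb) ha') hb'
  have hd1 : (1 - e) • d = (1 - e) • E := by
    have h1 : (1 - e) • (a * b) = (1 - e) • (E * b * a) := by
      rw [hmix haA hbB, hcomm]
      exact (hmix (hmix rfl hbB) haA).symm
    have h2 : (1 - e) • (a * b * (a' * b')) = (1 - e) • (E * b * a * (a' * b')) := hmix h1 rfl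
    have h3 : E * b * a * (a' * b') = E := by
      calc _ = E * (b * (a * a') * b') := by simp only [mul_assoc]
        _ = E := by rw [haa, mul_one, hbb, mul_one]
    rw [h3] at h2
    rw [← h2, hd, mul_assoc]
  have hddet : d.det = 1 := by
    have h1 : a.det * a'.det = 1 := by rw [← det_mul, haa, det_one]
    have h2 : b.det * b'.det = 1 := by rw [← det_mul, hbb, det_one]
    rw [hd, det_mul, det_mul, det_mul]
    linear_combination (b.det * b'.det) * h1 + h2
  have h1 := hG2 d hddet
  have h2 := hG2 E hEdet
  obtain ⟨x, hx, hx1, hx2⟩ := exists_inverse_mem hu h1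
  have h3 : e • (1 : Matrix n n R) + (1 - e) • E ∈ G := by
    have : d = (e • d + (1 - e) • 1) * (e • (1 : Matrix n n R) + (1 - e) • E) := by
      rw [split, mul_one, one_mul, ← hd1, self]
    have h4 : x * d = e • (1 : Matrix n n R) + (1 - e) • E := by
      conv_lhs => rw [this]
      rw [← mul_assoc, hx2, one_mul]
    rw [← h4]; exact G.mul_mem hx hdG
  have := G.mul_mem h2 h3
  rwa [split, mul_one, one_mul, self] at this

end MatrixGroups

section Places

variable (F E K L : Type*) [Field F] [Field E] [Algebra F E] [Normal F E]
  [Field L] [Algebra F L] [Algebra E L] [IsScalarTower F E L]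

section Decomposition

variable [Field K] [Algebra F K] [Algebra K L] [IsScalarTower F K L]

/-- The group of automorphisms of `E/F` induced by automorphisms of `L/K`. -/
def decompositionGroup : Subgroup (E ≃ₐ[F] E) :=
  ((AlgEquiv.restrictNormalHom (F := F) (K₁ := L) E).comp
    (AlgEquiv.restrictScalarsHom F (S := K) (A := L))).range

variable {F E K L}

lemma exists_mem_decompositionGroup (τ : L ≃ₐ[K] L) :
    ∃ σ ∈ decompositionGroup F E K L, ∀ x, algebraMap E L (σ x) = τ (algebraMap E L x) :=
  ⟨_, ⟨τ, rfl⟩, fun x => AlgEquiv.restrictNormal_commutes _ E x⟩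

lemma exists_algEquiv_of_mem_decompositionGroup {σ : E ≃ₐ[F] E}
    (hσ : σ ∈ decompositionGroup F E K L) :
    ∃ τ : L ≃ₐ[K] L, ∀ x, algebraMap E L (σ x) = τ (algebraMap E L x) := by
  obtain ⟨τ, rfl⟩ := hσ
  exact ⟨τ, fun x => AlgEquiv.restrictNormal_commutes _ E x⟩

lemma ncard_orbit_decompositionGroup [Normal K L] {x : E} (hx : IsSeparable F x) :
    Set.ncard {y | ∃ σ ∈ decompositionGroup F E K L, σ x = y} =
      (minpoly K (algebraMap E L x)).natDegree := by
  have hsep : IsSeparable K (algebraMap E L x) := by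
    have : IsSeparable F (algebraMap E L x) := by
      unfold IsSeparable
      rwa [minpoly.algebraMap_eq (algebraMap E L).injective]
    exact this.tower_top K
  have himg : algebraMap E L '' {y | ∃ σ ∈ decompositionGroup F E K L, σ x = y} =
      (minpoly K (algebraMap E L x)).rootSet L := by
    ext z
    constructor
    · rintro ⟨_, ⟨σ, hσ, rfl⟩, rfl⟩
      obtain ⟨τ, hτ⟩ := exists_algEquiv_of_mem_decompositionGroup hσ
      rw [hτ, mem_rootSet]
      refine ⟨minpoly.ne_zero (Algebra.IsIntegral.isIntegral _), ?_⟩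
      have : aeval (τ (algebraMap E L x)) (minpoly K (algebraMap E L x)) =
        τ (aeval (algebraMap E L x) (minpoly K (algebraMap E L x))) := aeval_algHom_apply τ.toAlgHom _ _
      rw [this, minpoly.aeval, map_zero]
    · intro hz
      have hz' := (mem_rootSet.1 hz).2
      obtain ⟨τ, hτ⟩ := minpoly.exists_algEquiv_of_root
        (Algebra.IsAlgebraic.isAlgebraic (R := K) (algebraMap E L x)) hz'
      obtain ⟨σ, hσ, h⟩ := exists_mem_decompositionGroup (F := F) (E := E) τ.symm
      exact ⟨σ x, ⟨σ, hσ, rfl⟩, by rw [h, ← hτ, AlgEquiv.symm_apply_apply]⟩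
  rw [← Set.ncard_image_of_injective _ (algebraMap E L).injective, himg,
    ← Nat.card_coe_set_eq, Nat.card_eq_fintype_card,
    card_rootSet_eq_natDegree hsep (Normal.splits inferInstance _)]

end Decomposition

variable [NontriviallyNormedField K] [IsUltrametricDist K] [CompleteSpace K] [Algebra F K]
  [Algebra K L] [IsScalarTower F K L] [Normal K L]

/-- The absolute value on `E` induced by the norm of `K`. -/
def placeAbs : AbsoluteValue E ℝ where
  toFun x := spectralNorm K L (algebraMap E L x)
  map_mul' x y := by rw [map_mul]; exact map_mul (spectralMulAlgNorm K L) _ _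
  nonneg' x := spectralNorm_nonneg _
  eq_zero' x := by
    constructor
    · intro h
      have := eq_zero_of_map_spectralNorm_eq_zero h (Algebra.IsAlgebraic.isAlgebraic _)
      simpa using this
    · rintro rfl
      rw [map_zero, spectralNorm_zero]
  add_le' x y := by
    rw [map_add]
    exact IsNonarchimedean.add_le spectralNorm_nonneg isNonarchimedean_spectralNorm

variable {F E K L}

lemma placeAbs_apply (x : E) : placeAbs E K L x = spectralNorm K L (algebraMap E L x) := rfl

lemma isNonarchimedean_placeAbs : IsNonarchimedean (placeAbs E K L) := by
  intro x y
  simp only [placeAbs_apply, map_add]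
  exact isNonarchimedean_spectralNorm _ _

lemma placeAbs_algebraMap (f : F) : placeAbs E K L (algebraMap F E f) = ‖algebraMap F K f‖ := by
  rw [placeAbs_apply, ← IsScalarTower.algebraMap_apply, IsScalarTower.algebraMap_apply F K L,
    spectralNorm_extends]

lemma placeAbs_map {σ : E ≃ₐ[F] E} (hσ : σ ∈ decompositionGroup F E K L) (x : E) :
    placeAbs E K L (σ x) = placeAbs E K L x := by
  obtain ⟨τ, hτ⟩ := exists_algEquiv_of_mem_decompositionGroup hσ
  rw [placeAbs_apply, hτ, placeAbs_apply, ← spectralNorm_eq_of_equiv]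

lemma placeAbs_pow_ncard {x : E} (hx : IsSeparable F x) :
    placeAbs E K L x ^ Set.ncard {y | ∃ σ ∈ decompositionGroup F E K L, σ x = y} =
      ‖(minpoly K (algebraMap E L x)).coeff 0‖ := by
  have h0 := minpoly.natDegree_pos (Algebra.IsIntegral.isIntegral (R := K) (algebraMap E L x))
  rw [ncard_orbit_decompositionGroup hx, placeAbs_apply,
    spectralNorm.spectralNorm_eq_norm_coeff_zero_rpow, ← Real.rpow_natCast, ← Real.rpow_mul
    (norm_nonneg _), one_div, inv_mul_cancel₀ (by positivity), Real.rpow_one]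

lemma exists_placeAbs_pow_ncard {t : F} (hval : ∀ c : K, c ≠ 0 → ∃ n : ℤ, ‖c‖ = ‖algebraMap F K t‖ ^ n)
    {x : E} (hx0 : x ≠ 0) (hx : IsSeparable F x) : ∃ n : ℤ,
    placeAbs E K L x ^ Set.ncard {y | ∃ σ ∈ decompositionGroup F E K L, σ x = y} =
      placeAbs E K L (algebraMap F E t) ^ n := by
  rw [placeAbs_pow_ncard hx, placeAbs_algebraMap]
  exact hval _ (minpoly.coeff_zero_ne_zero (Algebra.IsIntegral.isIntegral (R := K) _) (by simpa))

lemma exists_placeAbs_sub_lt_of_fixed {k' : Type*} [Field k'] (κ : k' →+* K)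
    (hres : ∀ c : K, ‖c‖ ≤ 1 → ∃ a, ‖c - κ a‖ < 1) {x : E} (hx : IsSeparable F x)
    (hfix : ∀ σ ∈ decompositionGroup F E K L, σ x = x) (hx1 : placeAbs E K L x ≤ 1) :
    ∃ a, ∀ f, algebraMap F K f = κ a → placeAbs E K L (x - algebraMap F E f) < 1 := by
  have h1 : (minpoly K (algebraMap E L x)).natDegree = 1 := by
    rw [← ncard_orbit_decompositionGroup (F := F) hx]
    have : {y | ∃ σ ∈ decompositionGroup F E K L, σ x = y} = {x} := by
      ext y
      constructor
      · rintro ⟨σ, hσ, rfl⟩; exact hfix σ hσ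
      · rintro rfl; exact ⟨1, one_mem _, rfl⟩
    rw [this, Set.ncard_singleton]
  obtain ⟨c, hc⟩ := minpoly.natDegree_eq_one_iff.1 h1
  rw [placeAbs_apply, ← hc, spectralNorm_extends] at hx1
  obtain ⟨a, ha⟩ := hres c hx1
  refine ⟨a, fun f hf => ?_⟩
  rwa [placeAbs_apply, map_sub, ← IsScalarTower.algebraMap_apply, IsScalarTower.algebraMap_apply F K L,
    ← hc, ← map_sub, spectralNorm_extends, hf]

lemma placeAbs_map_sub_lt {k' : Type*} [Field k'] [IsAlgClosed k'] (κ : k' →+* K)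
    (hres : ∀ c : K, ‖c‖ ≤ 1 → ∃ a, ‖c - κ a‖ < 1) {σ : E ≃ₐ[F] E}
    (hσ : σ ∈ decompositionGroup F E K L) {x : E} (hx1 : placeAbs E K L x ≤ 1) :
    placeAbs E K L (σ x - x) < 1 := by
  obtain ⟨τ, hτ⟩ := exists_algEquiv_of_mem_decompositionGroup hσ
  rw [placeAbs_apply] at hx1 ⊢
  rw [map_sub, hτ]
  set y := algebraMap E L x
  let := spectralNorm.normedField K L
  have hnorm : ∀ z : L, ‖z‖ = spectralNorm K L z := fun _ => rfl
  have hna : IsNonarchimedean (norm : L → ℝ) := isNonarchimedean_spectralNorm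
  have hext : ∀ z : K, ‖algebraMap K L z‖ = ‖z‖ := fun z => spectralNorm_extends z
  suffices h : ∃ b : k', ‖y - algebraMap K L (κ b)‖ < 1 by
    obtain ⟨b, hb⟩ := h
    have h1 : ‖τ y - algebraMap K L (κ b)‖ < 1 := by
      have : τ y - algebraMap K L (κ b) = τ (y - algebraMap K L (κ b)) := by simp
      rw [this, hnorm, ← spectralNorm_eq_of_equiv]
      exact hb
    have h2 : τ y - y = (τ y - algebraMap K L (κ b)) + (- (y - algebraMap K L (κ b))) := by ring
    rw [← hnorm, h2]
    refine (hna _ _).trans_lt (max_lt h1 ?_)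
    rwa [norm_neg]
  have hmon := minpoly.monic (Algebra.IsIntegral.isIntegral (R := K) y)
  have hco := (spectralValue_le_one_iff hmon).1 hx1
  choose a ha using fun n => hres _ (hco n)
  set P := minpoly K y
  set N := P.natDegree
  have hN : 0 < N := minpoly.natDegree_pos (Algebra.IsIntegral.isIntegral (R := K) y)
  let Q : k'[X] := X ^ N + ∑ n ∈ Finset.range N, C (a n) * X ^ n
  have hQm : Q.Monic := monic_X_pow_add (by
    refine (degree_sum_le _ _).trans_lt ?_
    rw [Finset.sup_lt_iff (by exact WithBot.bot_lt_coe N)]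
    intro b hb
    exact (degree_C_mul_X_pow_le _ _).trans_lt (by exact_mod_cast Finset.mem_range.1 hb))
  have hQs := IsAlgClosed.splits Q
  have hev : aeval y (Q.map κ) = ∑ n ∈ Finset.range N, algebraMap K L (κ (a n) - P.coeff n) * y ^ n := by
    have h0 : aeval y P = 0 := minpoly.aeval K y
    have h1 : aeval y P = y ^ N + ∑ n ∈ Finset.range N, algebraMap K L (P.coeff n) * y ^ n := by
      conv_lhs => rw [hmon.as_sum]
      simp [N]
    rw [h1] at h0
    have : y ^ N = - ∑ n ∈ Finset.range N, algebraMap K L (P.coeff n) * y ^ n := by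
      linear_combination h0
    simp [Q, Polynomial.map_sum, this, sub_mul, Finset.sum_sub_distrib]
    ring
  have hlt : ‖aeval y (Q.map κ)‖ < 1 := by
    rw [hev]
    obtain ⟨n, hn, hle⟩ := hna.finset_image_add_of_nonempty
      (fun n => algebraMap K L (κ (a n) - P.coeff n) * y ^ n) (t := Finset.range N)
      ⟨0, Finset.mem_range.2 hN⟩
    refine hle.trans_lt ?_
    rw [norm_mul, norm_pow, hext, norm_sub_rev]
    have h2 : ‖y‖ ^ n ≤ 1 := pow_le_one₀ (norm_nonneg _) hx1
    calc _ ≤ ‖P.coeff n - κ (a n)‖ * 1 := by gcongr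
      _ < 1 := by rw [mul_one]; exact ha n
  by_contra! hcon
  refine absurd hlt (not_lt.2 ?_)
  rw [hQs.eq_prod_roots_of_monic hQm, Polynomial.map_multiset_prod, map_multiset_prod,
    Multiset.map_map, Multiset.map_map, ← coe_nnnorm, ← NNReal.coe_one, NNReal.coe_le_coe]
  generalize Q.roots = s
  induction s using Multiset.induction with
  | empty => simp
  | cons b s ih =>
    rw [Multiset.map_cons, Multiset.prod_cons, nnnorm_mul]
    refine one_le_mul_of_one_le_of_one_le ?_ ih
    have := hcon b
    rw [← NNReal.coe_le_coe]
    simpa using this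

end Places

section ExistsPlace

variable {F E : Type*} [Field F] [Field E] [Algebra F E]

/-- A place of `E` with absolute value `v` and decomposition group `Γ`, discrete on a subfield
which contains `t` and has residue field `k'`. -/
structure IsPlace (v : AbsoluteValue E ℝ) (Γ : Subgroup (E ≃ₐ[F] E)) (t : F) : Prop where
  nonarch : IsNonarchimedean v
  map_eq : ∀ σ ∈ Γ, ∀ x, v (σ x) = v x
  orbit : ∀ x, x ≠ 0 → IsSeparable F x →
    ∃ n : ℤ, v x ^ Set.ncard {y | ∃ σ ∈ Γ, σ x = y} = v (algebraMap F E t) ^ n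

open WithZero in
lemma nonempty_rankOne_of_surjective {K : Type*} [Field K] (w : Valuation K (WithZero (Multiplicative ℤ)))
    (hw : Function.Surjective w) : Nonempty w.RankOne := by
  have : IsCyclic (WithZero (Multiplicative ℤ))ˣ :=
    isCyclic_of_surjective (WithZero.unitsWithZeroEquiv (α := Multiplicative ℤ)).symm.toMonoidHom
      (MulEquiv.surjective _)
  have : Nontrivial (MonoidWithZeroHom.valueGroup (MonoidWithZeroHom.ofClass w)) := by
    obtain ⟨x, hx⟩ := hw (exp (1 : ℤ))
    have hx' : w x ≠ 0 := by rw [hx]; exact exp_ne_zero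
    refine ⟨1, ⟨Units.mk0 (w x) hx', ?_⟩, ?_⟩
    · exact Subgroup.subset_closure ⟨x, rfl⟩
    · intro h
      have h2 := congrArg Units.val (congrArg Subtype.val h)
      have h3 : (1 : WithZero (Multiplicative ℤ)) = exp (1 : ℤ) := by rw [← hx]; exact h2
      rw [← exp_zero, exp_inj] at h3
      exact absurd h3 (by norm_num)
  have := Valuation.IsRankOneDiscrete.mk' w
  exact ⟨Valuation.IsRankOneDiscrete.rankOne w (e := 2) (by norm_num)⟩

open WithZero Valued in
lemma exists_place [IsAlgClosure F E] {K k' : Type*} [Field K] [Valued K (WithZero (Multiplicative ℤ))]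
    [CompleteSpace K] (hsurj : Function.Surjective (Valued.v : Valuation K (WithZero (Multiplicative ℤ))))
    [Field k'] (i : F →+* K) (κ : k' →+* K)
    (hres : ∀ c : K, v c ≤ 1 → ∃ a, v (c - κ a) < 1) {t : F} {s : ℤ}
    (ht : v (i t) = exp s) (hs : IsUnit s) :
    ∃ (w : AbsoluteValue E ℝ) (Γ : Subgroup (E ≃ₐ[F] E)), IsPlace w Γ t ∧
      (0 < s → 1 < w (algebraMap F E t)) ∧ (s < 0 → w (algebraMap F E t) < 1) ∧
      (IsAlgClosed k' → ∀ σ ∈ Γ, ∀ x, w x ≤ 1 → w (σ x - x) < 1) ∧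
      ∀ x, IsSeparable F x → (∀ σ ∈ Γ, σ x = x) → w x ≤ 1 →
        ∃ a, ∀ f, i f = κ a → w (x - algebraMap F E f) < 1 := by
  obtain ⟨_⟩ := nonempty_rankOne_of_surjective _ hsurj
  let : NontriviallyNormedField K := Valued.toNontriviallyNormedField K (WithZero (Multiplicative ℤ))
  have : IsUltrametricDist K := inferInstanceAs (@IsUltrametricDist K
    (Valued.toNormedField K (WithZero (Multiplicative ℤ))).toMetricSpace.toPseudoMetricSpace.toDist)
  have hle : ∀ x y : K, ‖x‖ ≤ ‖y‖ ↔ (v x : WithZero (Multiplicative ℤ)) ≤ v y :=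
    fun x y => Valued.toNormedField.norm_le_iff
  have hlt : ∀ x y : K, ‖x‖ < ‖y‖ ↔ (v x : WithZero (Multiplicative ℤ)) < v y :=
    fun x y => by rw [← not_le, ← not_le, hle]
  have heq : ∀ x y : K, (v x : WithZero (Multiplicative ℤ)) = v y → ‖x‖ = ‖y‖ :=
    fun x y h => le_antisymm ((hle _ _).2 h.le) ((hle _ _).2 h.ge)
  have hres' : ∀ c : K, ‖c‖ ≤ 1 → ∃ a, ‖c - κ a‖ < 1 := by
    intro c hc
    rw [← norm_one (α := K), hle, map_one] at hc
    obtain ⟨a, ha⟩ := hres c hc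
    refine ⟨a, ?_⟩
    rwa [← norm_one (α := K), hlt, map_one]
  have hval : ∀ c : K, c ≠ 0 → ∃ n : ℤ, ‖c‖ = ‖i t‖ ^ n := by
    intro c hc
    refine ⟨s * log (v c : WithZero (Multiplicative ℤ)), ?_⟩
    rw [← norm_zpow]
    apply heq
    rw [map_zpow₀, ht, ← exp_zsmul, smul_eq_mul, mul_right_comm]
    rcases Int.isUnit_iff.1 hs with h | h <;> subst h <;> simp [exp_log, hc]
  let := i.toAlgebra
  let L := AlgebraicClosure K
  let j : E →ₐ[F] L := IsAlgClosed.lift (S := E) (M := L)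
  let := j.toRingHom.toAlgebra
  have : IsScalarTower F E L := IsScalarTower.of_algebraMap_eq fun x => (j.commutes x).symm
  have : Normal F E := IsAlgClosure.normal F E
  have hw : ∀ f, placeAbs E K L (algebraMap F E f) = ‖i f‖ := placeAbs_algebraMap
  refine ⟨placeAbs E K L, decompositionGroup F E K L, ⟨isNonarchimedean_placeAbs, fun σ hσ x =>
    placeAbs_map hσ x, fun x hx0 hx => exists_placeAbs_pow_ncard hval hx0 hx⟩, ?_, ?_, ?_, ?_⟩
  · intro h
    rw [hw, ← norm_one (α := K), hlt, ht, map_one, ← exp_zero, exp_lt_exp]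
    exact h
  · intro h
    rw [hw, ← norm_one (α := K), hlt, ht, map_one, ← exp_zero, exp_lt_exp]
    exact h
  · intro _ σ hσ x hx
    exact placeAbs_map_sub_lt κ hres' hσ hx
  · intro x hx hfix hx1
    exact exists_placeAbs_sub_lt_of_fixed κ hres' hx hfix hx1

open LaurentSeries WithZero in
lemma exists_valuation_sub_C_lt_one {k : Type*} [Field k] (c : k⸨X⸩)
    (hc : (Valued.v c : WithZero (Multiplicative ℤ)) ≤ 1) :
    ∃ a : k, (Valued.v (c - HahnSeries.C a) : WithZero (Multiplicative ℤ)) < 1 := by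
  refine ⟨c.coeff 0, ?_⟩
  have h1 := (LaurentSeries.valuation_le_iff_coeff_lt_eq_zero k (D := 0) (f := c)).1 (by simpa using hc)
  have h2 : (Valued.v (c - HahnSeries.C (c.coeff 0)) : WithZero (Multiplicative ℤ)) ≤ exp (-1) := by
    rw [LaurentSeries.valuation_le_iff_coeff_lt_eq_zero]
    intro n hn
    rcases lt_or_eq_of_le (Int.lt_add_one_iff.1 (show n < 0 + 1 by simpa using hn)) with h | h
    · simp [h1 n h, HahnSeries.C_apply, HahnSeries.coeff_single_of_ne h.ne]
    · subst h; simp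
  refine h2.trans_lt ?_
  rw [← exp_zero, exp_lt_exp]; norm_num

open LaurentSeries WithZero in
lemma exists_ringHom_laurentSeries {k k' F : Type*} [Field k] [Field k'] [Field F] [Algebra k[X] F]
    [IsFractionRing k[X] F] (ι : k →+* k') {s : ℤ} (hs : s ≠ 0) :
    ∃ i : F →+* k'⸨X⸩, (∀ c, i (algebraMap k[X] F (C c)) = HahnSeries.C (ι c)) ∧
      i (algebraMap k[X] F X) = HahnSeries.single s 1 := by
  let f : k[X] →+* k'⸨X⸩ := eval₂RingHom (HahnSeries.C.comp ι) (HahnSeries.single s 1)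
  have hf : Function.Injective f := by
    rw [injective_iff_map_eq_zero]
    intro p hp
    by_contra hp0
    have h1 : ∀ n : ℕ, (HahnSeries.single s (1 : k')) ^ n = HahnSeries.single (n * s) 1 := by
      intro n; rw [HahnSeries.single_pow]; simp
    have h2 : (f p).coeff (p.natDegree * s) = ι p.leadingCoeff := by
      simp only [f, coe_eval₂RingHom, eval₂_eq_sum_range, h1, HahnSeries.coeff_sum, RingHom.comp_apply]
      rw [Finset.sum_eq_single p.natDegree]
      · simp
      · intro b _ hb
        rw [HahnSeries.C_mul_eq_smul, HahnSeries.coeff_smul, HahnSeries.coeff_single_of_ne, smul_zero]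
        intro h
        exact hb (by exact_mod_cast (mul_right_cancel₀ hs h).symm)
      · simp
    rw [hp] at h2
    rw [HahnSeries.coeff_zero, eq_comm, map_eq_zero, leadingCoeff_eq_zero] at h2
    exact hp0 h2
  exact ⟨IsFractionRing.lift hf, fun c => by rw [IsFractionRing.lift_algebraMap]; simp [f],
    by rw [IsFractionRing.lift_algebraMap]; simp [f]⟩

variable {k : Type*} [Field k] [Algebra k[X] F] [IsFractionRing k[X] F] [IsAlgClosure F E]

open LaurentSeries WithZero in
variable (k F E) in
lemma exists_place_zero :
    ∃ (w : AbsoluteValue E ℝ) (Γ : Subgroup (E ≃ₐ[F] E)), IsPlace w Γ (algebraMap k[X] F X) ∧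
      w (algebraMap F E (algebraMap k[X] F X)) < 1 ∧ ∀ σ ∈ Γ, ∀ x, w x ≤ 1 → w (σ x - x) < 1 := by
  obtain ⟨i, -, hi⟩ := exists_ringHom_laurentSeries (F := F)
    (algebraMap k (AlgebraicClosure k)) (s := 1) (by norm_num)
  obtain ⟨w, Γ, h1, -, h3, h4, -⟩ := exists_place (E := E)
    (LaurentSeries.valuation_surjective (AlgebraicClosure k)) i
    HahnSeries.C exists_valuation_sub_C_lt_one (t := algebraMap k[X] F X) (s := -1)
    (by rw [hi, LaurentSeries.valuation_single_zpow]) (by simp)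
  exact ⟨w, Γ, h1, h3 (by norm_num), h4 inferInstance⟩

open LaurentSeries WithZero in
variable (k F E) in
lemma exists_place_infty :
    ∃ (w : AbsoluteValue E ℝ) (Γ : Subgroup (E ≃ₐ[F] E)), IsPlace w Γ (algebraMap k[X] F X) ∧
      1 < w (algebraMap F E (algebraMap k[X] F X)) ∧
      ∀ x, IsSeparable F x → (∀ σ ∈ Γ, σ x = x) → w x ≤ 1 →
        ∃ a : k, w (x - algebraMap F E (algebraMap k[X] F (C a))) < 1 := by
  obtain ⟨i, hC, hi⟩ := exists_ringHom_laurentSeries (F := F) (RingHom.id k) (s := -1) (by norm_num)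
  obtain ⟨w, Γ, h1, h2, -, -, h5⟩ := exists_place (E := E)
    (LaurentSeries.valuation_surjective k) i
    HahnSeries.C exists_valuation_sub_C_lt_one (t := algebraMap k[X] F X) (s := 1)
    (by rw [hi, LaurentSeries.valuation_single_zpow]; simp) (by simp)
  refine ⟨w, Γ, h1, h2 (by norm_num), fun x hx hfix hx1 => ?_⟩
  obtain ⟨a, ha⟩ := h5 x hx hfix hx1
  exact ⟨a, ha _ (hC a)⟩

end ExistsPlace

section Nonarchimedean

variable {E : Type*} [Field E] {v : AbsoluteValue E ℝ}

lemma abv_add_lt (hna : IsNonarchimedean v) {x y : E} {c : ℝ} (hx : v x < c) (hy : v y < c) :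
    v (x + y) < c := (hna x y).trans_lt (max_lt hx hy)

lemma abv_add_le (hna : IsNonarchimedean v) {x y : E} {c : ℝ} (hx : v x ≤ c) (hy : v y ≤ c) :
    v (x + y) ≤ c := (hna x y).trans (max_le hx hy)

lemma abv_sub_lt (hna : IsNonarchimedean v) {x y : E} {c : ℝ} (hx : v x < c) (hy : v y < c) :
    v (x - y) < c := by
  rw [sub_eq_add_neg]; exact abv_add_lt hna hx (by rwa [v.map_neg])

lemma abv_sub_le (hna : IsNonarchimedean v) {x y : E} {c : ℝ} (hx : v x ≤ c) (hy : v y ≤ c) :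
    v (x - y) ≤ c := by
  rw [sub_eq_add_neg]; exact abv_add_le hna hx (by rwa [v.map_neg])

lemma abv_add_eq_left (hna : IsNonarchimedean v) {x y : E} (h : v y < v x) : v (x + y) = v x := by
  refine le_antisymm (abv_add_le hna le_rfl h.le) ?_
  by_contra! h2
  have := abv_sub_lt hna h2 h
  rw [add_sub_cancel_right] at this
  exact lt_irrefl _ this

lemma abv_add_eq_right (hna : IsNonarchimedean v) {x y : E} (h : v x < v y) : v (x + y) = v y := by
  rw [add_comm]; exact abv_add_eq_left hna h

lemma abv_eq_of_sub_lt (hna : IsNonarchimedean v) {x y : E} (h : v (x - y) < v y) : v x = v y := by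
  have := abv_add_eq_right hna h
  rwa [sub_add_cancel] at this

section FiniteField

variable {K : Type*} [Field K] [Fintype K] [Algebra K E]

lemma abv_algebraMap_finite {c : K} (hc : c ≠ 0) : v (algebraMap K E c) = 1 := by
  have h : v (algebraMap K E c) ^ (Fintype.card K - 1) = 1 := by
    rw [← map_pow, ← map_pow, FiniteField.pow_card_sub_one_eq_one c hc, map_one, map_one]
  have h2 := Fintype.one_lt_card (α := K)
  exact (pow_eq_one_iff_of_nonneg (v.nonneg _) (by omega)).1 h

lemma abv_smul_finite {c : K} (hc : c ≠ 0) (x : E) : v (c • x) = v x := by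
  rw [Algebra.smul_def, map_mul, abv_algebraMap_finite hc, one_mul]

lemma abv_smul_finite_le (c : K) (x : E) : v (c • x) ≤ v x := by
  by_cases hc : c = 0
  · simp [hc]
  · exact (abv_smul_finite hc x).le

lemma exists_abv_sub_algebraMap_lt_one {x : E} (h : v (x ^ Fintype.card K - x) < 1) :
    ∃ c : K, v (x - algebraMap K E c) < 1 := by
  have h1 : x ^ Fintype.card K - x = ∏ c : K, (x - algebraMap K E c) := by
    have h3 : (X ^ Fintype.card K - X : K[X]).Monic := by
      apply monic_X_pow_sub
      rw [degree_X]
      exact_mod_cast Fintype.one_lt_card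
    have h2 : (X ^ Fintype.card K - X : K[X]).Splits := by
      rw [splits_iff_card_roots, FiniteField.roots_X_pow_card_sub_X,
        FiniteField.X_pow_card_sub_X_natDegree_eq K Fintype.one_lt_card]
      rfl
    have h4 := h2.eq_prod_roots_of_monic h3
    rw [FiniteField.roots_X_pow_card_sub_X] at h4
    have h5 := congrArg (aeval x) h4
    rw [map_multiset_prod, Multiset.map_map, map_sub, map_pow, aeval_X] at h5
    rw [h5, Finset.prod]
    congr 2
    ext c
    simp
  by_contra! hcon
  rw [h1, map_prod] at h
  refine absurd h (not_lt.2 ?_)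
  calc (1 : ℝ) = ∏ c : K, 1 := by simp
    _ ≤ _ := Finset.prod_le_prod (fun _ _ => zero_le_one) fun c _ => hcon c

end FiniteField

end Nonarchimedean

section ZeroPlace

variable {k : Type*} [Field k] [Fintype k] {E : Type*} [Field E] [Algebra k E]
  {v : AbsoluteValue E ℝ} {r : ℕ} {θ : E}

local notation "q" => Fintype.card k

lemma one_lt_card_pow (hr : 2 ≤ r) : 1 < q ^ (r - 1) :=
  Nat.one_lt_pow (by omega) one_lt_card

lemma abv_drin_last (hr : 2 ≤ r) (x : E) : v (θ ^ (q - 1) * x ^ q ^ r) =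
    (v θ * v x ^ q ^ (r - 1)) ^ (q - 1) * v x ^ q ^ (r - 1) := by
  have h1 : q ^ r = q ^ (r - 1) * (q - 1) + q ^ (r - 1) := by
    have := one_lt_card (k := k)
    rw [← Nat.mul_succ, Nat.succ_eq_add_one, Nat.sub_add_cancel this.le, ← pow_succ]
    congr 1; omega
  rw [map_mul, map_pow, map_pow, h1, pow_add, mul_pow, pow_mul]; ring

lemma abv_drin_of_lt (hna : IsNonarchimedean v) (hr : 2 ≤ r) (hθ : v θ < 1) {x : E} (h1 : 1 < v x)
    (h2 : v θ * v x ^ q ^ (r - 1) < 1) : v (drin k r θ x) = v x ^ q ^ (r - 1) := by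
  have hQ := one_lt_card_pow (k := k) hr
  have hq := one_lt_card (k := k)
  have h0 : 0 ≤ v θ * v x ^ q ^ (r - 1) := by have := v.nonneg θ; positivity
  have h3 : v (θ * x) < v (x ^ q ^ (r - 1)) := by
    rw [map_mul, map_pow]
    calc v θ * v x < 1 * v x := by gcongr
      _ = v x ^ 1 := by ring
      _ ≤ _ := pow_le_pow_right₀ h1.le hQ.le
  have h4 : v (θ * x + x ^ q ^ (r - 1)) = v x ^ q ^ (r - 1) := by
    rw [abv_add_eq_right hna h3, map_pow]
  rw [drin_apply, abv_add_eq_left hna, h4]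
  rw [h4, abv_drin_last hr]
  have : (v θ * v x ^ q ^ (r - 1)) ^ (q - 1) < 1 := pow_lt_one₀ h0 h2 (by omega)
  have h5 : 0 < v x ^ q ^ (r - 1) := by positivity
  nlinarith

lemma abv_drin_of_gt (hna : IsNonarchimedean v) (hr : 2 ≤ r) (hθ : v θ < 1) {x : E}
    (h2 : 1 < v θ * v x ^ q ^ (r - 1)) : v x < v (drin k r θ x) := by
  have hQ := one_lt_card_pow (k := k) hr
  have hq := one_lt_card (k := k)
  have h0 := v.nonneg x
  have hθ0 := v.nonneg θ
  have h1 : 1 < v x := by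
    by_contra! h
    have : v x ^ q ^ (r - 1) ≤ 1 := pow_le_one₀ h0 h
    nlinarith
  have h3 : v x ≤ v x ^ q ^ (r - 1) := le_self_pow₀ h1.le (by omega)
  have h4 : v (θ * x + x ^ q ^ (r - 1)) ≤ v x ^ q ^ (r - 1) := by
    refine abv_add_le hna ?_ (by rw [map_pow])
    rw [map_mul]
    nlinarith
  have h5 : v x ^ q ^ (r - 1) < v (θ ^ (q - 1) * x ^ q ^ r) := by
    rw [abv_drin_last hr]
    have : 1 < (v θ * v x ^ q ^ (r - 1)) ^ (q - 1) := one_lt_pow₀ h2 (by omega)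
    have h5 : 0 < v x ^ q ^ (r - 1) := by positivity
    nlinarith
  rw [drin_apply, abv_add_eq_right hna (h4.trans_lt h5)]
  exact h3.trans_lt h5

lemma abv_drin_le_one (hna : IsNonarchimedean v) (hθ : v θ < 1) {x : E} (h1 : v x ≤ 1) :
    v (drin k r θ x) ≤ 1 := by
  rw [drin_apply]
  refine abv_add_le hna (abv_add_le hna ?_ ?_) ?_ <;> simp only [map_mul, map_pow]
  · exact mul_le_one₀ hθ.le (v.nonneg _) h1
  · exact pow_le_one₀ (v.nonneg _) h1
  · exact mul_le_one₀ (pow_le_one₀ (v.nonneg _) hθ.le) (by positivity) (pow_le_one₀ (v.nonneg _) h1)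

lemma abv_drin_lt_self (hna : IsNonarchimedean v) (hr : 2 ≤ r) (hθ : v θ < 1) {x : E}
    (hx : x ≠ 0) (h1 : v x < 1) : v (drin k r θ x) < v x := by
  have hQ := one_lt_card_pow (k := k) hr
  have hq := one_lt_card (k := k)
  have h0 := v.pos hx
  have h3 : v x ^ q ^ (r - 1) < v x := pow_lt_self_of_lt_one₀ h0 h1 hQ
  rw [drin_apply]
  refine abv_add_lt hna (abv_add_lt hna ?_ ?_) ?_
  · rw [map_mul]; nlinarith
  · rwa [map_pow]
  · rw [abv_drin_last hr]
    have h4 : (v θ * v x ^ q ^ (r - 1)) ^ (q - 1) ≤ 1 :=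
      pow_le_one₀ (by have := v.nonneg θ; positivity) (by have := v.nonneg θ; nlinarith)
    exact (mul_le_of_le_one_left (by positivity) h4).trans_lt h3

lemma abv_aeval_drin_le_one (hna : IsNonarchimedean v) (hθ : v θ < 1) (a : k[X]) {x : E}
    (h1 : v x ≤ 1) : v (aeval (drin k r θ) a x) ≤ 1 := by
  induction a using divX_induction with
  | h0 => simp
  | h1 c hc => simpa [Module.algebraMap_end_apply, abv_smul_finite hc] using h1
  | h2 a _ ih =>
    rw [aeval_end_divX]
    exact abv_add_le hna (abv_drin_le_one hna hθ ih) ((abv_smul_finite_le _ _).trans h1)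

lemma abv_aeval_drin_le_self (hna : IsNonarchimedean v) (hr : 2 ≤ r) (hθ : v θ < 1) (a : k[X]) {x : E}
    (h1 : v x < 1) : v (aeval (drin k r θ) a x) ≤ v x := by
  induction a using divX_induction with
  | h0 => simp
  | h1 c hc => simp [Module.algebraMap_end_apply, abv_smul_finite hc]
  | h2 a _ ih =>
    rw [aeval_end_divX]
    refine abv_add_le hna ?_ (abv_smul_finite_le _ _)
    by_cases h : aeval (drin k r θ) a.divX x = 0
    · rw [h, map_zero, map_zero]; exact v.nonneg _
    · exact (abv_drin_lt_self hna hr hθ h (ih.trans_lt h1)).le.trans ih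

lemma aeval_drin_ne_zero_of_abv_lt_one (hna : IsNonarchimedean v) (hr : 2 ≤ r) (hθ : v θ < 1)
    {a : k[X]} (ha : a.coeff 0 ≠ 0) {x : E} (hx : x ≠ 0) (h1 : v x < 1) :
    aeval (drin k r θ) a x ≠ 0 := by
  have h0 := v.pos hx
  have h2 : v (aeval (drin k r θ) a x) = v x := by
    rw [aeval_end_divX, abv_add_eq_right hna, abv_smul_finite ha]
    rw [abv_smul_finite ha]
    have ih := abv_aeval_drin_le_self hna hr hθ a.divX h1
    by_cases h : aeval (drin k r θ) a.divX x = 0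
    · rw [h, map_zero, map_zero]; exact h0
    · exact (abv_drin_lt_self hna hr hθ h (ih.trans_lt h1)).trans_le ih
  intro h
  rw [h, map_zero] at h2
  exact h0.ne h2

lemma abv_aeval_drin_of_lt (hna : IsNonarchimedean v) (hr : 2 ≤ r) (hθ : v θ < 1)
    {a : k[X]} (ha : a ≠ 0) {x : E} (h1 : 1 < v x)
    (h2 : v θ * v x ^ (q ^ (r - 1)) ^ a.natDegree < 1) :
    v (aeval (drin k r θ) a x) = v x ^ (q ^ (r - 1)) ^ a.natDegree := by
  have hQ := one_lt_card_pow (k := k) hr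
  induction a using divX_induction with
  | h0 => exact absurd rfl ha
  | h1 c hc => simp [Module.algebraMap_end_apply, abv_smul_finite hc]
  | h2 a hd ih =>
    obtain ⟨m, hm⟩ : ∃ m, a.natDegree = m + 1 := ⟨_, (Nat.sub_add_cancel hd).symm⟩
    have hm' : a.divX.natDegree = m := by rw [natDegree_divX_eq_natDegree_tsub_one]; omega
    rw [hm] at h2 ⊢
    have h3 : v θ * v x ^ (q ^ (r - 1)) ^ m < 1 := by
      refine lt_of_le_of_lt ?_ h2
      have := v.nonneg θ
      gcongr
      · exact h1.le
      · exact hQ.le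
      · omega
    have ih := ih (divX_ne_zero_of_natDegree_pos hd) (by rwa [hm'])
    rw [hm'] at ih
    have h4 : v (drin k r θ (aeval (drin k r θ) a.divX x)) = v x ^ (q ^ (r - 1)) ^ (m + 1) := by
      rw [abv_drin_of_lt hna hr hθ, ih, ← pow_mul, pow_succ]
      · rw [ih]; exact one_lt_pow₀ h1 (by positivity)
      · rwa [ih, ← pow_mul, ← pow_succ]
    rw [aeval_end_divX, abv_add_eq_left hna, h4]
    rw [h4]
    refine (abv_smul_finite_le _ _).trans_lt ?_
    exact lt_self_pow₀ h1 (Nat.one_lt_pow (by omega) hQ)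

lemma aeval_drin_mem_tors {a : k[X]} (b : k[X]) {x : E} (hx : x ∈ tors k r θ a) :
    aeval (drin k r θ) b x ∈ tors k r θ a := by
  rw [LinearMap.mem_ker] at hx ⊢
  rw [← Module.End.mul_apply, ← map_mul, mul_comm, map_mul, Module.End.mul_apply, hx, map_zero]

lemma drin_mem_tors {a : k[X]} {x : E} (hx : x ∈ tors k r θ a) :
    drin k r θ x ∈ tors k r θ a := by
  simpa using aeval_drin_mem_tors X hx

lemma mul_abv_pow_le_one_of_mem_tors (hna : IsNonarchimedean v) (hr : 2 ≤ r) (hθ0 : θ ≠ 0)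
    (hθ : v θ < 1) {a : k[X]} (ha : a ≠ 0) {x : E} (hx : x ∈ tors k r θ a) :
    v θ * v x ^ q ^ (r - 1) ≤ 1 := by
  by_contra! h
  have := finite_tors (k := k) (r := r) (by omega) hθ0 ha
  obtain ⟨y, hy, hmax⟩ := Set.exists_max_image (tors k r θ a : Set E) v (Set.toFinite _) ⟨x, hx⟩
  have h1 : 1 < v θ * v y ^ q ^ (r - 1) := by
    refine h.trans_le ?_
    have := hmax x hx
    have := v.nonneg θ
    have := v.nonneg x
    gcongr
  exact absurd (hmax _ (drin_mem_tors hy)) (not_le.2 (abv_drin_of_gt hna hr hθ h1))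

lemma exists_level (hna : IsNonarchimedean v) (hr : 2 ≤ r) (hθ0 : θ ≠ 0)
    (hθ : v θ < 1) {a : k[X]} (ha : a ≠ 0) {x : E} (hx : x ∈ tors k r θ a) (h1 : 1 < v x) :
    ∃ j < a.natDegree, v θ * v x ^ (q ^ (r - 1)) ^ (j + 1) = 1 := by
  have hQ := one_lt_card_pow (k := k) hr
  have hv0 := v.pos hθ0
  have hex : ∃ m, 1 ≤ v θ * v x ^ (q ^ (r - 1)) ^ m := by
    obtain ⟨m, hm⟩ := pow_unbounded_of_one_lt (v θ)⁻¹ h1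
    refine ⟨m, ?_⟩
    have h2 : v x ^ m ≤ v x ^ (q ^ (r - 1)) ^ m :=
      pow_le_pow_right₀ h1.le (Nat.lt_pow_self hQ).le
    rw [inv_lt_iff_one_lt_mul₀ hv0] at hm
    nlinarith
  classical
  have hm := Nat.find_spec hex
  have hmin := fun n (h : n < Nat.find hex) => Nat.find_min hex h
  set m := Nat.find hex
  have hle := mul_abv_pow_le_one_of_mem_tors hna hr hθ0 hθ ha hx
  have hm0 : m ≠ 0 := by
    intro h
    rw [h, pow_zero, pow_one] at hm
    have := lt_self_pow₀ h1 hQ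
    nlinarith
  obtain ⟨j, hj⟩ := Nat.exists_eq_succ_of_ne_zero hm0
  have hlt := hmin j (by omega)
  rw [not_le] at hlt
  refine ⟨j, ?_, le_antisymm ?_ ?_⟩
  · by_contra! hcon
    have h3 := abv_aeval_drin_of_lt hna hr hθ ha h1 (lt_of_le_of_lt (by
      gcongr
      · exact h1.le
      · exact hQ.le) hlt)
    rw [LinearMap.mem_ker.1 hx, map_zero] at h3
    have : 0 < v x ^ (q ^ (r - 1)) ^ a.natDegree := by positivity
    exact this.ne h3
  · have h4 := abv_aeval_drin_of_lt hna hr hθ (a := (X : k[X]) ^ j) (pow_ne_zero _ X_ne_zero) h1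
      (by rwa [natDegree_X_pow])
    have h5 := mul_abv_pow_le_one_of_mem_tors hna hr hθ0 hθ ha (aeval_drin_mem_tors (X ^ j) hx)
    rwa [h4, natDegree_X_pow, ← pow_mul, ← pow_succ] at h5
  · rwa [hj] at hm

variable (k) in
/-- The elements of absolute value at most one. -/
def integers (hna : IsNonarchimedean v) : Subalgebra k E where
  carrier := {x | v x ≤ 1}
  mul_mem' {x y} hx hy := by
    simp only [Set.mem_ofPred_eq, map_mul] at *
    exact mul_le_one₀ hx (v.nonneg _) hy
  add_mem' hx hy := abv_add_le hna hx hy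
  algebraMap_mem' c := by
    by_cases hc : c = 0
    · simp [hc]
    · exact (abv_algebraMap_finite hc).le

variable (k r θ) in
/-- The integral torsion points. -/
def unitTors (hna : IsNonarchimedean v) (a : k[X]) : Submodule k E :=
  tors k r θ a ⊓ Subalgebra.toSubmodule (integers k hna)

lemma card_unitTors_le (hna : IsNonarchimedean v) (hr : 2 ≤ r) (hθ : v θ < 1) {a : k[X]} (ha : a ≠ 0) :
    Nat.card (unitTors k r θ hna a) ≤ (q ^ (r - 1)) ^ a.natDegree := by
  classical
  let O := integers k hna
  let θ' : O := ⟨θ, hθ.le⟩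
  have hnu : ¬ IsUnit θ' := by
    rintro hu
    obtain ⟨b, hb⟩ := hu.exists_right_inv
    have h1 : θ * (b : E) = 1 := congrArg Subtype.val hb
    have h2 : v θ * v (b : E) = 1 := by rw [← map_mul, h1, map_one]
    have h3 : v (b : E) ≤ 1 := b.2
    have := v.nonneg θ
    nlinarith
  obtain ⟨M, hM, hθM⟩ := exists_max_ideal_of_mem_nonunits hnu
  let : Field (O ⧸ M) := Ideal.Quotient.field M
  let P : O[X] := aeval (drin k r (C θ')) a X
  let π : O →ₐ[k] O ⧸ M := Ideal.Quotient.mkₐ k M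
  have hπ : π θ' = 0 := Ideal.Quotient.eq_zero_iff_mem.2 hθM
  have hmap : P.map π.toRingHom = aeval (drin k r (0 : (O ⧸ M)[X])) a X := by
    have := map_aeval_drin (k := k) (Polynomial.mapAlgHom π) r (θ := C θ') (θ' := 0)
      (by simp [hπ]) a X
    simpa [P] using this
  have hdeg : (P.map π.toRingHom).natDegree = (q ^ (r - 1)) ^ a.natDegree := by
    rw [hmap]
    refine natDegree_aeval_of_op (one_lt_card_pow hr) (fun P _ => natDegree_drin_zero P) ha
  have hP0 : P.map π.toRingHom ≠ 0 := by
    intro h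
    rw [h, natDegree_zero] at hdeg
    have : 0 < (q ^ (r - 1)) ^ a.natDegree := by positivity
    omega
  have hP : P ≠ 0 := by
    intro h
    rw [h, Polynomial.map_zero] at hP0
    exact hP0 rfl
  set s := P.roots.toFinset
  have hs : Nat.card (unitTors k r θ hna a) ≤ s.card := by
    have hroot : ∀ u : unitTors k r θ hna a, (⟨u, u.2.2⟩ : O) ∈ s := by
      intro u
      rw [Multiset.mem_toFinset, mem_roots hP, IsRoot.def, eval_aeval_drin]
      apply Subtype.val_injective
      have := map_aeval_drin (k := k) O.val r (θ := θ') (θ' := θ) rfl a ⟨u, u.2.2⟩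
      exact this.trans u.2.1
    rw [← Fintype.card_coe, ← Nat.card_eq_fintype_card]
    refine Nat.card_le_card_of_injective (fun u => (⟨_, hroot u⟩ : s)) fun u u' h => ?_
    exact Subtype.ext (congrArg (fun z : s => ((z : O) : E)) h)
  refine hs.trans ?_
  have hdvd : (s.val.map fun u => X - C u).prod ∣ P := by
    rw [Multiset.prod_X_sub_C_dvd_iff_le_roots hP]
    exact Multiset.dedup_le _
  have hdvd' := Polynomial.map_dvd π.toRingHom hdvd
  have hmon : (s.val.map fun u => X - C u).prod.Monic := monic_multisetProd_X_sub_C _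
  have := natDegree_le_of_dvd hdvd' hP0
  rw [hdeg, hmon.natDegree_map, natDegree_multiset_prod_X_sub_C_eq_card] at this
  exact this

end ZeroPlace

section ZeroPlaceGenerator

variable {k : Type*} [Field k] [Fintype k] {E : Type*} [Field E] [Algebra k E]
  {v : AbsoluteValue E ℝ} {r : ℕ} {θ : E}

local notation "q" => Fintype.card k

lemma sub_smul_pow_card_pow (x y : E) (c : k) (n : ℕ) :
    (x - c • y) ^ q ^ n = x ^ q ^ n - c • y ^ q ^ n := by
  simp only [← frob_pow_apply (k := k), map_sub, map_smul]

lemma exists_abv_sub_smul_lt_of_level_one (hna : IsNonarchimedean v) (hr : 2 ≤ r) (hθ0 : θ ≠ 0)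
    (hθ : v θ < 1) {a : k[X]} (ha : a ≠ 0) {x y : E} (hx : x ∈ tors k r θ a)
    (hy : y ∈ tors k r θ a) (hxy : v y = v x) (h1 : 1 < v x) (hlev : v θ * v x ^ q ^ (r - 1) = 1) :
    ∃ c : k, v (x - c • y) < v x := by
  have hQ := one_lt_card_pow (k := k) hr
  have hq := one_lt_card (k := k)
  have hv0 := v.pos hθ0
  have key : ∀ z ∈ tors k r θ a, v z = v x → v (1 + (θ * z ^ q ^ (r - 1)) ^ (q - 1)) < 1 := by
    intro z hz hzx
    have hz1 : 1 < v z := by rwa [hzx]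
    have hlt : v z < v (z ^ q ^ (r - 1)) := by rw [map_pow]; exact lt_self_pow₀ hz1 hQ
    have h2 : v (drin k r θ z) < v (z ^ q ^ (r - 1)) := by
      refine lt_of_le_of_lt ?_ hlt
      have h3 := mul_abv_pow_le_one_of_mem_tors hna hr hθ0 hθ ha (drin_mem_tors hz)
      rw [← hlev, mul_le_mul_iff_right₀ hv0, ← hzx] at h3
      exact (pow_le_pow_iff_left₀ (v.nonneg _) (v.nonneg _) (by omega)).1 h3
    have h3 : v (θ * z) < v (z ^ q ^ (r - 1)) := by
      refine lt_trans ?_ hlt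
      rw [map_mul]; nlinarith
    have h4 : drin k r θ z - θ * z = z ^ q ^ (r - 1) * (1 + (θ * z ^ q ^ (r - 1)) ^ (q - 1)) := by
      have h5 : q ^ r = q ^ (r - 1) * (q - 1) + q ^ (r - 1) := by
        rw [← Nat.mul_succ, Nat.succ_eq_add_one, Nat.sub_add_cancel hq.le, ← pow_succ]
        congr 1; omega
      rw [drin_apply, h5, pow_add, mul_pow, pow_mul]; ring
    have h5 := abv_sub_lt hna h2 h3
    rw [h4, map_mul] at h5
    have : 0 < v (z ^ q ^ (r - 1)) := lt_trans (by linarith) hlt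
    exact lt_of_mul_lt_mul_left (by linarith) this.le
  set α := θ * x ^ q ^ (r - 1)
  set β := θ * y ^ q ^ (r - 1)
  have hα : v α = 1 := by simpa [α] using hlev
  have hβ : v β = 1 := by simpa [β, hxy] using hlev
  have hβ0 : β ≠ 0 := by rw [← v.ne_zero_iff, hβ]; norm_num
  have h2 : v ((α / β) ^ q - α / β) < 1 := by
    have h3 : (α / β) ^ q - α / β =
        (α / β) * (((1 + α ^ (q - 1)) - (1 + β ^ (q - 1))) / β ^ (q - 1)) := by
      obtain ⟨m, hm⟩ : ∃ m, q = m + 1 := ⟨q - 1, by omega⟩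
      rw [hm, Nat.add_sub_cancel, add_sub_add_left_eq_sub, sub_div, ← div_pow,
        div_self (pow_ne_zero _ hβ0), mul_sub, mul_one, pow_succ']
    rw [h3, map_mul, map_div₀, map_div₀, map_pow, hα, hβ]
    simpa using abv_sub_lt hna (key x hx rfl) (key y hy hxy)
  obtain ⟨c, hc⟩ := exists_abv_sub_algebraMap_lt_one h2
  refine ⟨c, ?_⟩
  have h3 : v θ * v (x - c • y) ^ q ^ (r - 1) < v θ * v x ^ q ^ (r - 1) := by
    rw [hlev, ← map_pow, ← map_mul, sub_smul_pow_card_pow]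
    have h4 : θ * (x ^ q ^ (r - 1) - c • y ^ q ^ (r - 1)) = (α / β - algebraMap k E c) * β := by
      rw [sub_mul, div_mul_cancel₀ _ hβ0, Algebra.smul_def]; ring
    rw [h4, map_mul, hβ, mul_one]
    exact hc
  rw [mul_lt_mul_iff_right₀ hv0] at h3
  exact lt_of_pow_lt_pow_left₀ _ (v.nonneg _) h3

lemma mul_abv_pow_lt_one (hr : 2 ≤ r) (hθ0 : θ ≠ 0) {x : E} (h1 : 1 < v x) {i j : ℕ} (hij : i < j)
    (hlev : v θ * v x ^ (q ^ (r - 1)) ^ j = 1) : v θ * v x ^ (q ^ (r - 1)) ^ i < 1 := by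
  have hQ := one_lt_card_pow (k := k) hr
  rw [← hlev, mul_lt_mul_iff_right₀ (v.pos hθ0)]
  exact pow_lt_pow_right₀ h1 (Nat.pow_lt_pow_right hQ hij)

lemma exists_abv_sub_smul_lt (hna : IsNonarchimedean v) (hr : 2 ≤ r) (hθ0 : θ ≠ 0)
    (hθ : v θ < 1) {a : k[X]} (ha : a ≠ 0) {x y : E} (hx : x ∈ tors k r θ a)
    (hy : y ∈ tors k r θ a) (hxy : v y = v x) (h1 : 1 < v x) : ∃ c : k, v (x - c • y) < v x := by
  obtain ⟨j, -, hj⟩ := exists_level hna hr hθ0 hθ ha hx h1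
  have hlt := mul_abv_pow_lt_one (k := k) hr hθ0 h1 (Nat.lt_succ_self j) hj
  have key : ∀ z : E, v z = v x → v (aeval (drin k r θ) ((X : k[X]) ^ j) z) =
      v x ^ (q ^ (r - 1)) ^ j := by
    intro z hz
    have := abv_aeval_drin_of_lt hna hr hθ (a := (X : k[X]) ^ j) (pow_ne_zero _ X_ne_zero)
      (x := z) (by rwa [hz]) (by rwa [natDegree_X_pow, hz])
    rwa [natDegree_X_pow, hz] at this
  obtain ⟨c, hc⟩ := exists_abv_sub_smul_lt_of_level_one hna hr hθ0 hθ ha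
    (aeval_drin_mem_tors (k := k) (X ^ j) hx) (aeval_drin_mem_tors (k := k) (X ^ j) hy)
    (by rw [key x rfl, key y hxy]) (by rw [key x rfl]; exact one_lt_pow₀ h1 (by positivity))
    (by rw [key x rfl, ← pow_mul, ← pow_succ, hj])
  refine ⟨c, lt_of_le_of_ne (abv_sub_le hna le_rfl ((abv_smul_finite_le _ _).trans hxy.le)) ?_⟩
  intro h
  rw [← map_smul, ← map_sub, key _ h, key x rfl] at hc
  exact lt_irrefl _ hc

theorem exists_generator [IsAlgClosed E] (hna : IsNonarchimedean v) (hr : 2 ≤ r) (hθ0 : θ ≠ 0)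
    (hθ : v θ < 1) {a : k[X]} (ha : aeval θ a ≠ 0) (hd : 0 < a.natDegree) :
    ∃ y ∈ tors k r θ a, 1 < v y ∧ v θ * v y ^ (q ^ (r - 1)) ^ a.natDegree = 1 ∧
      (∀ x ∈ tors k r θ a, 1 < v x → v y ≤ v x) ∧
      (∀ x ∈ tors k r θ a, ∃ b : k[X], x - aeval (drin k r θ) b y ∈ unitTors k r θ hna a) ∧
      Nat.card (unitTors k r θ hna a) = (q ^ (r - 1)) ^ a.natDegree := by
  have hQ := one_lt_card_pow (k := k) hr
  have hq := one_lt_card (k := k)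
  have ha0 : a ≠ 0 := by rintro rfl; simp at hd
  have hfin := finite_tors (k := k) (r := r) (by omega) hθ0 ha0
  have hcard := card_tors (k := k) hr hθ0 ha
  have hU := card_unitTors_le hna hr hθ ha0
  have hqr : q ^ (r * a.natDegree) = (q ^ (r - 1)) ^ a.natDegree * q ^ a.natDegree := by
    rw [← mul_pow, ← pow_succ, Nat.sub_add_cancel (by omega), pow_mul]
  have hex : ∃ y ∈ tors k r θ a, 1 < v y := by
    by_contra! h
    have : unitTors k r θ hna a = tors k r θ a := inf_eq_left.2 h
    rw [this, hcard, hqr] at hU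
    have h1 : 1 < q ^ a.natDegree := Nat.one_lt_pow hd.ne' hq
    have h2 : 0 < (q ^ (r - 1)) ^ a.natDegree := by positivity
    nlinarith
  obtain ⟨y, ⟨hy, hy1⟩, hmin⟩ := Set.exists_min_image {y | y ∈ tors k r θ a ∧ 1 < v y} v
    (Set.Finite.subset (Set.toFinite (tors k r θ a : Set E)) fun x hx => hx.1) hex
  obtain ⟨j, hjd, hj⟩ := exists_level hna hr hθ0 hθ ha0 hy hy1
  have hgen : ∀ x ∈ tors k r θ a, ∃ b ∈ degreeLT k (j + 1),
      x - aeval (drin k r θ) b y ∈ unitTors k r θ hna a := by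
    by_contra! hcon
    obtain ⟨x, hx, hxn⟩ := hcon
    obtain ⟨x, ⟨hx, hxn⟩, hxmin⟩ := Set.exists_min_image {x | x ∈ tors k r θ a ∧
        ∀ b ∈ degreeLT k (j + 1), x - aeval (drin k r θ) b y ∉ unitTors k r θ hna a} v
      (Set.Finite.subset (Set.toFinite (tors k r θ a : Set E)) fun x hx => hx.1) ⟨x, hx, hxn⟩
    have hx1 : 1 < v x := by
      by_contra! h
      exact hxn 0 (zero_mem _) (by simpa using ⟨hx, h⟩)
    obtain ⟨i, hid, hi⟩ := exists_level hna hr hθ0 hθ ha0 hx hx1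
    have hyx : v y ≤ v x := hmin x ⟨hx, hx1⟩
    have hij : i ≤ j := by
      by_contra! h
      have h1 := mul_abv_pow_lt_one (k := k) hr hθ0 hx1 (Nat.succ_lt_succ h) hi
      rw [← hj, mul_lt_mul_iff_right₀ (v.pos hθ0)] at h1
      exact absurd (lt_of_pow_lt_pow_left₀ _ (v.nonneg _) h1) (not_lt.2 hyx)
    have hlt := mul_abv_pow_lt_one (k := k) hr hθ0 hy1 (show j - i < j + 1 by omega) hj
    have hz := abv_aeval_drin_of_lt hna hr hθ (a := (X : k[X]) ^ (j - i)) (pow_ne_zero _ X_ne_zero)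
      hy1 (by rwa [natDegree_X_pow])
    rw [natDegree_X_pow] at hz
    have hzx : v (aeval (drin k r θ) ((X : k[X]) ^ (j - i)) y) = v x := by
      rw [hz]
      rw [← hj, mul_right_inj' (v.pos hθ0).ne'] at hi
      have h2 : v y ^ (q ^ (r - 1)) ^ (j + 1) =
          (v y ^ (q ^ (r - 1)) ^ (j - i)) ^ (q ^ (r - 1)) ^ (i + 1) := by
        rw [← pow_mul (v y), ← pow_add]; congr 2; omega
      rw [h2] at hi
      exact ((pow_left_inj₀ (v.nonneg _) (pow_nonneg (v.nonneg y) _) (by positivity)).1 hi).symm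
    obtain ⟨c, hc⟩ := exists_abv_sub_smul_lt hna hr hθ0 hθ ha0 hx (aeval_drin_mem_tors _ hy) hzx hx1
    have hmem : x - c • aeval (drin k r θ) ((X : k[X]) ^ (j - i)) y ∈ tors k r θ a :=
      sub_mem hx (Submodule.smul_mem _ _ (aeval_drin_mem_tors _ hy))
    refine absurd hc (not_lt.2 (hxmin _ ⟨hmem, fun b hb hb' => ?_⟩))
    refine hxn (c • X ^ (j - i) + b) (add_mem (Submodule.smul_mem _ _ ?_) hb) ?_
    · rw [mem_degreeLT, degree_X_pow]; exact_mod_cast (by omega : j - i < j + 1)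
    · simpa [sub_sub] using hb'
  have hle : Nat.card (tors k r θ a) ≤
      Nat.card (degreeLT k (j + 1)) * Nat.card (unitTors k r θ hna a) := by
    rw [← Nat.card_prod]
    have : Finite (degreeLT k (j + 1)) := Finite.of_equiv _ (degreeLTEquiv k (j + 1)).symm.toEquiv
    have : Finite (unitTors k r θ hna a) :=
      Finite.of_injective _ (Submodule.inclusion_injective
        (inf_le_left : unitTors k r θ hna a ≤ tors k r θ a))
    choose b hb hbu using hgen
    refine Nat.card_le_card_of_injective
      (fun x => (⟨b x x.2, hb x x.2⟩, ⟨_, hbu x x.2⟩)) fun x x' h => ?_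
    have h1 : b x x.2 = b x' x'.2 := congrArg (fun z => ((z.1 : degreeLT k (j + 1)) : k[X])) h
    have h2 : (x : E) - aeval (drin k r θ) (b x x.2) y = x' - aeval (drin k r θ) (b x' x'.2) y :=
      congrArg (fun z => ((z.2 : unitTors k r θ hna a) : E)) h
    rw [h1] at h2
    exact Subtype.ext (sub_left_injective h2)
  have hcd : Nat.card (degreeLT k (j + 1)) = q ^ (j + 1) := by
    rw [Nat.card_congr (degreeLTEquiv k (j + 1)).toEquiv]; simp
  rw [hcard, hqr, hcd, mul_comm] at hle
  have hjD : j + 1 = a.natDegree := by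
    by_contra hne
    have h1 : q ^ (j + 1) < q ^ a.natDegree := Nat.pow_lt_pow_right hq (by omega)
    have h2 : 0 < (q ^ (r - 1)) ^ a.natDegree := by positivity
    have h3 := Nat.mul_le_mul_left (q ^ (j + 1)) hU
    nlinarith
  rw [hjD] at hle hj
  refine ⟨y, hy, hy1, hj, fun x hx hx1 => hmin x ⟨hx, hx1⟩, fun x hx => ?_, le_antisymm hU ?_⟩
  · obtain ⟨b, -, hb⟩ := hgen x hx
    exact ⟨b, hb⟩
  · exact le_of_mul_le_mul_left hle (by positivity)

end ZeroPlaceGenerator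

section Galois

variable {k F E : Type*} [Field k] [Fintype k] [Field F] [Field E] [Algebra k F] [Algebra F E]
  [Algebra k E] [IsScalarTower k F E] {t : F} {θ : E} {r : ℕ}

local notation "q" => Fintype.card k

lemma galois_smul (σ : E ≃ₐ[F] E) (c : k) (x : E) : σ (c • x) = c • σ x := by
  rw [← algebraMap_smul F c x, map_smul, algebraMap_smul]

lemma galois_aeval_drin (hθt : algebraMap F E t = θ) (σ : E ≃ₐ[F] E) (r : ℕ) (a : k[X]) (x : E) :
    σ (aeval (drin k r θ) a x) = aeval (drin k r θ) a (σ x) :=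
  map_aeval_drin ((σ : E →ₐ[F] E).restrictScalars k) r (by simp [← hθt]) a x

lemma galois_mem_tors (hθt : algebraMap F E t = θ) (σ : E ≃ₐ[F] E) {a : k[X]} {x : E}
    (hx : x ∈ tors k r θ a) : σ x ∈ tors k r θ a := by
  rw [LinearMap.mem_ker] at *
  rw [← galois_aeval_drin hθt, hx, map_zero]

lemma isSeparable_of_mem_tors (hθt : algebraMap F E t = θ) (hr : 2 ≤ r) {a : k[X]}
    (ha : aeval θ a ≠ 0) {x : E} (hx : x ∈ tors k r θ a) : IsSeparable F x := by
  have ha' : aeval t a ≠ 0 := by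
    intro h
    apply ha
    rw [← hθt, aeval_algebraMap_apply, h, map_zero]
  set P := aeval (drin k r (C t)) a (X : F[X]) with hP
  have hsep : P.Separable := by
    rw [Polynomial.Separable, derivative_aeval_of_op (fun P => derivative_drin hr t P)]
    rw [derivative_X, mul_one]
    exact (isCoprime_one_right.of_isCoprime_of_dvd_right (isUnit_C.2 (IsUnit.mk0 _ ha')).dvd)
  refine hsep.of_dvd (minpoly.dvd F x ?_)
  have := map_aeval_drin (k := k) ((Polynomial.aeval (R := F) x).restrictScalars k) r
    (θ := C t) (θ' := θ) (by simpa using hθt) a X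
  simp only [AlgHom.restrictScalars_apply, aeval_X] at this
  rw [hP, this]
  exact hx

end Galois

section ZeroPlaceGalois

variable {k F E : Type*} [Field k] [Fintype k] [Field F] [Field E] [Algebra k F] [Algebra F E]
  [Algebra k E] [IsScalarTower k F E] {t : F} {θ : E} {r : ℕ}
  {v : AbsoluteValue E ℝ} {Γ : Subgroup (E ≃ₐ[F] E)}

local notation "q" => Fintype.card k

lemma IsPlace.exists_mul_eq_ncard (hp : IsPlace v Γ t) {x : E} (hx0 : x ≠ 0) (hx1 : v x ≠ 1)
    (hsep : IsSeparable F x) {m : ℤ} {s : ℤ} (hm : v x ^ m = v (algebraMap F E t) ^ s) :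
    ∃ n : ℤ, s * (Set.ncard {y | ∃ σ ∈ Γ, σ x = y} : ℤ) = m * n := by
  obtain ⟨n, hn⟩ := hp.orbit x hx0 hsep
  refine ⟨n, (zpow_right_inj₀ (v.pos hx0) hx1).1 ?_⟩
  rw [mul_comm s, zpow_mul, zpow_natCast, hn, zpow_mul (v x) m, hm, ← zpow_mul, ← zpow_mul,
    mul_comm]

lemma IsPlace.exists_eq_of_ncard_le (hp : IsPlace v Γ t) {x : E} (hx0 : x ≠ 0) (hx1 : v x ≠ 1)
    (hsep : IsSeparable F x) {m : ℤ} (hm : v x ^ m = v (algebraMap F E t)) {S : Set E}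
    (hS : S.Finite) (hO : ∀ σ ∈ Γ, σ x ∈ S) (hc : S.ncard ≤ |m|) {y : E} (hy : y ∈ S) :
    ∃ σ ∈ Γ, σ x = y := by
  obtain ⟨n, hn⟩ := hp.exists_mul_eq_ncard (s := 1) hx0 hx1 hsep (by simpa using hm)
  set O := {y | ∃ σ ∈ Γ, σ x = y} with hOdef
  have hsub : O ⊆ S := by rintro _ ⟨σ, hσ, rfl⟩; exact hO σ hσ
  have hpos : 0 < O.ncard := (Set.ncard_pos (hS.subset hsub)).2 ⟨x, 1, one_mem _, rfl⟩
  have hle : |m| ≤ O.ncard := Int.le_of_dvd (by exact_mod_cast hpos)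
    ((abs_dvd _ _).2 ⟨n, by simpa using hn⟩)
  have : O = S := Set.eq_of_subset_of_ncard_le hsub (by exact_mod_cast hc.trans hle) hS
  rw [← this] at hy
  exact hy

lemma galois_mem_unitTors (hθt : algebraMap F E t = θ) (hp : IsPlace v Γ t) {σ : E ≃ₐ[F] E}
    (hσ : σ ∈ Γ) {a : k[X]} {x : E} (hx : x ∈ unitTors k r θ hp.nonarch a) :
    σ x ∈ unitTors k r θ hp.nonarch a :=
  ⟨galois_mem_tors hθt σ hx.1, (hp.map_eq σ hσ x).trans_le hx.2⟩

lemma aeval_drin_mem_unitTors (hna : IsNonarchimedean v) (hθ : v θ < 1) {a : k[X]} (b : k[X]) {x : E}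
    (hx : x ∈ unitTors k r θ hna a) : aeval (drin k r θ) b x ∈ unitTors k r θ hna a :=
  ⟨aeval_drin_mem_tors b hx.1, abv_aeval_drin_le_one hna hθ b hx.2⟩

lemma galois_sub_mem_unitTors (hθt : algebraMap F E t = θ) (hp : IsPlace v Γ t) (hθ0 : θ ≠ 0)
    (hres : ∀ σ ∈ Γ, ∀ x, v x ≤ 1 → v (σ x - x) < 1) {a : k[X]} {y : E} (hy : y ∈ tors k r θ a)
    (hlev : v θ * v y ^ (q ^ (r - 1)) ^ a.natDegree = 1)
    (hmin : ∀ x ∈ tors k r θ a, 1 < v x → v y ≤ v x) {σ : E ≃ₐ[F] E} (hσ : σ ∈ Γ) :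
    σ y - y ∈ unitTors k r θ hp.nonarch a := by
  refine ⟨sub_mem (galois_mem_tors hθt σ hy) hy, ?_⟩
  change v (σ y - y) ≤ 1
  by_contra! h
  have h1 := hmin _ (sub_mem (galois_mem_tors hθt σ hy) hy) h
  have h2 := hres σ hσ (θ * y ^ (q ^ (r - 1)) ^ a.natDegree) (by simp [hlev])
  have h3 := sub_smul_pow_card_pow (σ y) y (1 : k) ((r - 1) * a.natDegree)
  rw [one_smul, one_smul, pow_mul] at h3
  rw [map_mul, map_pow, ← hθt, AlgEquiv.commutes, hθt, ← mul_sub, ← h3, map_mul, map_pow, ← hlev,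
    mul_lt_mul_iff_right₀ (v.pos hθ0)] at h2
  exact absurd (lt_of_pow_lt_pow_left₀ _ (v.nonneg _) h2) (not_lt.2 h1)

lemma exists_galois_eq_add (hθt : algebraMap F E t = θ) (hp : IsPlace v Γ t) (hr : 2 ≤ r)
    (hθ0 : θ ≠ 0)
    (hres : ∀ σ ∈ Γ, ∀ x, v x ≤ 1 → v (σ x - x) < 1) {a : k[X]} (ha : aeval θ a ≠ 0) {y : E}
    (hy : y ∈ tors k r θ a) (hy1 : 1 < v y)
    (hlev : v θ * v y ^ (q ^ (r - 1)) ^ a.natDegree = 1)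
    (hmin : ∀ x ∈ tors k r θ a, 1 < v x → v y ≤ v x)
    (hcard : Nat.card (unitTors k r θ hp.nonarch a) = (q ^ (r - 1)) ^ a.natDegree)
    {u : E} (hu : u ∈ unitTors k r θ hp.nonarch a) : ∃ σ ∈ Γ, σ y = y + u := by
  have ha0 : a ≠ 0 := by rintro rfl; simp at ha
  have hfin := finite_tors (k := k) (r := r) (by omega) hθ0 ha0
  refine hp.exists_eq_of_ncard_le (S := (y + ·) '' (unitTors k r θ hp.nonarch a : Set E))
    (m := -((q ^ (r - 1)) ^ a.natDegree : ℕ)) ?_ hy1.ne' (isSeparable_of_mem_tors hθt hr ha hy) ?_ ?_ ?_ ?_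
    ⟨u, hu, rfl⟩
  · rintro rfl; simp at hy1; linarith
  · rw [zpow_neg, zpow_natCast, hθt]
    exact (eq_inv_of_mul_eq_one_left hlev).symm
  · exact (Set.Finite.subset (Set.toFinite (tors k r θ a : Set E)) fun x hx => hx.1).image _
  · intro σ hσ
    exact ⟨_, galois_sub_mem_unitTors hθt hp hθ0 hres hy hlev hmin hσ, by simp⟩
  · rw [Set.ncard_image_of_injective _ (add_right_injective y), abs_neg, ← hcard, Nat.abs_cast]
    rfl

lemma galois_eq_of_coeff_zero_ne_zero (hθt : algebraMap F E t = θ) (hp : IsPlace v Γ t) (hr : 2 ≤ r)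
    (hθ : v θ < 1) (hres : ∀ σ ∈ Γ, ∀ x, v x ≤ 1 → v (σ x - x) < 1) {b : k[X]}
    (hb : b.coeff 0 ≠ 0) {x : E} (hx : x ∈ unitTors k r θ hp.nonarch b) {σ : E ≃ₐ[F] E}
    (hσ : σ ∈ Γ) : σ x = x := by
  by_contra h
  exact aeval_drin_ne_zero_of_abv_lt_one hp.nonarch hr hθ hb (sub_ne_zero.2 h) (hres σ hσ x hx.2)
    (sub_mem (galois_mem_tors hθt σ hx.1) hx.1)

lemma abv_pow_eq_of_mem_unitTors_X (hna : IsNonarchimedean v) (hr : 2 ≤ r)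
    (hθ : v θ < 1) {x : E} (hx : x ∈ unitTors k r θ hna X) (hx0 : x ≠ 0) :
    v x ^ (q ^ (r - 1) - 1) = v θ := by
  have h : x ∈ tors k r θ X := hx.1
  have hQ := one_lt_card_pow (k := k) hr
  have hvx := v.pos hx0
  have hx1 : v x ≤ 1 := hx.2
  have hlt : v (θ ^ (q - 1) * x ^ q ^ r) < v (x ^ q ^ (r - 1)) := by
    have h1 : q ^ (r - 1) ≤ q ^ r := Nat.pow_le_pow_right Fintype.card_pos (by omega)
    rw [map_mul, map_pow, map_pow, map_pow]
    calc v θ ^ (q - 1) * v x ^ q ^ r < 1 * v x ^ q ^ r := by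
          refine mul_lt_mul_of_pos_right (pow_lt_one₀ (v.nonneg _) hθ ?_) (by positivity)
          have := one_lt_card (k := k); omega
      _ ≤ _ := by rw [one_mul]; exact pow_le_pow_of_le_one (v.nonneg _) hx1 h1
  rw [LinearMap.mem_ker, aeval_X, drin_apply, add_assoc, add_eq_zero_iff_eq_neg] at h
  have h2 := congrArg v h
  rw [AbsoluteValue.map_neg, abv_add_eq_left hna hlt, map_mul, map_pow] at h2
  obtain ⟨m, hm⟩ : ∃ m, q ^ (r - 1) = m + 1 := ⟨q ^ (r - 1) - 1, by omega⟩
  rw [hm, pow_succ, mul_left_inj' hvx.ne'] at h2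
  rw [hm, Nat.add_sub_cancel, h2]

lemma exists_galois_eq_smul_X [IsAlgClosed E] (hθt : algebraMap F E t = θ) (hp : IsPlace v Γ t)
    (hr : 2 ≤ r) (hθ0 : θ ≠ 0) (hθ : v θ < 1)
    (hres : ∀ σ ∈ Γ, ∀ x, v x ≤ 1 → v (σ x - x) < 1) {c : k} (hc : c ≠ 0) :
    ∃ z ∈ Γ, ∀ x ∈ unitTors k r θ hp.nonarch X, z x = c • x := by
  have hQ := one_lt_card_pow (k := k) hr
  have hX : aeval θ (X : k[X]) ≠ 0 := by simpa using hθ0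
  obtain ⟨-, -, -, -, -, -, hcard⟩ := exists_generator (k := k) hp.nonarch hr hθ0 hθ hX
    (by simp)
  rw [natDegree_X, pow_one] at hcard
  have hfin : Finite (tors k r θ X) := finite_tors (k := k) (r := r) (by omega) hθ0 X_ne_zero
  set U := unitTors k r θ hp.nonarch X with hU
  have hUfin : (U : Set E).Finite :=
    Set.Finite.subset (Set.toFinite (tors k r θ X : Set E)) fun x hx => hx.1
  have hUn : (U : Set E).ncard = q ^ (r - 1) := hcard
  obtain ⟨x, hx, hx0⟩ := Set.exists_ne_of_one_lt_ncard (s := (U : Set E)) (by rwa [hUn]) 0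
  have hlev := abv_pow_eq_of_mem_unitTors_X hp.nonarch hr hθ hx hx0
  have hx1 : v x ≠ 1 := by
    intro h; rw [h, one_pow] at hlev; exact hθ.ne hlev.symm
  obtain ⟨z, hz, hzx⟩ := hp.exists_eq_of_ncard_le (S := (U : Set E) \ {0})
    (m := (q ^ (r - 1) - 1 : ℕ)) hx0 hx1 (isSeparable_of_mem_tors hθt hr hX hx.1)
    (by rw [zpow_natCast, hlev, hθt]) (hUfin.sdiff)
    (fun σ hσ => ⟨galois_mem_unitTors hθt hp hσ hx, by simpa using hx0⟩)
    (by rw [Set.ncard_sdiff_singleton_of_mem (zero_mem U), hUn, Nat.abs_cast])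
    (y := c • x) ⟨U.smul_mem c hx, by simpa using ⟨hc, hx0⟩⟩
  refine ⟨z, hz, fun x' hx' => ?_⟩
  by_cases hx'0 : x' = 0
  · simp [hx'0]
  by_contra hne
  have hQ1 : q ^ (r - 1) - 1 ≠ 0 := by omega
  have key : ∀ w ∈ U, w ≠ 0 → v w = v x := fun w hw hw0 =>
    (pow_left_inj₀ (v.nonneg _) (v.nonneg _) hQ1).1
      ((abv_pow_eq_of_mem_unitTors_X hp.nonarch hr hθ hw hw0).trans hlev.symm)
  have h1 := key _ (sub_mem (galois_mem_unitTors hθt hp hz hx') (U.smul_mem c hx'))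
    (sub_ne_zero.2 hne)
  have h2 := hres z hz (x' / x) (by
    rw [map_div₀, key x' hx' hx'0, div_self (v.pos hx0).ne'])
  have hcE : algebraMap k E c ≠ 0 := by simpa using hc
  have h3 : z x' - c • x' = (z (x' / x) - x' / x) * (c • x) := by
    rw [map_div₀, hzx, Algebra.smul_def, Algebra.smul_def]
    field_simp
  rw [h3, map_mul, abv_smul_finite hc] at h1
  have := v.pos hx0
  nlinarith

lemma exists_galois_eq_smul_X_pow [IsAlgClosed E] (hθt : algebraMap F E t = θ) (hp : IsPlace v Γ t)
    (hr : 2 ≤ r) (hθ0 : θ ≠ 0) (hθ : v θ < 1)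
    (hres : ∀ σ ∈ Γ, ∀ x, v x ≤ 1 → v (σ x - x) < 1) {c : k} (hc : c ≠ 0) (n : ℕ) :
    ∃ z ∈ Γ, ∀ x ∈ unitTors k r θ hp.nonarch (X ^ n), z x = c • x := by
  obtain ⟨z, hz, hzX⟩ := exists_galois_eq_smul_X hθt hp hr hθ0 hθ hres hc
  set Z : Module.End k E := ((z : E →ₐ[F] E).restrictScalars k).toLinearMap with hZ
  have hZa : ∀ x, Z x = z x := fun _ => rfl
  have key : ∀ m, ∀ x ∈ unitTors k r θ hp.nonarch (X ^ m),
      aeval Z ((X - C c) ^ m) x = 0 := by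
    intro m
    induction m with
    | zero => intro x hx; simpa using hx.1
    | succ m ih =>
      intro x hx
      rw [pow_succ, map_mul]
      have h1 := hzX (aeval (drin k r θ) ((X : k[X]) ^ m) x) ⟨by
        change aeval (drin k r θ) X (aeval (drin k r θ) ((X : k[X]) ^ m) x) = 0
        rw [← Module.End.mul_apply, ← map_mul, ← pow_succ']
        exact hx.1, abv_aeval_drin_le_one hp.nonarch hθ _ hx.2⟩
      refine ih _ ⟨?_, ?_⟩
      · change aeval (drin k r θ) ((X : k[X]) ^ m) _ = 0
        simp only [map_sub, aeval_X, aeval_C, LinearMap.sub_apply, Module.algebraMap_end_apply, hZa,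
          map_smul]
        rw [← galois_aeval_drin hθt, h1, sub_self]
      · simp only [map_sub, aeval_X, aeval_C, LinearMap.sub_apply, Module.algebraMap_end_apply, hZa]
        exact sub_mem (galois_mem_unitTors hθt hp hz hx).2 (Submodule.smul_mem _ c hx).2
  refine ⟨z ^ q ^ n, pow_mem hz _, fun x hx => ?_⟩
  have h1 := key n x hx
  have h2 : aeval Z ((X - C c) ^ q ^ n) x = 0 := by
    obtain ⟨d, hd⟩ := pow_dvd_pow (X - C c) (Nat.lt_pow_self (one_lt_card (k := k)) (n := n)).le
    rw [hd, mul_comm, map_mul, Module.End.mul_apply, h1, map_zero]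
  have h3 : (X - C c : k[X]) ^ q ^ n = X ^ q ^ n - C c := by
    have := map_sub (frob k k[X] ^ n) X (C c)
    simp only [frob_pow_apply] at this
    rw [this, ← C_pow, FiniteField.pow_card_pow]
  rw [h3] at h2
  simp only [map_sub, map_pow, aeval_X, aeval_C, LinearMap.sub_apply, Module.algebraMap_end_apply] at h2
  rw [← sub_eq_zero, ← h2]
  congr 1
  have : ∀ m, ∀ x, (z ^ m) x = (Z ^ m) x := by
    intro m
    induction m with
    | zero => simp
    | succ m ih => intro x; rw [pow_succ, pow_succ, AlgEquiv.mul_apply, ih]; rfl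
  exact this _ x

end ZeroPlaceGalois

section ZeroPlaceStructure

variable {k F E : Type*} [Field k] [Fintype k] [Field F] [Field E] [Algebra k F] [Algebra F E]
  [Algebra k E] [IsScalarTower k F E] {t : F} {θ : E} {r : ℕ}
  {v : AbsoluteValue E ℝ} {Γ : Subgroup (E ≃ₐ[F] E)}

local notation "q" => Fintype.card k

lemma aeval_mod_apply {T : Module.End k E} {a : k[X]} {y : E} (hy : aeval T a y = 0) (b : k[X]) :
    aeval T (b % a) y = aeval T b y := by
  conv_rhs => rw [← EuclideanDomain.mod_add_div b a, mul_comm a]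
  rw [map_add, map_mul, LinearMap.add_apply, Module.End.mul_apply, hy, map_zero, add_zero]

lemma dvd_of_aeval_drin_mem_unitTors (hna : IsNonarchimedean v) (hr : 2 ≤ r) (hθ0 : θ ≠ 0)
    (hθ : v θ < 1) {a : k[X]} (ha : a ≠ 0) {y : E} (hy : y ∈ tors k r θ a) (hy1 : 1 < v y)
    (hlev : v θ * v y ^ (q ^ (r - 1)) ^ a.natDegree = 1) {b : k[X]}
    (hb : aeval (drin k r θ) b y ∈ unitTors k r θ hna a) : a ∣ b := by
  by_contra hab
  have hm : b % a ≠ 0 := fun h => hab (EuclideanDomain.mod_eq_zero.1 h)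
  rw [← aeval_mod_apply hy] at hb
  have hlt : (b % a).natDegree < a.natDegree := natDegree_lt_natDegree hm (EuclideanDomain.mod_lt b ha)
  have h1 := abv_aeval_drin_of_lt hna hr hθ hm hy1
    (mul_abv_pow_lt_one (k := k) hr hθ0 hy1 hlt hlev)
  have h2 : v (aeval (drin k r θ) (b % a) y) ≤ 1 := hb.2
  rw [h1] at h2
  have hQ := one_lt_card_pow (k := k) hr
  exact absurd (one_lt_pow₀ hy1 (by positivity)) (not_lt.2 h2)

lemma exists_coprime_decomposition {a : k[X]} (ha : a ≠ 0) :
    ∃ (n : ℕ) (b e s : k[X]), b.coeff 0 ≠ 0 ∧ a = X ^ n * b ∧ b ∣ e ∧ s * X ^ n + e = 1 := by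
  obtain ⟨b, hab, hb⟩ := (FiniteMultiplicity.of_not_isUnit (a := (X : k[X])) not_isUnit_X ha).exists_eq_pow_mul_and_not_dvd
  obtain ⟨s, w, h⟩ := ((irreducible_X.coprime_iff_not_dvd).2 hb).pow_left (m := multiplicity X a)
  exact ⟨_, b, w * b, s, fun h => hb (X_dvd_iff.2 h), hab, dvd_mul_left _ _, h⟩

theorem exists_zero_place_structure [IsAlgClosed E] (hθt : algebraMap F E t = θ)
    (hp : IsPlace v Γ t) (hr : 2 ≤ r) (hq : 2 < q) (hθ0 : θ ≠ 0) (hθ : v θ < 1)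
    (hres : ∀ σ ∈ Γ, ∀ x, v x ≤ 1 → v (σ x - x) < 1) {a : k[X]} (ha : aeval θ a ≠ 0)
    (hd : 0 < a.natDegree) :
    ∃ (U : Submodule k E) (y : E) (e : k[X]), U ≤ tors k r θ a ∧
      (∀ b : k[X], ∀ x ∈ U, aeval (drin k r θ) b x ∈ U) ∧ y ∈ tors k r θ a ∧
      (∀ x ∈ tors k r θ a, ∃ b : k[X], x - aeval (drin k r θ) b y ∈ U) ∧
      (∀ b : k[X], aeval (drin k r θ) b y ∈ U → a ∣ b) ∧ a ∣ e * e - e ∧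
      (∀ u ∈ U, aeval (drin k r θ) e u = u →
        ∃ σ : E ≃ₐ[F] E, (∀ x ∈ U, σ x = x) ∧ σ y = y + u) ∧
      (∀ u ∈ U, ∃ σ : E ≃ₐ[F] E, (∀ x ∈ U,
        aeval (drin k r θ) (1 - e) (σ x) = aeval (drin k r θ) (1 - e) x) ∧ σ y = y + u) := by
  have hna := hp.nonarch
  have ha0 : a ≠ 0 := by rintro rfl; simp at ha
  obtain ⟨y, hy, hy1, hlev, hmin, hgen, hcard⟩ := exists_generator (k := k) hna hr hθ0 hθ ha hd
  obtain ⟨n, b, e, s, hb0, hab, hbe, hse⟩ := exists_coprime_decomposition ha0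
  set U := unitTors k r θ hna a with hU
  have hφU : ∀ b : k[X], ∀ x ∈ U, aeval (drin k r θ) b x ∈ U :=
    fun b x hx => aeval_drin_mem_unitTors hna hθ b hx
  have hσU : ∀ σ ∈ Γ, ∀ x ∈ U, σ x ∈ U := fun σ hσ x hx => galois_mem_unitTors hθt hp hσ hx
  have hmul : ∀ (f g : k[X]) (x : E),
      aeval (drin k r θ) f (aeval (drin k r θ) g x) = aeval (drin k r θ) (f * g) x := by
    intro f g x; rw [map_mul]; rfl
  have hax : ∀ (f : k[X]), ∀ x ∈ U, a ∣ f → aeval (drin k r θ) f x = 0 := by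
    rintro _ x hx ⟨g, rfl⟩
    rw [mul_comm, ← hmul, show aeval (drin k r θ) a x = 0 from hx.1, map_zero]
  have h1e : 1 - e = s * X ^ n := by rw [← hse]; ring
  have hbpart : ∀ σ ∈ Γ, ∀ x ∈ U, σ (aeval (drin k r θ) (1 - e) x) = aeval (drin k r θ) (1 - e) x := by
    intro σ hσ x hx
    refine galois_eq_of_coeff_zero_ne_zero hθt hp hr hθ hres hb0 ⟨?_, (hφU _ x hx).2⟩ hσ
    change aeval (drin k r θ) b _ = 0
    rw [hmul]
    refine hax _ x hx ⟨s, ?_⟩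
    rw [h1e, hab]; ring
  have hidem : a ∣ e * e - e := by
    obtain ⟨w, rfl⟩ := hbe
    refine ⟨-(w * s), ?_⟩
    have : b * w = 1 - s * X ^ n := by rw [← hse]; ring
    rw [hab]
    linear_combination (b * w) * this
  have hsplit : ∀ x, x = aeval (drin k r θ) e x + aeval (drin k r θ) (1 - e) x := by
    intro x; rw [← LinearMap.add_apply, ← map_add]; simp
  have htrans : ∀ y' ∈ tors k r θ a, v y' = v y → ∀ u ∈ U, ∃ σ ∈ Γ, σ y' = y' + u := by
    intro y' hy' hyy u hu
    exact exists_galois_eq_add hθt hp hr hθ0 hres ha hy' (by rwa [hyy]) (by rwa [hyy])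
      (by simpa [hyy] using hmin) hcard hu
  obtain ⟨c, hc⟩ : ∃ c : k, c ≠ 0 ∧ c ≠ 1 := by
    classical
    obtain ⟨c, -, hc⟩ := Finset.exists_mem_notMem_of_card_lt_card (s := ({0, 1} : Finset k))
      (t := Finset.univ) (Finset.card_le_two.trans_lt hq)
    exact ⟨c, by simpa using hc⟩
  have hc1 : 1 - c ≠ 0 := sub_ne_zero.2 (Ne.symm hc.2)
  obtain ⟨z, hz, hzX⟩ := exists_galois_eq_smul_X_pow hθt hp hr hθ0 hθ hres hc.1 n
  refine ⟨U, y, e, inf_le_left, hφU, hy, hgen,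
    fun b hb => dvd_of_aeval_drin_mem_unitTors hna hr hθ0 hθ ha0 hy hy1 hlev hb, hidem, ?_, ?_⟩
  · intro u hu heu
    have hzU : ∀ x ∈ U, z x = c • aeval (drin k r θ) e x + aeval (drin k r θ) (1 - e) x := by
      intro x hx
      conv_lhs => rw [hsplit x, map_add, hbpart z hz x hx]
      rw [hzX _ ⟨?_, (hφU _ x hx).2⟩]
      change aeval (drin k r θ) ((X : k[X]) ^ n) _ = 0
      rw [hmul]
      obtain ⟨w, rfl⟩ := hbe
      refine hax _ x hx ⟨w, ?_⟩
      rw [hab]; ring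
    set w := z y - y with hw
    have hwU : w ∈ U := galois_sub_mem_unitTors hθt hp hθ0 hres hy hlev hmin hz
    have heU := hφU e w hwU
    set y' := y + (1 - c)⁻¹ • aeval (drin k r θ) e w with hy'
    have hy'U : (1 - c)⁻¹ • aeval (drin k r θ) e w ∈ U := U.smul_mem _ heU
    have hy'v : v y' = v y := abv_add_eq_left hna (lt_of_le_of_lt hy'U.2 hy1)
    have hee : ∀ x ∈ U, aeval (drin k r θ) e (aeval (drin k r θ) e x) = aeval (drin k r θ) e x := by
      intro x hx
      rw [hmul, ← sub_eq_zero, ← LinearMap.sub_apply, ← map_sub]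
      exact hax _ x hx hidem
    have he1 : ∀ x ∈ U, aeval (drin k r θ) (1 - e) (aeval (drin k r θ) e x) = 0 := by
      intro x hx
      rw [map_sub, map_one, LinearMap.sub_apply, Module.End.one_apply, hee x hx, sub_self]
    have hzy' : z y' = y' + aeval (drin k r θ) (1 - e) w := by
      have h1 : z y = y + w := by rw [hw]; ring
      rw [hy', map_add, galois_smul, hzU _ heU, hee w hwU, he1 w hwU, h1, add_zero, smul_smul]
      have h2 : (1 - c)⁻¹ • aeval (drin k r θ) e w =
          aeval (drin k r θ) e w + ((1 - c)⁻¹ * c) • aeval (drin k r θ) e w := by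
        conv_rhs => rw [← one_smul k (aeval (drin k r θ) e w), smul_smul, mul_one, ← add_smul]
        congr 1; field_simp; ring
      rw [h2]
      linear_combination hsplit w
    set m := (c - 1)⁻¹ • u with hm
    have hmU : m ∈ U := U.smul_mem _ hu
    have hem : aeval (drin k r θ) e m = m := by rw [hm, map_smul, heu]
    obtain ⟨g, hg, hgy⟩ := htrans y' (add_mem hy hy'U.1) hy'v m hmU
    have hcomm : ∀ x ∈ U, z (g x) = g (z x) := by
      intro x hx
      rw [hzU _ (hσU g hg x hx), hzU x hx, map_add, galois_smul, galois_aeval_drin hθt,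
        galois_aeval_drin hθt]
    have hσ : ∀ x ∈ U, (z * g * (g * z)⁻¹) x = x := by
      intro x hx
      have hx' : (g * z)⁻¹ x ∈ U := hσU _ (inv_mem (mul_mem hg hz)) x hx
      rw [AlgEquiv.mul_apply, AlgEquiv.mul_apply, hcomm _ hx', ← AlgEquiv.mul_apply,
        ← AlgEquiv.mul_apply, mul_inv_cancel, AlgEquiv.one_apply]
    refine ⟨z * g * (g * z)⁻¹, hσ, ?_⟩
    have h1 : (g * z) y' = y' + m + aeval (drin k r θ) (1 - e) w := by
      rw [AlgEquiv.mul_apply, hzy', map_add, hgy, hbpart g hg w hwU]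
    have h2 : (z * g) y' = y' + aeval (drin k r θ) (1 - e) w + c • m := by
      have := he1 m hmU
      rw [hem] at this
      rw [AlgEquiv.mul_apply, hgy, map_add, hzy', hzU m hmU, hem, this, add_zero]
    have h3 : (z * g * (g * z)⁻¹) (y' + m + aeval (drin k r θ) (1 - e) w) =
        y' + aeval (drin k r θ) (1 - e) w + c • m := by
      rw [← h1, ← AlgEquiv.mul_apply, inv_mul_cancel_right, h2]
    rw [map_add, map_add, hσ m hmU, hσ _ (hφU _ w hwU), hy', map_add, hσ _ hy'U] at h3
    have h4 : u = c • m - m := by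
      calc u = ((c - 1) * (c - 1)⁻¹) • u := by rw [mul_inv_cancel₀ (sub_ne_zero.2 hc.2), one_smul]
        _ = c • m - m := by rw [mul_smul, sub_smul, one_smul]
    rw [h4]
    linear_combination h3
  · intro u hu
    obtain ⟨σ, hσ, hσy⟩ := htrans y hy rfl u hu
    refine ⟨σ, fun x hx => ?_, hσy⟩
    rw [← galois_aeval_drin hθt, hbpart σ hσ x hx]

end ZeroPlaceStructure

section FixedField

variable (k E : Type*) [Field k] [Fintype k] [Field E] [Algebra k E]

local notation "q" => Fintype.card k

/-- The subfield of `E` fixed by the `n`-th power of the `q`-Frobenius. -/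
def frobFixed (n : ℕ) : IntermediateField k E :=
  (AlgHom.equalizer (FiniteField.frobeniusAlgHom k E ^ n) (AlgHom.id k E)).toIntermediateField
    (fun x hx => by rw [AlgHom.mem_equalizer] at *; rw [map_inv₀, hx, map_inv₀])

variable {k E}

lemma mem_frobFixed {n : ℕ} {x : E} : x ∈ frobFixed k E n ↔ x ^ q ^ n = x := by
  change (FiniteField.frobeniusAlgHom k E ^ n) x = x ↔ _
  rw [← frob_pow_apply (k := k)]
  have : ∀ m, ∀ x, (FiniteField.frobeniusAlgHom k E ^ m) x = (frob k E ^ m) x := by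
    intro m
    induction m with
    | zero => intro x; simp
    | succ m ih => intro x; rw [pow_succ, pow_succ, AlgHom.mul_apply, ih]; rfl
  rw [this]

lemma card_frobFixed [IsAlgClosed E] {n : ℕ} (hn : n ≠ 0) : Nat.card (frobFixed k E n) = q ^ n := by
  classical
  obtain ⟨p, hp⟩ := CharP.exists k
  have hpE : CharP E p := charP_of_injective_algebraMap (algebraMap k E).injective p
  obtain ⟨m, hpp, hm⟩ := FiniteField.card k p
  have : Fact p.Prime := ⟨hpp⟩
  have h1 : 1 < q ^ n := Nat.one_lt_pow hn (one_lt_card (k := k))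
  have hsep : (X ^ q ^ n - X : E[X]).Separable := by
    refine @galois_poly_separable E _ p _ hpE ?_
    rw [hm]
    exact dvd_pow (dvd_pow_self p m.ne_zero) hn
  have := card_rootSet_eq_natDegree (K := E) hsep (IsAlgClosed.splits_domain _)
  rw [FiniteField.X_pow_card_sub_X_natDegree_eq E h1, ← Nat.card_eq_fintype_card] at this
  rw [← this]
  refine Nat.card_congr (Equiv.setCongr ?_)
  ext x
  rw [mem_rootSet]
  change x ∈ frobFixed k E n ↔ _
  rw [mem_frobFixed]
  simp [sub_eq_zero, FiniteField.X_pow_card_sub_X_ne_zero E h1]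

lemma abv_frobFixed {v : AbsoluteValue E ℝ} {n : ℕ} (hn : n ≠ 0) {x : E} (hx : x ∈ frobFixed k E n)
    (hx0 : x ≠ 0) : v x = 1 := by
  rw [mem_frobFixed] at hx
  have h1 : 1 < q ^ n := Nat.one_lt_pow hn (one_lt_card (k := k))
  obtain ⟨m, hm⟩ : ∃ m, q ^ n = m + 1 := ⟨q ^ n - 1, by omega⟩
  rw [hm, pow_succ, mul_eq_right₀ hx0] at hx
  have h2 := congrArg v hx
  rw [map_pow, map_one] at h2
  exact (pow_eq_one_iff_of_nonneg (v.nonneg _) (by omega)).1 h2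

end FixedField

section InftyPlace

variable {k : Type*} [Field k] [Fintype k] {E : Type*} [Field E] [Algebra k E]
  {v : AbsoluteValue E ℝ} {r : ℕ} {θ : E} {ρ : ℝ}

local notation "q" => Fintype.card k

lemma exists_radius (k : Type*) [Field k] [Fintype k] (hq : 2 < q) (hr : 1 ≤ r) (hθ : 1 < v θ) :
    ∃ ρ : ℝ, 0 < ρ ∧ ρ < 1 ∧ v θ ^ (q - 2) * ρ ^ (q ^ r - 1) = 1 := by
  have h1 : 1 < q ^ r := Nat.one_lt_pow (by omega) (by omega)
  have h2 : q ^ r - 1 ≠ 0 := by omega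
  have h3 : 1 < v θ ^ (q - 2) := one_lt_pow₀ hθ (by omega)
  have h0 : 0 < (v θ ^ (q - 2))⁻¹ := by positivity
  refine ⟨(v θ ^ (q - 2))⁻¹ ^ ((q ^ r - 1 : ℕ) : ℝ)⁻¹, Real.rpow_pos_of_pos h0 _, ?_, ?_⟩
  · exact Real.rpow_lt_one h0.le (inv_lt_one_of_one_lt₀ h3) (by positivity)
  · rw [Real.rpow_inv_natCast_pow h0.le h2, mul_inv_cancel₀ (by positivity)]

lemma abv_drin_last_infty (hq : 2 ≤ q) (x : E) :
    v (θ ^ (q - 1) * x ^ q ^ r) = v θ * v x * (v θ ^ (q - 2) * v x ^ (q ^ r - 1)) := by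
  have h1 : q - 1 = (q - 2) + 1 := by omega
  have h2 : q ^ r = (q ^ r - 1) + 1 := by have : 0 < q ^ r := by positivity
                                          omega
  rw [map_mul, map_pow, map_pow, h1]
  conv_lhs => rw [h2]
  ring

lemma abv_drin_sub_lt (hna : IsNonarchimedean v) (hr : 2 ≤ r) (hθ : 1 < v θ) (hρ1 : ρ < 1)
    (hρ : v θ ^ (q - 2) * ρ ^ (q ^ r - 1) = 1) {x : E} (hx0 : x ≠ 0) (hx : v x < ρ) :
    v (drin k r θ x - θ * x) < v θ * v x := by
  have hQ := one_lt_card_pow (k := k) hr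
  have hq := one_lt_card (k := k)
  have h0 := v.pos hx0
  have h1 : 1 < q ^ r := Nat.one_lt_pow (by omega) (by omega)
  have h2 : drin k r θ x - θ * x = x ^ q ^ (r - 1) + θ ^ (q - 1) * x ^ q ^ r := by
    rw [drin_apply]; ring
  rw [h2]
  refine abv_add_lt hna ?_ ?_
  · rw [map_pow]
    have : v x ^ q ^ (r - 1) ≤ v x := pow_le_of_le_one h0.le (by linarith) (by omega)
    nlinarith
  · rw [abv_drin_last_infty hq]
    refine mul_lt_of_lt_one_right (by positivity) ?_
    rw [← hρ]
    have : 0 < v θ ^ (q - 2) := by positivity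
    exact mul_lt_mul_of_pos_left (pow_lt_pow_left₀ hx h0.le (by omega)) this

lemma abv_drin_eq_mul (hna : IsNonarchimedean v) (hr : 2 ≤ r) (hθ : 1 < v θ) (hρ1 : ρ < 1)
    (hρ : v θ ^ (q - 2) * ρ ^ (q ^ r - 1) = 1) {x : E} (hx0 : x ≠ 0) (hx : v x < ρ) :
    v (drin k r θ x) = v θ * v x := by
  have := abv_drin_sub_lt hna hr hθ hρ1 hρ hx0 hx
  rw [← map_mul] at this ⊢
  exact abv_eq_of_sub_lt hna this

lemma abv_lt_abv_drin (hna : IsNonarchimedean v) (hr : 2 ≤ r) (hθ : 1 < v θ) (hρ0 : 0 < ρ)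
    (hρ : v θ ^ (q - 2) * ρ ^ (q ^ r - 1) = 1) {x : E} (hx : ρ < v x) :
    v x < v (drin k r θ x) := by
  have hQ := one_lt_card_pow (k := k) hr
  have hq := one_lt_card (k := k)
  have h0 : 0 < v x := hρ0.trans hx
  have h1 : 1 < q ^ r := Nat.one_lt_pow (by omega) (by omega)
  have h2 : v θ * v x < v (θ ^ (q - 1) * x ^ q ^ r) := by
    rw [abv_drin_last_infty hq]
    refine lt_mul_of_one_lt_right (by positivity) ?_
    rw [← hρ]
    have : 0 < v θ ^ (q - 2) := by positivity
    exact mul_lt_mul_of_pos_left (pow_lt_pow_left₀ hx hρ0.le (by omega)) this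
  have h3 : v x < v θ * v x := by nlinarith
  have h4 : v (x ^ q ^ (r - 1)) < v (θ ^ (q - 1) * x ^ q ^ r) := by
    rcases le_or_gt (v x) 1 with h | h
    · rw [map_pow]
      exact (pow_le_of_le_one h0.le h (by omega)).trans_lt (h3.trans h2)
    · rw [map_mul, map_pow, map_pow, map_pow]
      calc v x ^ q ^ (r - 1) < v x ^ q ^ r := pow_lt_pow_right₀ h (Nat.pow_lt_pow_right hq (by omega))
        _ ≤ _ := le_mul_of_one_le_left (by positivity) (one_le_pow₀ hθ.le)
  rw [drin_apply, abv_add_eq_right hna (abv_add_lt hna (by rwa [map_mul]) h4)]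
  exact h3.trans h2

lemma abv_le_of_mem_tors (hna : IsNonarchimedean v) (hr : 2 ≤ r) (hθ : 1 < v θ) (hρ0 : 0 < ρ)
    (hρ : v θ ^ (q - 2) * ρ ^ (q ^ r - 1) = 1) {a : k[X]} (ha : a ≠ 0) {x : E}
    (hx : x ∈ tors k r θ a) : v x ≤ ρ := by
  have hθ0 : θ ≠ 0 := by rintro rfl; simp at hθ; linarith
  have hfin := finite_tors (k := k) (r := r) (by omega) hθ0 ha
  obtain ⟨y, hy, hmax⟩ := Set.exists_max_image (tors k r θ a : Set E) v (Set.toFinite _) ⟨x, hx⟩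
  refine (hmax x hx).trans (not_lt.1 fun h => ?_)
  exact absurd (abv_lt_abv_drin hna hr hθ hρ0 hρ h) (not_lt.2 (hmax _ (drin_mem_tors hy)))

lemma abv_aeval_X_pow_sub_lt (hna : IsNonarchimedean v) (hr : 2 ≤ r) (hθ : 1 < v θ) (hρ1 : ρ < 1)
    (hρ : v θ ^ (q - 2) * ρ ^ (q ^ r - 1) = 1) {x : E} (hx0 : x ≠ 0) {j : ℕ}
    (hx : v θ ^ j * v x ≤ ρ) :
    v (aeval (drin k r θ) ((X : k[X]) ^ j) x - θ ^ j * x) < v θ ^ j * v x := by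
  have h0 := v.pos hx0
  induction j with
  | zero => simpa using h0
  | succ j ih =>
    have hlt : v θ ^ j * v x < v θ ^ (j + 1) * v x := by
      have : 0 < v θ ^ j * v x := by positivity
      rw [pow_succ]; nlinarith
    have ih := ih (hlt.le.trans hx)
    set y := aeval (drin k r θ) ((X : k[X]) ^ j) x with hy
    have hyv : v y = v θ ^ j * v x := by
      rw [← map_pow, ← map_mul] at ih ⊢; exact abv_eq_of_sub_lt hna ih
    have hy0 : y ≠ 0 := by
      rw [← v.ne_zero_iff, hyv]; positivity
    have h1 : aeval (drin k r θ) ((X : k[X]) ^ (j + 1)) x - θ ^ (j + 1) * x =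
        (drin k r θ y - θ * y) + θ * (y - θ ^ j * x) := by
      rw [pow_succ', map_mul, aeval_X, Module.End.mul_apply, ← hy]; ring
    rw [h1]
    refine abv_add_lt hna ?_ ?_
    · have := abv_drin_sub_lt hna hr hθ hρ1 hρ hy0 (by rw [hyv]; linarith)
      rwa [hyv, ← mul_assoc, ← pow_succ'] at this
    · rw [map_mul, pow_succ', mul_assoc]
      exact mul_lt_mul_of_pos_left ih (by linarith)

lemma abv_aeval_drin_infty (hna : IsNonarchimedean v) (hr : 2 ≤ r) (hθ : 1 < v θ) (hρ1 : ρ < 1)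
    (hρ : v θ ^ (q - 2) * ρ ^ (q ^ r - 1) = 1) {x : E} (hx0 : x ≠ 0) {b : k[X]} (hb : b ≠ 0)
    (hx : v θ ^ b.natDegree * v x ≤ ρ) :
    v (aeval (drin k r θ) b x) = v θ ^ b.natDegree * v x := by
  have h0 := v.pos hx0
  induction b using divX_induction with
  | h0 => simp at hb
  | h1 c hc => simp [Module.algebraMap_end_apply, abv_smul_finite hc]
  | h2 b hd ih =>
    have hd' : b.natDegree = b.divX.natDegree + 1 := by rw [natDegree_divX_eq_natDegree_tsub_one]; omega
    have hlt : v θ ^ b.divX.natDegree * v x < v θ ^ b.natDegree * v x := by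
      have : 0 < v θ ^ b.divX.natDegree * v x := by positivity
      rw [hd', pow_succ]; nlinarith
    have ih := ih (divX_ne_zero_of_natDegree_pos hd) (hlt.le.trans hx)
    have h1 := abv_drin_eq_mul hna hr hθ hρ1 hρ (x := aeval (drin k r θ) b.divX x)
      (by rw [← v.ne_zero_iff, ih]; positivity) (by rw [ih]; linarith)
    rw [ih, ← mul_assoc, ← pow_succ', ← hd'] at h1
    rw [aeval_end_divX, abv_add_eq_left hna, h1]
    rw [h1]
    refine (abv_smul_finite_le _ _).trans_lt (lt_of_le_of_lt ?_ hlt)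
    exact le_mul_of_one_le_left h0.le (one_le_pow₀ hθ.le)

lemma radius_lt_of_mem_tors (hna : IsNonarchimedean v) (hr : 2 ≤ r) (hθ : 1 < v θ) (hρ1 : ρ < 1)
    (hρ : v θ ^ (q - 2) * ρ ^ (q ^ r - 1) = 1) {a : k[X]} (ha : a ≠ 0) {x : E}
    (hx : x ∈ tors k r θ a) (hx0 : x ≠ 0) : ρ < v θ ^ a.natDegree * v x := by
  by_contra! h
  have h1 := abv_aeval_drin_infty hna hr hθ hρ1 hρ hx0 ha h
  rw [show aeval (drin k r θ) a x = 0 from hx, map_zero] at h1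
  have := v.pos hx0
  have : 0 < v θ ^ a.natDegree * v x := by positivity
  linarith

lemma mul_abv_eq_radius (hna : IsNonarchimedean v) (hr : 2 ≤ r) (hθ : 1 < v θ) (hρ0 : 0 < ρ)
    (hρ1 : ρ < 1) (hρ : v θ ^ (q - 2) * ρ ^ (q ^ r - 1) = 1) {a : k[X]} (ha : a ≠ 0) {x : E}
    (hx : x ∈ tors k r θ a) {j : ℕ} (h1 : v θ ^ j * v x ≤ ρ) (h2 : ρ < v θ ^ (j + 1) * v x) :
    v θ ^ j * v x = ρ := by
  have hx0 : x ≠ 0 := by rintro rfl; simp at h2; linarith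
  refine le_antisymm h1 (not_lt.1 fun h => ?_)
  have h3 := abv_aeval_drin_infty hna hr hθ hρ1 hρ hx0 (b := (X : k[X]) ^ j)
    (pow_ne_zero _ X_ne_zero) (by rwa [natDegree_X_pow])
  rw [natDegree_X_pow] at h3
  have h5 := v.pos hx0
  have h4 := abv_drin_eq_mul hna hr hθ hρ1 hρ (x := aeval (drin k r θ) ((X : k[X]) ^ j) x)
    (by rw [← v.ne_zero_iff, h3]; positivity) (by rwa [h3])
  rw [h3, ← mul_assoc, ← pow_succ'] at h4
  have h6 := abv_le_of_mem_tors hna hr hθ hρ0 hρ ha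
    (drin_mem_tors (aeval_drin_mem_tors ((X : k[X]) ^ j) hx))
  linarith

lemma abv_one_add_lt_one (hna : IsNonarchimedean v) (hr : 2 ≤ r) (hθ : 1 < v θ) (hρ0 : 0 < ρ)
    (hρ1 : ρ < 1) (hρ : v θ ^ (q - 2) * ρ ^ (q ^ r - 1) = 1) {a : k[X]} (ha : a ≠ 0) {y : E}
    (hy : y ∈ tors k r θ a) (hyρ : v y = ρ) : v (1 + θ ^ (q - 2) * y ^ (q ^ r - 1)) < 1 := by
  have hQ := one_lt_card_pow (k := k) hr
  have hq := one_lt_card (k := k)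
  have h1 := abv_le_of_mem_tors hna hr hθ hρ0 hρ ha (drin_mem_tors hy)
  have h2 : v (y ^ q ^ (r - 1)) ≤ ρ := by
    rw [map_pow, hyρ]
    exact pow_le_of_le_one hρ0.le hρ1.le (by omega)
  have h3 : drin k r θ y - y ^ q ^ (r - 1) = θ * y * (1 + θ ^ (q - 2) * y ^ (q ^ r - 1)) := by
    have h4 : q - 1 = (q - 2) + 1 := by omega
    have h5 : y ^ q ^ r = y ^ (q ^ r - 1) * y := by
      rw [← pow_succ]; congr 1; have : 0 < q ^ r := by positivity
      omega
    rw [drin_apply, h4, h5]; ring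
  have h4 := abv_sub_le hna h1 h2
  rw [h3, map_mul, map_mul, hyρ] at h4
  by_contra! h
  have : ρ < v θ * ρ := by nlinarith
  have : v θ * ρ ≤ v θ * ρ * v (1 + θ ^ (q - 2) * y ^ (q ^ r - 1)) :=
    le_mul_of_one_le_right (by positivity) h
  linarith

lemma exists_abv_sub_mul_lt_radius [IsAlgClosed E] (hna : IsNonarchimedean v) (hr : 2 ≤ r)
    (hθ : 1 < v θ) (hρ0 : 0 < ρ)
    (hρ1 : ρ < 1) (hρ : v θ ^ (q - 2) * ρ ^ (q ^ r - 1) = 1) {a : k[X]} (ha : a ≠ 0) {y y0 : E}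
    (hy : y ∈ tors k r θ a) (hyρ : v y = ρ) (hy0 : y0 ∈ tors k r θ a) (hy0ρ : v y0 = ρ) :
    ∃ ζ : frobFixed k E r, v (y - ζ * y0) < ρ := by
  have hcard := card_frobFixed (k := k) (E := E) (n := r) (by omega)
  have : Finite (frobFixed k E r) := Nat.finite_of_card_ne_zero (by rw [hcard]; positivity)
  have := Fintype.ofFinite (frobFixed k E r)
  have hy00 : y0 ≠ 0 := by rw [← v.ne_zero_iff, hy0ρ]; exact hρ0.ne'
  have hθ0 : θ ≠ 0 := by rintro rfl; simp at hθ; linarith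
  rw [Nat.card_eq_fintype_card] at hcard
  have h1 := abv_sub_lt hna (abv_one_add_lt_one hna hr hθ hρ0 hρ1 hρ ha hy hyρ)
    (abv_one_add_lt_one hna hr hθ hρ0 hρ1 hρ ha hy0 hy0ρ)
  have h2 : v ((y / y0) ^ Fintype.card (frobFixed k E r) - y / y0) < 1 := by
    rw [hcard]
    have h3 : (y / y0) ^ q ^ r - y / y0 = (y / y0) * (((1 + θ ^ (q - 2) * y ^ (q ^ r - 1)) -
        (1 + θ ^ (q - 2) * y0 ^ (q ^ r - 1))) / (θ ^ (q - 2) * y0 ^ (q ^ r - 1))) := by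
      rw [add_sub_add_left_eq_sub, ← mul_sub, mul_div_mul_left _ _ (pow_ne_zero _ hθ0), sub_div,
        ← div_pow, div_self (pow_ne_zero _ hy00), mul_sub, mul_one, ← pow_succ']
      congr 2; have : 0 < q ^ r := by positivity
      omega
    rw [h3, map_mul, map_div₀, map_div₀, map_mul, map_pow, map_pow, hyρ, hy0ρ, hρ, div_self hρ0.ne',
      one_mul, div_one]
    exact h1
  obtain ⟨ζ, hζ⟩ := exists_abv_sub_algebraMap_lt_one h2
  refine ⟨ζ, ?_⟩
  have h3 : y - ζ * y0 = (y / y0 - ζ) * y0 := by field_simp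
  rw [h3, map_mul, hy0ρ]
  exact mul_lt_of_lt_one_left hρ0 hζ

lemma exists_abv_sub_mul_lt [IsAlgClosed E] (hna : IsNonarchimedean v) (hr : 2 ≤ r)
    (hθ : 1 < v θ) (hρ0 : 0 < ρ)
    (hρ1 : ρ < 1) (hρ : v θ ^ (q - 2) * ρ ^ (q ^ r - 1) = 1) {a : k[X]} (ha : a ≠ 0) {x y : E}
    {j : ℕ} (hx : x ∈ tors k r θ a) (hxρ : v θ ^ j * v x = ρ) (hy : y ∈ tors k r θ a)
    (hyρ : v θ ^ j * v y = ρ) : ∃ ζ : frobFixed k E r, v (x - ζ * y) < v y := by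
  have key : ∀ z ∈ tors k r θ a, v θ ^ j * v z = ρ →
      v (aeval (drin k r θ) ((X : k[X]) ^ j) z - θ ^ j * z) < ρ ∧
      v (aeval (drin k r θ) ((X : k[X]) ^ j) z) = ρ := by
    intro z hz hzρ
    have hz0 : z ≠ 0 := by rintro rfl; simp at hzρ; linarith
    have h1 := abv_aeval_X_pow_sub_lt (k := k) (r := r) hna hr hθ hρ1 hρ hz0 hzρ.le
    refine ⟨by rwa [hzρ] at h1, ?_⟩
    rw [← hzρ]
    rw [← map_pow, ← map_mul] at h1 ⊢
    exact abv_eq_of_sub_lt hna h1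
  obtain ⟨ζ, hζ⟩ := exists_abv_sub_mul_lt_radius hna hr hθ hρ0 hρ1 hρ ha
    (aeval_drin_mem_tors _ hx) (key x hx hxρ).2 (aeval_drin_mem_tors _ hy) (key y hy hyρ).2
  refine ⟨ζ, ?_⟩
  have hζ1 : v (ζ : E) ≤ 1 := by
    by_cases h : (ζ : E) = 0
    · simp [h]
    · exact (abv_frobFixed (by omega) ζ.2 h).le
  have h0 : 0 < v θ ^ j := by positivity
  have h1 : v (θ ^ j * (x - ζ * y)) < ρ := by
    set x' := aeval (drin k r θ) ((X : k[X]) ^ j) x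
    set y' := aeval (drin k r θ) ((X : k[X]) ^ j) y
    have : θ ^ j * (x - ζ * y) = (x' - ζ * y') - ((x' - θ ^ j * x) - ζ * (y' - θ ^ j * y)) := by ring
    rw [this]
    refine abv_sub_lt hna hζ (abv_sub_lt hna (key x hx hxρ).1 ?_)
    rw [map_mul]
    exact (mul_le_of_le_one_left (v.nonneg _) hζ1).trans_lt (key y hy hyρ).1
  rw [map_mul, map_pow, ← hyρ, mul_lt_mul_iff_right₀ h0] at h1
  exact h1

end InftyPlace

section LeadingMap

variable {k E : Type*} [Field k] [Field E] [Algebra k E] {v : AbsoluteValue E ℝ}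

lemma leading_unique (hna : IsNonarchimedean v) {K : IntermediateField k E}
    (hK : ∀ ζ ∈ K, ζ ≠ 0 → v ζ = 1) {x y : E} {ζ ξ : K}
    (h1 : v (x - ζ * y) < v y) (h2 : v (x - ξ * y) < v y) : ζ = ξ := by
  by_contra hne
  have h3 := abv_sub_lt hna h1 h2
  have h4 : x - ζ * y - (x - ξ * y) = ((ξ - ζ : K) : E) * y := by push_cast; ring
  rw [h4, map_mul, hK _ (ξ - ζ).2 (by simpa [sub_eq_zero, eq_comm] using hne), one_mul] at h3
  exact lt_irrefl _ h3

lemma abv_mul_finite_lt {K : IntermediateField k E} (hK : ∀ ζ ∈ K, ζ ≠ 0 → v ζ = 1) {x : E}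
    {B : ℝ} (ζ : K) (h : v x < B) : v (ζ * x) < B := by
  by_cases h0 : (ζ : E) = 0
  · rw [h0, zero_mul, map_zero]; exact (v.nonneg _).trans_lt h
  · rwa [map_mul, hK _ ζ.2 h0, one_mul]

lemma exists_leading_map (hna : IsNonarchimedean v) {K : IntermediateField k E}
    (hK : ∀ ζ ∈ K, ζ ≠ 0 → v ζ = 1) {W : Submodule k E} {y : E}
    (hex : ∀ x ∈ W, ∃ ζ : K, v (x - ζ * y) < v y) :
    ∃ ι : W →ₗ[k] K, ∀ x : W, v ((x : E) - ι x * y) < v y := by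
  choose f hf using fun x : W => hex x x.2
  refine ⟨{ toFun := f, map_add' := fun x x' => ?_, map_smul' := fun c x => ?_ }, hf⟩
  · refine leading_unique hna hK (hf _) ?_
    have : ((x + x' : W) : E) - ((f x + f x' : K) : E) * y = (x - f x * y) + (x' - f x' * y) := by
      push_cast; ring
    rw [this]
    exact abv_add_lt hna (hf _) (hf _)
  · refine leading_unique hna hK (hf _) ?_
    have : ((c • x : W) : E) - (((RingHom.id k) c • f x : K) : E) * y =
        (algebraMap k K c : K) * (x - f x * y) := by
      simp [Algebra.smul_def]; ring
    rw [this]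
    exact abv_mul_finite_lt hK _ (hf _)

end LeadingMap

section Ball

variable {k : Type*} [Field k] [Fintype k] {E : Type*} [Field E] [Algebra k E]
  {v : AbsoluteValue E ℝ} {r : ℕ} {θ : E} {ρ : ℝ}

local notation "q" => Fintype.card k

lemma abv_sum_lt (hna : IsNonarchimedean v) {α : Type*} (s : Finset α) {f : α → E} {B : ℝ}
    (hB : 0 < B) (h : ∀ i ∈ s, v (f i) < B) : v (∑ i ∈ s, f i) < B :=
  Finset.sum_induction f (fun x => v x < B) (fun _ _ => abv_add_lt hna) (by simpa) h

variable (k r θ ρ) in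
/-- The torsion points `x` with `|θ ^ j x| ≤ ρ`. -/
def ballTors (hna : IsNonarchimedean v) (hρ0 : 0 < ρ) (a : k[X]) (j : ℕ) : Submodule k E where
  carrier := {x | x ∈ tors k r θ a ∧ v (θ ^ j * x) ≤ ρ}
  add_mem' := fun hx hy => ⟨add_mem hx.1 hy.1, by rw [mul_add]; exact abv_add_le hna hx.2 hy.2⟩
  zero_mem' := ⟨zero_mem _, by simpa using hρ0.le⟩
  smul_mem' := fun c x hx => ⟨Submodule.smul_mem _ _ hx.1, by
    rw [mul_smul_comm]; exact (abv_smul_finite_le _ _).trans hx.2⟩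

lemma mem_ballTors {hna : IsNonarchimedean v} {hρ0 : 0 < ρ} {a : k[X]} {j : ℕ} {x : E} :
    x ∈ ballTors k r θ ρ hna hρ0 a j ↔ x ∈ tors k r θ a ∧ v θ ^ j * v x ≤ ρ := by
  rw [← map_pow, ← map_mul]; rfl

variable [IsAlgClosed E]

lemma exists_abv_sub_mul_lt_of_mem_ballTors (hna : IsNonarchimedean v) (hr : 2 ≤ r) (hθ : 1 < v θ)
    (hρ0 : 0 < ρ) (hρ1 : ρ < 1) (hρ : v θ ^ (q - 2) * ρ ^ (q ^ r - 1) = 1) {a : k[X]} (ha : a ≠ 0)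
    {j : ℕ} {y : E} (hy : y ∈ tors k r θ a) (hyρ : v θ ^ j * v y = ρ) {x : E}
    (hx : x ∈ ballTors k r θ ρ hna hρ0 a j) : ∃ ζ : frobFixed k E r, v (x - ζ * y) < v y := by
  obtain ⟨hx, hxρ⟩ := mem_ballTors.1 hx
  rcases hxρ.lt_or_eq with h | h
  · refine ⟨0, ?_⟩
    rw [← hyρ] at h
    simpa using lt_of_mul_lt_mul_left h (by positivity)
  · exact exists_abv_sub_mul_lt hna hr hθ hρ0 hρ1 hρ ha hx h hy hyρ

lemma card_ballTors_le (hna : IsNonarchimedean v) (hr : 2 ≤ r) (hθ : 1 < v θ)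
    (hρ0 : 0 < ρ) (hρ1 : ρ < 1) (hρ : v θ ^ (q - 2) * ρ ^ (q ^ r - 1) = 1) {a : k[X]} (ha : a ≠ 0)
    (j : ℕ) : Nat.card (ballTors k r θ ρ hna hρ0 a j) ≤
      q ^ r * Nat.card (ballTors k r θ ρ hna hρ0 a (j + 1)) := by
  have hθ0 : θ ≠ 0 := by rintro rfl; simp at hθ; linarith
  have hfin := finite_tors (k := k) (r := r) (by omega) hθ0 ha
  have hfin' : ∀ j, Finite (ballTors k r θ ρ hna hρ0 a j) := fun j =>
    Set.Finite.subset (Set.toFinite (tors k r θ a : Set E)) fun x hx => hx.1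
  by_cases h : ∃ y ∈ tors k r θ a, v θ ^ j * v y = ρ
  · obtain ⟨y, hy, hyρ⟩ := h
    obtain ⟨ι, hι⟩ := exists_leading_map hna
      (fun ζ hζ h => abv_frobFixed (k := k) (n := r) (by omega) hζ h)
      (fun x hx => exists_abv_sub_mul_lt_of_mem_ballTors hna hr hθ hρ0 hρ1 hρ ha hy hyρ hx)
    have hcard := card_frobFixed (k := k) (E := E) (n := r) (by omega)
    have : Finite (frobFixed k E r) := Nat.finite_of_card_ne_zero (by rw [hcard]; positivity)
    rw [Submodule.card_eq_card_quotient_mul_card (LinearMap.ker ι),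
      Nat.card_congr ι.quotKerEquivRange.toEquiv, mul_comm]
    refine Nat.mul_le_mul ?_ ?_
    · rw [← hcard]
      exact Nat.card_le_card_of_injective _ Subtype.val_injective
    · refine Nat.card_le_card_of_injective (fun x : LinearMap.ker ι => (⟨x.1.1, ?_⟩ :
        ballTors k r θ ρ hna hρ0 a (j + 1))) ?_
      · obtain ⟨hx1, hx2⟩ := mem_ballTors.1 x.1.2
        refine mem_ballTors.2 ⟨hx1, not_lt.1 fun h => ?_⟩
        have h1 := mul_abv_eq_radius hna hr hθ hρ0 hρ1 hρ ha hx1 hx2 h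
        have h2 := hι x.1
        rw [show ι x.1 = 0 from x.2] at h2
        simp only [ZeroMemClass.coe_zero, zero_mul, sub_zero] at h2
        rw [← h1] at hyρ
        have h3 : 0 < v θ ^ j := by positivity
        have := mul_left_cancel₀ h3.ne' hyρ
        linarith
      · intro x y hxy
        exact Subtype.ext (Subtype.ext (Subtype.mk.inj hxy))
  · push Not at h
    refine (Nat.card_mono (Set.toFinite _) (s := (ballTors k r θ ρ hna hρ0 a j : Set E))
      (t := (ballTors k r θ ρ hna hρ0 a (j + 1) : Set E)) ?_).trans
      (Nat.le_mul_of_pos_left _ (by positivity))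
    intro x hx
    obtain ⟨hx1, hx2⟩ := mem_ballTors.1 hx
    exact mem_ballTors.2 ⟨hx1, not_lt.1 fun h' =>
      h x hx1 (mul_abv_eq_radius hna hr hθ hρ0 hρ1 hρ ha hx1 hx2 h')⟩

lemma card_ballTors_pred (hna : IsNonarchimedean v) (hr : 2 ≤ r) (hθ : 1 < v θ)
    (hρ0 : 0 < ρ) (hρ1 : ρ < 1) (hρ : v θ ^ (q - 2) * ρ ^ (q ^ r - 1) = 1) {a : k[X]}
    (ha : aeval θ a ≠ 0) (hd : 0 < a.natDegree) :
    Nat.card (ballTors k r θ ρ hna hρ0 a (a.natDegree - 1)) = q ^ r := by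
  have hθ0 : θ ≠ 0 := by rintro rfl; simp at hθ; linarith
  have ha0 : a ≠ 0 := by rintro rfl; simp at ha
  have hstep := card_ballTors_le (k := k) (r := r) hna hr hθ hρ0 hρ1 hρ ha0
  have hz : Nat.card (ballTors k r θ ρ hna hρ0 a 0) = q ^ (r * a.natDegree) := by
    rw [← card_tors (E := E) hr hθ0 ha]
    refine Nat.card_congr (Equiv.setCongr ?_)
    ext x
    refine ⟨fun h => h.1, fun h => mem_ballTors.2 ⟨h, ?_⟩⟩
    simpa using abv_le_of_mem_tors hna hr hθ hρ0 hρ ha0 h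
  have hD : Nat.card (ballTors k r θ ρ hna hρ0 a a.natDegree) = 1 := by
    have : ballTors k r θ ρ hna hρ0 a a.natDegree = ⊥ := by
      rw [eq_bot_iff]
      intro x hx
      obtain ⟨hx1, hx2⟩ := mem_ballTors.1 hx
      by_contra h0
      exact absurd (radius_lt_of_mem_tors hna hr hθ hρ1 hρ ha0 hx1 h0) (not_lt.2 hx2)
    rw [this]; simp
  refine le_antisymm ?_ ?_
  · have := hstep (a.natDegree - 1)
    rwa [Nat.sub_add_cancel hd, hD, mul_one] at this
  · have h1 : ∀ j, q ^ (r * a.natDegree) ≤ q ^ (r * j) * Nat.card (ballTors k r θ ρ hna hρ0 a j) := by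
      intro j
      induction j with
      | zero => simp [hz]
      | succ j ih =>
        refine ih.trans ?_
        rw [mul_add, mul_one, pow_add, mul_assoc]
        exact Nat.mul_le_mul_left _ (hstep j)
    have h2 := h1 (a.natDegree - 1)
    have h3 : r * a.natDegree = r * (a.natDegree - 1) + r := by
      obtain ⟨m, hm⟩ : ∃ m, a.natDegree = m + 1 := ⟨a.natDegree - 1, by omega⟩
      rw [hm, Nat.add_sub_cancel]; ring
    rw [h3, pow_add] at h2
    exact Nat.le_of_mul_le_mul_left h2 (by positivity)

lemma mul_abv_eq_of_mem_ballTors (hna : IsNonarchimedean v) (hr : 2 ≤ r) (hθ : 1 < v θ)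
    (hρ0 : 0 < ρ) (hρ1 : ρ < 1) (hρ : v θ ^ (q - 2) * ρ ^ (q ^ r - 1) = 1) {a : k[X]}
    (ha : a ≠ 0) (hd : 0 < a.natDegree) {x : E}
    (hx : x ∈ ballTors k r θ ρ hna hρ0 a (a.natDegree - 1)) (hx0 : x ≠ 0) :
    v θ ^ (a.natDegree - 1) * v x = ρ := by
  obtain ⟨hx1, hx2⟩ := mem_ballTors.1 hx
  refine mul_abv_eq_radius hna hr hθ hρ0 hρ1 hρ ha hx1 hx2 ?_
  rw [Nat.sub_add_cancel hd]
  exact radius_lt_of_mem_tors hna hr hθ hρ1 hρ ha hx1 hx0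

lemma sum_aeval_drin_ne_zero (hna : IsNonarchimedean v) (hr : 2 ≤ r) (hθ : 1 < v θ)
    (hρ0 : 0 < ρ) (hρ1 : ρ < 1) (hρ : v θ ^ (q - 2) * ρ ^ (q ^ r - 1) = 1) {a : k[X]}
    (ha : a ≠ 0) (hd : 0 < a.natDegree) {ι : Type*} [Fintype ι] {x : ι → E}
    (hx : ∀ i, x i ∈ ballTors k r θ ρ hna hρ0 a (a.natDegree - 1)) (hli : LinearIndependent k x)
    {c : ι → k[X]} (hc : ∀ i, (c i).natDegree < a.natDegree) (hc0 : c ≠ 0) :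
    ∑ i, aeval (drin k r θ) (c i) (x i) ≠ 0 := by
  classical
  obtain ⟨i0, hi0⟩ := Function.ne_iff.1 hc0
  obtain ⟨m, hm, hmax⟩ := Finset.exists_max_image (Finset.univ.filter fun i => c i ≠ 0)
    (fun i => (c i).natDegree) ⟨i0, by simpa using hi0⟩
  simp only [Finset.mem_filter, Finset.mem_univ, true_and] at hm hmax
  set N := (c m).natDegree with hN
  have hle : ∀ i, (c i).natDegree ≤ N := fun i => by
    by_cases h : c i = 0
    · simp [h]
    · exact hmax i h
  have hv := fun {z} => mul_abv_eq_of_mem_ballTors (x := z) hna hr hθ hρ0 hρ1 hρ ha hd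
  set y := ∑ i, (c i).coeff N • x i with hy
  have hyW : y ∈ ballTors k r θ ρ hna hρ0 a (a.natDegree - 1) :=
    sum_mem fun i _ => Submodule.smul_mem _ _ (hx i)
  have hy0 : y ≠ 0 := by
    intro h0
    have := Fintype.linearIndependent_iff.1 hli _ h0 m
    rw [hN, coeff_natDegree, leadingCoeff_eq_zero] at this
    exact hm this
  have hmono : ∀ z, v z = v y → ∀ n ≤ N, v θ ^ n * v z ≤ ρ := fun z hz n hn => by
    rw [hz, ← hv hyW hy0]
    exact mul_le_mul_of_nonneg_right (pow_le_pow_right₀ hθ.le (hn.trans (by have := hc m; omega)))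
      (v.nonneg _)
  have hxy : ∀ i, v (x i) = v y := fun i => by
    have h1 := (hv (hx i) (hli.ne_zero i)).trans (hv hyW hy0).symm
    exact mul_left_cancel₀ (by positivity) h1
  have h1 : v (aeval (drin k r θ) ((X : k[X]) ^ N) y) = v θ ^ N * v y := by
    have := abv_aeval_drin_infty hna hr hθ hρ1 hρ hy0 (b := (X : k[X]) ^ N)
      (pow_ne_zero _ X_ne_zero) (by rw [natDegree_X_pow]; exact hmono y rfl _ le_rfl)
    rwa [natDegree_X_pow] at this
  have hpos : 0 < v θ ^ N * v y := by have := v.pos hy0; positivity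
  have h2 : ∑ i, aeval (drin k r θ) (c i) (x i) = aeval (drin k r θ) ((X : k[X]) ^ N) y +
      ∑ i, aeval (drin k r θ) (c i - C ((c i).coeff N) * X ^ N) (x i) := by
    rw [hy, map_sum, ← Finset.sum_add_distrib]
    refine Finset.sum_congr rfl fun i _ => ?_
    rw [map_sub, map_mul, LinearMap.sub_apply, Module.End.mul_apply, aeval_C,
      Module.algebraMap_end_apply, map_smul]
    abel
  have h3 : v (∑ i, aeval (drin k r θ) (c i - C ((c i).coeff N) * X ^ N) (x i)) <
      v θ ^ N * v y := by
    refine abv_sum_lt hna _ hpos fun i _ => ?_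
    by_cases h0 : c i - C ((c i).coeff N) * X ^ N = 0
    · rw [h0]; simpa using hpos
    have hdeg : (c i - C ((c i).coeff N) * X ^ N).natDegree < N := by
      rw [natDegree_lt_iff_degree_lt h0, degree_lt_iff_coeff_zero]
      intro n hn
      rw [coeff_sub, coeff_C_mul, coeff_X_pow]
      rcases hn.eq_or_lt with rfl | h
      · simp
      · rw [if_neg h.ne', coeff_eq_zero_of_natDegree_lt ((hle i).trans_lt h)]; simp
    rw [abv_aeval_drin_infty hna hr hθ hρ1 hρ (hli.ne_zero i) h0 (hmono _ (hxy i) _ hdeg.le), hxy]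
    exact mul_lt_mul_of_pos_right (pow_lt_pow_right₀ hθ hdeg) (v.pos hy0)
  rw [h2, ← v.ne_zero_iff, abv_add_eq_left hna (by rwa [h1]), h1]
  exact hpos.ne'

lemma dvd_of_sum_aeval_drin_eq_zero (hna : IsNonarchimedean v) (hr : 2 ≤ r) (hθ : 1 < v θ)
    (hρ0 : 0 < ρ) (hρ1 : ρ < 1) (hρ : v θ ^ (q - 2) * ρ ^ (q ^ r - 1) = 1) {a : k[X]}
    (ha : a ≠ 0) (hd : 0 < a.natDegree) {ι : Type*} [Fintype ι] {x : ι → E}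
    (hx : ∀ i, x i ∈ ballTors k r θ ρ hna hρ0 a (a.natDegree - 1)) (hli : LinearIndependent k x)
    {c : ι → k[X]} (hc : ∑ i, aeval (drin k r θ) (c i) (x i) = 0) (i : ι) : a ∣ c i := by
  by_contra hi
  refine sum_aeval_drin_ne_zero hna hr hθ hρ0 hρ1 hρ ha hd hx hli (c := fun i => c i % a)
    (fun i => natDegree_mod_lt _ hd.ne') (fun h => hi (EuclideanDomain.mod_eq_zero.1
      (congrFun h i))) ?_
  rw [← hc]
  exact Finset.sum_congr rfl fun i _ => aeval_mod_apply (hx i).1 _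

lemma exists_eq_sum_aeval_drin (hna : IsNonarchimedean v) (hr : 2 ≤ r) (hθ : 1 < v θ)
    (hρ0 : 0 < ρ) (hρ1 : ρ < 1) (hρ : v θ ^ (q - 2) * ρ ^ (q ^ r - 1) = 1) {a : k[X]}
    (ha : aeval θ a ≠ 0) (hd : 0 < a.natDegree) {x : Fin r → E}
    (hx : ∀ i, x i ∈ ballTors k r θ ρ hna hρ0 a (a.natDegree - 1)) (hli : LinearIndependent k x)
    {y : E} (hy : y ∈ tors k r θ a) : ∃ c : Fin r → k[X], y = ∑ i, aeval (drin k r θ) (c i) (x i) := by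
  have hθ0 : θ ≠ 0 := by rintro rfl; simp at hθ; linarith
  have ha0 : a ≠ 0 := by rintro rfl; simp at ha
  have hfin := finite_tors (k := k) (r := r) (by omega) hθ0 ha0
  let f : (Fin r → degreeLT k a.natDegree) → tors k r θ a := fun c =>
    ⟨∑ i, aeval (drin k r θ) (c i : k[X]) (x i), sum_mem fun i _ => aeval_drin_mem_tors _ (hx i).1⟩
  have hinj : Function.Injective f := by
    intro c c' h
    by_contra hne
    refine sum_aeval_drin_ne_zero hna hr hθ hρ0 hρ1 hρ ha0 hd hx hli
      (c := fun i => (c i : k[X]) - c' i) (fun i => ?_) (fun h => hne ?_) ?_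
    · have := (c i - c' i).2
      rw [mem_degreeLT] at this
      by_cases h0 : (c i : k[X]) - c' i = 0
      · rwa [h0, natDegree_zero]
      · exact (natDegree_lt_iff_degree_lt h0).2 this
    · funext i
      exact Subtype.ext (sub_eq_zero.1 (congrFun h i))
    · simp only [map_sub, LinearMap.sub_apply, Finset.sum_sub_distrib]
      exact sub_eq_zero.2 (congrArg Subtype.val h)
  have hcard : Nat.card (tors k r θ a) ≤ Nat.card (Fin r → degreeLT k a.natDegree) := by
    rw [card_tors hr hθ0 ha, Nat.card_fun, Nat.card_congr (degreeLTEquiv k a.natDegree).toEquiv]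
    simp [← pow_mul, mul_comm]
  obtain ⟨c, hc⟩ := (hinj.bijective_of_nat_card_le hcard).2 ⟨y, hy⟩
  exact ⟨fun i => c i, (congrArg Subtype.val hc).symm⟩

end Ball

section EndAlgebra

variable {k K : Type*} [Field k] [Field K] [Algebra k K] [FiniteDimensional k K] [IsGalois k K]

/-- A subalgebra of `End_k K`, `K/k` cyclic of prime degree, which contains a nonscalar
multiplication and a nontrivial semilinear map contains every operator of rank one. -/
lemma smulRight_mem_of_prime (hr : (Module.finrank k K).Prime) (S : Subalgebra k (Module.End k K))
    {μ : K} (hμ : μ ∉ Set.range (algebraMap k K)) (hμS : LinearMap.mulLeft k μ ∈ S)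
    {τ : K ≃ₐ[k] K} (hτ : τ ≠ 1) {χ : K} (hχ : χ ≠ 0)
    (hτS : LinearMap.mulLeft k χ * τ.toLinearMap ∈ S) (l : K →ₗ[k] k) (α : K) :
    l.smulRight α ∈ S := by
  have hmul : ∀ α, LinearMap.mulLeft k α ∈ S := by
    have := Subalgebra.isSimpleOrder_of_finrank_prime k K hr
    rcases eq_bot_or_eq_top (S.comap (Algebra.lmul k K)) with h | h
    · exact absurd (Algebra.mem_bot.1 (h ▸ show μ ∈ S.comap (Algebra.lmul k K) from hμS)) hμ
    · intro α
      exact (h ▸ Algebra.mem_top : α ∈ S.comap (Algebra.lmul k K))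
  have hτS' : τ.toLinearMap ∈ S := by
    have := S.mul_mem (hmul χ⁻¹) hτS
    convert this using 1
    ext x
    simp [hχ]
  have hgal : ∀ σ : K ≃ₐ[k] K, σ.toLinearMap ∈ S := by
    intro σ
    have : Fact (Module.finrank k K).Prime := ⟨hr⟩
    obtain ⟨n, rfl⟩ := mem_powers_of_prime_card (IsGalois.card_aut_eq_finrank k K) hτ (g' := σ)
    have h : ((τ ^ n : K ≃ₐ[k] K).toLinearMap : Module.End k K) = τ.toLinearMap ^ n := by
      induction n with
      | zero => rfl
      | succ n ih => rw [pow_succ, pow_succ, ← ih]; rfl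
    change (τ ^ n : K ≃ₐ[k] K).toLinearMap ∈ S
    rw [h]
    exact S.pow_mem hτS' n
  obtain ⟨β, rfl⟩ := (LinearMap.BilinForm.toDual _ (traceForm_nondegenerate k K)).surjective l
  have h : ((LinearMap.BilinForm.toDual _ (traceForm_nondegenerate k K)) β).smulRight α =
      LinearMap.mulLeft k α * (∑ σ : K ≃ₐ[k] K, σ.toLinearMap) * LinearMap.mulLeft k β := by
    ext x
    simp [LinearMap.BilinForm.toDual_def, Algebra.traceForm_apply, Algebra.smul_def,
      trace_eq_sum_automorphisms, mul_comm, LinearMap.sum_apply]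
    rw [Finset.mul_sum]
  rw [h]
  exact S.mul_mem (S.mul_mem (hmul α) (S.sum_mem fun σ _ => hgal σ)) (hmul β)

end EndAlgebra

lemma mul_lt_card_pow_sub_one {Q r : ℕ} (hQ : 3 ≤ Q) (hr : 3 ≤ r) :
    (Q - 2) * (r * (Q - 1)) < Q ^ r - 1 := by
  obtain ⟨m, rfl⟩ : ∃ m, Q = m + 3 := ⟨Q - 3, by omega⟩
  have h : (m + 1) * (r * (m + 2)) + 1 < (m + 3) ^ r := by
    induction r, hr using Nat.le_induction with
    | base => nlinarith [sq_nonneg m]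
    | succ r hr ih =>
      have h2 : (m + 3) ^ (r + 1) = (m + 3) ^ r * m + 3 * (m + 3) ^ r := by rw [pow_succ]; ring
      have h3 : (m + 1) * (m + 2) ≤ (m + 1) * (r * (m + 2)) :=
        Nat.mul_le_mul_left _ (Nat.le_mul_of_pos_left _ (by omega))
      have h4 : (m + 1) * ((r + 1) * (m + 2)) = (m + 1) * (r * (m + 2)) + (m + 1) * (m + 2) := by
        ring
      rw [h2, h4]
      have := Nat.zero_le ((m + 3) ^ r * m)
      omega
  have : m + 3 - 2 = m + 1 := by omega
  have h4 : m + 3 - 1 = m + 2 := by omega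
  rw [this, h4]; omega

section InftyGalois

variable {k F E : Type*} [Field k] [Fintype k] [Field F] [Field E] [Algebra k F] [Algebra F E]
  [Algebra k E] [IsScalarTower k F E]

variable (k) in
/-- The `k`-linear endomorphism of `E` given by an `F`-automorphism. -/
def galEnd : (E ≃ₐ[F] E) →* Module.End k E where
  toFun σ := (σ.restrictScalars k).toLinearMap
  map_one' := rfl
  map_mul' _ _ := rfl

lemma exists_mem_span_galEnd {W : Submodule k E} {K : Type*} [Field K] [Algebra k K]
    [FiniteDimensional k K] [IsGalois k K] (hr : (Module.finrank k K).Prime) (ι : W ≃ₗ[k] K)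
    {σ : E ≃ₐ[F] E} (hσW : ∀ w ∈ W, σ w ∈ W) {μ : K} (hμ : μ ∉ Set.range (algebraMap k K))
    (hσ : ∀ w : W, ι ⟨σ w, hσW w w.2⟩ = μ * ι w) {τ : E ≃ₐ[F] E} (hτW : ∀ w ∈ W, τ w ∈ W)
    {τ' : K ≃ₐ[k] K} (hτ' : τ' ≠ 1) {χ : K} (hχ : χ ≠ 0)
    (hτ : ∀ w : W, ι ⟨τ w, hτW w w.2⟩ = χ * τ' (ι w)) (x : W) (l : W →ₗ[k] k) :
    ∃ f ∈ Submodule.span k (Set.range (galEnd (F := F) (E := E) k)), ∀ w : W, f w = l w • (x : E) := by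
  have hspan : Submodule.span k (Set.range (galEnd (F := F) (E := E) k)) =
      Subalgebra.toSubmodule (Algebra.adjoin k (Set.range (galEnd (F := F) (E := E) k))) := by
    rw [Algebra.adjoin_eq_span, ← MonoidHom.coe_mrange, Submonoid.closure_eq]
  set A := Algebra.adjoin k (Set.range (galEnd (F := F) (E := E) k)) with hA
  have hgA : ∀ σ, galEnd (F := F) (E := E) k σ ∈ A := fun σ => Algebra.subset_adjoin ⟨σ, rfl⟩
  let S : Subalgebra k (Module.End k K) :=
    { carrier := {h | ∃ f ∈ A, ∀ w : W, f w = ι.symm (h (ι w))}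
      mul_mem' := by
        rintro h h' ⟨f, hf, hfw⟩ ⟨f', hf', hfw'⟩
        exact ⟨f * f', A.mul_mem hf hf', fun w => by simp [hfw', hfw]⟩
      add_mem' := by
        rintro h h' ⟨f, hf, hfw⟩ ⟨f', hf', hfw'⟩
        exact ⟨f + f', A.add_mem hf hf', fun w => by simp [hfw', hfw]⟩
      algebraMap_mem' := fun c => ⟨algebraMap k _ c, A.algebraMap_mem c, fun w => by
        simp [Module.algebraMap_end_apply]⟩ }
  have h1 := smulRight_mem_of_prime hr S hμ ⟨_, hgA σ, fun w => by
      rw [LinearMap.mulLeft_apply, ← hσ, ι.symm_apply_apply]; rfl⟩ hτ' hχ ⟨_, hgA τ, fun w => by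
      rw [Module.End.mul_apply, LinearMap.mulLeft_apply, AlgEquiv.toLinearMap_apply, ← hτ,
        ι.symm_apply_apply]; rfl⟩ (l ∘ₗ ι.symm.toLinearMap) (ι x)
  obtain ⟨f, hf, hfw⟩ := h1
  refine ⟨f, hspan ▸ hf, fun w => ?_⟩
  rw [hfw]
  simp

variable {t : F} {θ : E} {r : ℕ} {v : AbsoluteValue E ℝ} {Γ : Subgroup (E ≃ₐ[F] E)} {ρ : ℝ}

local notation "q" => Fintype.card k

lemma galois_mem_ballTors (hθt : algebraMap F E t = θ) (hp : IsPlace v Γ t) {hna : IsNonarchimedean v}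
    {hρ0 : 0 < ρ} {a : k[X]} {j : ℕ} {σ : E ≃ₐ[F] E} (hσ : σ ∈ Γ) {x : E}
    (hx : x ∈ ballTors k r θ ρ hna hρ0 a j) : σ x ∈ ballTors k r θ ρ hna hρ0 a j := by
  rw [mem_ballTors] at *
  exact ⟨galois_mem_tors hθt σ hx.1, by rw [hp.map_eq σ hσ]; exact hx.2⟩

theorem exists_infty_place_structure [IsAlgClosed E] (hθt : algebraMap F E t = θ)
    (hp : IsPlace v Γ t) (hr : r.Prime) (hr3 : 3 ≤ r) (hq : 2 < q) (hθ : 1 < v θ)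
    (hres : ∀ x, IsSeparable F x → (∀ σ ∈ Γ, σ x = x) → v x ≤ 1 →
      ∃ c : k, v (x - algebraMap k E c) < 1) {a : k[X]} (ha : aeval θ a ≠ 0)
    (hd : 0 < a.natDegree) :
    ∃ x : Fin r → E, (∀ i, x i ∈ tors k r θ a) ∧
      (∀ c : Fin r → k[X], ∑ i, aeval (drin k r θ) (c i) (x i) = 0 → ∀ i, a ∣ c i) ∧
      (∀ y ∈ tors k r θ a, ∃ c : Fin r → k[X], y = ∑ i, aeval (drin k r θ) (c i) (x i)) ∧
      ∀ i j, ∃ f ∈ Submodule.span k (Set.range (galEnd (F := F) (E := E) k)),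
        ∀ m, f (x m) = if m = j then x i else 0 := by
  have hna := hp.nonarch
  have hr2 : 2 ≤ r := by omega
  have hθ0 : θ ≠ 0 := by rintro rfl; simp at hθ; linarith
  have ha0 : a ≠ 0 := by rintro rfl; simp at ha
  obtain ⟨ρ, hρ0, hρ1, hρ⟩ := exists_radius k (v := v) hq (by omega : 1 ≤ r) hθ
  set W := ballTors k r θ ρ hna hρ0 a (a.natDegree - 1) with hW
  have hWcard : Nat.card W = q ^ r := card_ballTors_pred hna hr2 hθ hρ0 hρ1 hρ ha hd
  have hWfin : Finite W := Nat.finite_of_card_ne_zero (by rw [hWcard]; positivity)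
  have hWrank : Module.finrank k W = r := by
    have h := Module.natCard_eq_pow_finrank (K := k) (V := W)
    rw [hWcard, Nat.card_eq_fintype_card] at h
    exact (Nat.pow_right_injective hq.le h).symm
  let b := Module.finBasisOfFinrankEq k W hWrank
  have hbW : ∀ i, (b i : E) ∈ W := fun i => (b i).2
  have hbli : LinearIndependent k fun i => (b i : E) :=
    b.linearIndependent.map' W.subtype (Submodule.ker_subtype _)
  refine ⟨fun i => b i, fun i => (hbW i).1, fun c hc =>
    dvd_of_sum_aeval_drin_eq_zero hna hr2 hθ hρ0 hρ1 hρ ha0 hd hbW hbli hc, fun y hy =>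
    exists_eq_sum_aeval_drin hna hr2 hθ hρ0 hρ1 hρ ha hd hbW hbli hy, ?_⟩
  suffices h : ∀ (x : W) (l : W →ₗ[k] k), ∃ f ∈ Submodule.span k (Set.range
      (galEnd (F := F) (E := E) k)), ∀ w : W, f w = l w • (x : E) by
    intro i j
    obtain ⟨f, hf, hfw⟩ := h (b i) (b.coord j)
    refine ⟨f, hf, fun m => ?_⟩
    rw [hfw, Module.Basis.coord_apply, Module.Basis.repr_self, Finsupp.single_apply]
    split_ifs <;> simp
  have hrad : ∀ {x}, x ∈ W → x ≠ 0 → v θ ^ (a.natDegree - 1) * v x = ρ := fun hx hx0 =>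
    mul_abv_eq_of_mem_ballTors hna hr2 hθ hρ0 hρ1 hρ ha0 hd hx hx0
  have hσW : ∀ σ ∈ Γ, ∀ w ∈ W, σ w ∈ W := fun σ hσ w hw => galois_mem_ballTors hθt hp hσ hw
  -- the leading coefficient map
  obtain ⟨y, hyW, hy0⟩ : ∃ y ∈ W, y ≠ 0 := ⟨b ⟨0, by omega⟩, hbW _, hbli.ne_zero _⟩
  have hyv := hrad hyW hy0
  set K := frobFixed k E r with hK
  have hKv : ∀ ζ ∈ K, ζ ≠ 0 → v ζ = 1 := fun ζ hζ h0 => abv_frobFixed (by omega) hζ h0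
  have hKcard : Nat.card K = q ^ r := card_frobFixed (by omega)
  have hKfin : Finite K := Nat.finite_of_card_ne_zero (by rw [hKcard]; positivity)
  have hKrank : Module.finrank k K = r := by
    have h := Module.natCard_eq_pow_finrank (K := k) (V := K)
    rw [hKcard, Nat.card_eq_fintype_card] at h
    exact (Nat.pow_right_injective hq.le h).symm
  obtain ⟨ι0, hι0⟩ := exists_leading_map (W := W) (y := y) hna hKv fun x hx =>
    exists_abv_sub_mul_lt_of_mem_ballTors hna hr2 hθ hρ0 hρ1 hρ ha0 hyW.1 hyv hx
  have hinj : Function.Injective ι0 := by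
    rw [injective_iff_map_eq_zero]
    intro x hx
    by_contra h0
    have h1 := hι0 x
    rw [hx, ZeroMemClass.coe_zero, zero_mul, sub_zero] at h1
    have h2 := hrad x.2 (by simpa using h0)
    rw [← hyv] at h2
    exact h1.ne (mul_left_cancel₀ (by positivity) h2)
  let ι : W ≃ₗ[k] K := LinearEquiv.ofBijective ι0
    (hinj.bijective_of_nat_card_le (by rw [hWcard, hKcard]))
  have hι : ∀ x : W, v ((x : E) - ι x * y) < v y := hι0
  let res : (E ≃ₐ[F] E) → (K ≃ₐ[k] K) := fun σ => (σ.restrictScalars k).restrictNormal K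
  have hres' : ∀ σ (ζ : K), (res σ ζ : E) = σ ζ := fun σ ζ =>
    AlgEquiv.restrictNormal_commutes (σ.restrictScalars k) K ζ
  have hres_mul : ∀ σ τ, res (σ * τ) = res σ * res τ := fun σ τ => by
    ext ζ; simp [hres']
  let χ : Γ → K := fun σ => ι ⟨σ.1 y, hσW σ σ.2 y hyW⟩
  have hχ : ∀ (σ : Γ) (w : W), ι ⟨σ.1 w, hσW σ σ.2 w w.2⟩ = χ σ * res σ.1 (ι w) := by
    intro σ w
    refine leading_unique hna hKv (hι _) ?_
    have h1 : v (σ.1 (w - ι w * y)) < v y := by rw [hp.map_eq _ σ.2]; exact hι w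
    have h2 := abv_mul_finite_lt hKv (res σ.1 (ι w)) (hι ⟨σ.1 y, hσW σ σ.2 y hyW⟩)
    have h3 : ((⟨σ.1 w, hσW σ σ.2 w w.2⟩ : W) : E) - ((χ σ * res σ.1 (ι w) : K) : E) * y =
        σ.1 (w - ι w * y) + res σ.1 (ι w) * (σ.1 y - χ σ * y) := by
      rw [map_sub, map_mul, ← hres']; push_cast; ring
    rw [h3]
    exact abv_add_lt hna h1 h2
  have hχ0 : ∀ σ, χ σ ≠ 0 := fun σ h => by
    have h1 := (map_eq_zero_iff ι ι.injective).1 h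
    exact hy0 (by simpa using congrArg Subtype.val h1)
  obtain ⟨τ, hτ⟩ : ∃ τ : Γ, res τ.1 ≠ 1 := by
    by_contra! h
    have htop : ∀ ζ : K, ζ ∈ (⊥ : Subalgebra k K) := by
      intro ζ
      have hsep : IsSeparable F (ζ : E) := by
        have h1 : IsSeparable k ζ := Algebra.IsSeparable.isSeparable k ζ
        exact (h1.map K.val K.val.injective).tower_top F
      obtain ⟨c, hc⟩ := hres ζ hsep (fun σ hσ => by rw [← hres', h ⟨σ, hσ⟩]; rfl) (by
        by_cases h0 : (ζ : E) = 0
        · simp [h0]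
        · exact (hKv _ ζ.2 h0).le)
      refine Algebra.mem_bot.2 ⟨c, ?_⟩
      by_contra hne
      have h2 := hKv _ (ζ - algebraMap k K c).2 (fun h0 => hne
        (sub_eq_zero.1 (Subtype.ext h0)).symm)
      exact hc.ne (by simpa using h2)
    have h1 : (⊥ : Subalgebra k K) = ⊤ := by
      rw [eq_top_iff]; exact fun ζ _ => htop ζ
    have h2 := Subalgebra.bot_eq_top_iff_finrank_eq_one.1 h1
    omega
  obtain ⟨σ, hσ1, hσμ⟩ : ∃ σ : Γ, res σ.1 = 1 ∧ χ σ ∉ Set.range (algebraMap k K) := by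
    by_contra! h
    have hιy : ι ⟨y, hyW⟩ = 1 := leading_unique hna hKv (hι _) (by simpa using v.pos hy0)
    have hone : ∀ s : Γ, res s.1 = 1 → ∃ c : kˣ, s.1 y = (c : k) • y := by
      intro s hs
      obtain ⟨c, hc⟩ := h s hs
      have hc0 : c ≠ 0 := by
        rintro rfl
        exact hχ0 s (by rw [← hc, map_zero])
      refine ⟨Units.mk0 c hc0, ?_⟩
      have h1 : ι ⟨s.1 y, hσW s s.2 y hyW⟩ = ι (c • ⟨y, hyW⟩) := by
        rw [map_smul, hιy, ← Algebra.algebraMap_eq_smul_one, hc]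
      exact congrArg Subtype.val (ι.injective h1)
    have hz : ∀ g : K ≃ₐ[k] K, ∃ z : E, ∀ σ ∈ Γ, res σ = g → ∃ c : kˣ, σ y = (c : k) • z := by
      intro g
      by_cases hg : ∃ σ ∈ Γ, res σ = g
      · obtain ⟨σ₀, hσ₀, rfl⟩ := hg
        refine ⟨σ₀ y, fun σ hσ hσg => ?_⟩
        have h1 : res (σ₀⁻¹ * σ) = 1 := by
          have h2 := hres_mul σ₀ (σ₀⁻¹ * σ)
          rw [mul_inv_cancel_left, hσg] at h2
          exact (mul_eq_left.1 h2.symm)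
        obtain ⟨c, hc⟩ := hone ⟨_, Γ.mul_mem (Γ.inv_mem hσ₀) hσ⟩ h1
        refine ⟨c, ?_⟩
        have h3 := congrArg σ₀ hc
        rw [galois_smul] at h3
        rw [← h3]
        change σ y = (σ₀ * (σ₀⁻¹ * σ)) y
        rw [mul_inv_cancel_left]
      · exact ⟨0, fun σ hσ hσg => absurd ⟨σ, hσ, hσg⟩ hg⟩
    choose z hz using hz
    set O := {x | ∃ σ ∈ Γ, σ y = x} with hO
    have hOsub : O ⊆ Set.range fun p : (K ≃ₐ[k] K) × kˣ => (p.2 : k) • z p.1 := by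
      rintro _ ⟨σ, hσ, rfl⟩
      obtain ⟨c, hc⟩ := hz _ σ hσ rfl
      exact ⟨(res σ, c), hc.symm⟩
    have hOcard : O.ncard ≤ r * (q - 1) := by
      refine (Set.ncard_le_ncard hOsub (Set.finite_range _)).trans ?_
      refine (Finite.card_range_le _).trans ?_
      rw [Nat.card_prod, IsGalois.card_aut_eq_finrank, hKrank, Nat.card_units,
        Nat.card_eq_fintype_card]
    have hOpos : 0 < O.ncard :=
      (Set.ncard_pos ((Set.finite_range _).subset hOsub)).2 ⟨y, 1, one_mem _, rfl⟩
    have hvθ : 0 < v θ := by linarith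
    have hvy := v.pos hy0
    have hy1 : v y < 1 := by
      have : v y ≤ v θ ^ (a.natDegree - 1) * v y :=
        le_mul_of_one_le_left hvy.le (one_le_pow₀ hθ.le)
      linarith
    have hm : v y ^ ((q ^ r - 1 : ℕ) : ℤ) = v (algebraMap F E t) ^
        (-((q - 2 : ℕ) + (a.natDegree - 1 : ℕ) * (q ^ r - 1 : ℕ)) : ℤ) := by
      rw [hθt, zpow_neg, zpow_add₀ hvθ.ne', zpow_mul]
      simp only [zpow_natCast]
      rw [← hyv, mul_pow, ← mul_assoc] at hρ
      exact eq_inv_of_mul_eq_one_right hρ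
    obtain ⟨n, hn⟩ := hp.exists_mul_eq_ncard hy0 hy1.ne (isSeparable_of_mem_tors hθt hr2 ha hyW.1) hm
    have hdvd : ((q ^ r - 1 : ℕ) : ℤ) ∣ ((q - 2 : ℕ) * O.ncard : ℕ) :=
      ⟨-n - (a.natDegree - 1 : ℕ) * O.ncard, by push_cast at hn ⊢; linear_combination -hn⟩
    have h1 := Nat.le_of_dvd (Nat.mul_pos (by omega) hOpos) (Int.natCast_dvd_natCast.1 hdvd)
    have h2 := mul_lt_card_pow_sub_one (Q := q) hq hr3
    have h3 := Nat.mul_le_mul_left (q - 2) hOcard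
    omega
  refine exists_mem_span_galEnd (K := K) (by rwa [hKrank]) ι (hσW σ σ.2) hσμ (fun w => ?_)
    (hσW τ τ.2) hτ (hχ0 τ) (hχ τ)
  rw [hχ, hσ1]; rfl

end InftyGalois

section CoefficientRing

variable {k : Type*} [Field k] (E : Type*) [Field E] [Algebra k E] {a : k[X]}

/-- The base change `E ⊗ k[X]/(a)`. -/
abbrev TorsRing (a : k[X]) := AdjoinRoot (a.map (algebraMap k E))

/-- The structure map `k[X] → E ⊗ k[X]/(a)`. -/
def torsCoef (a : k[X]) : k[X] →+* TorsRing E a :=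
  (AdjoinRoot.mk _).comp (mapRingHom (algebraMap k E))

lemma torsCoef_apply (b : k[X]) : torsCoef E a b = AdjoinRoot.mk _ (b.map (algebraMap k E)) := rfl

lemma torsCoef_eq_zero {b : k[X]} : torsCoef E a b = 0 ↔ a ∣ b := by
  rw [torsCoef_apply, AdjoinRoot.mk_eq_zero, map_dvd_map']

lemma torsCoef_C (c : k) : torsCoef E a (C c) = AdjoinRoot.of _ (algebraMap k E c) := by
  rw [torsCoef_apply, map_C, AdjoinRoot.mk_C]

variable {E}

/-- The top coefficient functional on `E ⊗ k[X]/(a)`. -/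
def topCoeff (ha : a.Monic) : TorsRing E a →ₗ[E] E :=
  lcoeff E (a.natDegree - 1) ∘ₗ AdjoinRoot.modByMonicHom (ha.map (algebraMap k E))

lemma topCoeff_mk (ha : a.Monic) (p : E[X]) : topCoeff ha (AdjoinRoot.mk _ p) =
    (p %ₘ a.map (algebraMap k E)).coeff (a.natDegree - 1) := by
  rw [topCoeff, LinearMap.comp_apply, AdjoinRoot.modByMonicHom_mk, lcoeff_apply]

lemma exists_mk_eq (ha : a.Monic) (e : TorsRing E a) :
    ∃ p : E[X], p.degree < a.natDegree ∧ AdjoinRoot.mk _ p = e := by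
  obtain ⟨p, rfl⟩ := AdjoinRoot.mk_surjective e
  refine ⟨p %ₘ a.map (algebraMap k E), ?_, ?_⟩
  · refine (degree_modByMonic_lt p (ha.map _)).trans_le ?_
    rw [ha.degree_map]
    exact degree_le_natDegree
  · have := AdjoinRoot.mk_leftInverse (ha.map (algebraMap k E)) (AdjoinRoot.mk _ p)
    rwa [AdjoinRoot.modByMonicHom_mk] at this

lemma topCoeff_mk_of_degree_lt (ha : a.Monic) {p : E[X]} (hp : p.degree < a.natDegree) :
    topCoeff ha (AdjoinRoot.mk _ p) = p.coeff (a.natDegree - 1) := by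
  rw [topCoeff_mk, (modByMonic_eq_self_iff (ha.map _)).2]
  rwa [ha.degree_map, degree_eq_natDegree ha.ne_zero]

lemma eq_zero_of_topCoeff (ha : a.Monic) (hd : 0 < a.natDegree) {e : TorsRing E a}
    (h : ∀ j < a.natDegree, topCoeff ha (torsCoef E a (X ^ j) * e) = 0) : e = 0 := by
  obtain ⟨p, hp, rfl⟩ := exists_mk_eq ha e
  by_cases hp0 : p = 0
  · rw [hp0, map_zero]
  exfalso
  have hlt : p.natDegree < a.natDegree := (natDegree_lt_iff_degree_lt hp0).2 hp
  have h1 := h (a.natDegree - 1 - p.natDegree) (by omega)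
  rw [torsCoef_apply, ← map_mul, Polynomial.map_pow, map_X, topCoeff_mk_of_degree_lt ha] at h1
  · have h2 : a.natDegree - 1 = p.natDegree + (a.natDegree - 1 - p.natDegree) := by omega
    rw [h2, mul_comm, Nat.add_sub_cancel_left, coeff_mul_X_pow, coeff_natDegree,
      leadingCoeff_eq_zero] at h1
    exact hp0 h1
  · rw [degree_mul, degree_X_pow, degree_eq_natDegree hp0]
    norm_cast
    omega

lemma finiteDimensional_torsRing (ha : a.Monic) : FiniteDimensional E (TorsRing E a) :=
  (ha.map (algebraMap k E)).finite_adjoinRoot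

lemma finrank_torsRing : Module.finrank E (TorsRing E a) = a.natDegree := by
  rw [← natDegree_map (algebraMap k E)]
  exact finrank_quotient_span_eq_natDegree

lemma exists_topCoeff_eq (ha : a.Monic) (hd : 0 < a.natDegree) (g : Fin a.natDegree → E) :
    ∃ e : TorsRing E a, ∀ j : Fin a.natDegree,
      topCoeff ha (torsCoef E a (X ^ (j : ℕ)) * e) = g j := by
  have := finiteDimensional_torsRing (E := E) ha
  let L : TorsRing E a →ₗ[E] (Fin a.natDegree → E) := LinearMap.pi fun j =>
    topCoeff ha ∘ₗ LinearMap.mulLeft E (torsCoef E a (X ^ (j : ℕ)))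
  have hinj : Function.Injective L := by
    rw [injective_iff_map_eq_zero]
    intro e he
    exact eq_zero_of_topCoeff ha hd fun j hj => congrFun he ⟨j, hj⟩
  have hsurj := (LinearMap.injective_iff_surjective_of_finrank_eq_finrank
    (by rw [finrank_torsRing]; simp)).1 hinj
  obtain ⟨e, he⟩ := hsurj g
  exact ⟨e, fun j => congrFun he j⟩

/-- A family of values `topCoeff (X ^ j e)` satisfying the recursion of an operator killed by `a`
computes all the `topCoeff (b e)`. -/
lemma topCoeff_torsCoef_mul (ha : a.Monic) {T : Module.End k E} {x : E}
    (hx : aeval T a x = 0) {e : TorsRing E a}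
    (he : ∀ j < a.natDegree, topCoeff ha (torsCoef E a (X ^ j) * e) = aeval T (X ^ j : k[X]) x)
    (b : k[X]) : topCoeff ha (torsCoef E a b * e) = aeval T b x := by
  have key : ∀ b : k[X], b.natDegree < a.natDegree →
      topCoeff ha (torsCoef E a b * e) = aeval T b x := by
    intro b hb
    rw [b.as_sum_range_C_mul_X_pow' hb, map_sum, Finset.sum_mul, map_sum, map_sum,
      LinearMap.sum_apply]
    refine Finset.sum_congr rfl fun j hj => ?_
    rw [RingHom.map_mul, torsCoef_C, mul_assoc, map_mul (aeval T), Module.End.mul_apply, ← he j (Finset.mem_range.1 hj),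
      aeval_C, Module.algebraMap_end_apply, ← AdjoinRoot.algebraMap_eq, ← Algebra.smul_def, map_smul,
      smul_eq_mul, Algebra.smul_def]
  rcases Nat.eq_zero_or_pos a.natDegree with hd | hd
  · have h1 : a = 1 := ha.natDegree_eq_zero.1 hd
    have hx0 : x = 0 := by rw [h1] at hx; simpa using hx
    have : torsCoef E a b = 0 := (torsCoef_eq_zero E).2 (h1 ▸ one_dvd _)
    rw [this, hx0]; simp
  · have h1 := EuclideanDomain.mod_add_div b a
    have h2 : torsCoef E a a = 0 := (torsCoef_eq_zero E).2 dvd_rfl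
    rw [← h1, RingHom.map_add, RingHom.map_mul, h2, zero_mul, add_zero, key _ (natDegree_mod_lt _ hd.ne'),
      mul_comm a, map_add, map_mul, LinearMap.add_apply, Module.End.mul_apply, hx, map_zero, add_zero]

/-- Coefficientwise action of a `k`-endomorphism of `E`. -/
def torsMap (a : k[X]) (h : E →ₐ[k] E) : TorsRing E a →+* TorsRing E a :=
  AdjoinRoot.map h _ _ (by rw [map_map, h.comp_algebraMap])

lemma torsMap_mk (h : E →ₐ[k] E) (p : E[X]) :
    torsMap a h (AdjoinRoot.mk _ p) = AdjoinRoot.mk _ (p.map (h : E →+* E)) := by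
  rw [torsMap, AdjoinRoot.map, AdjoinRoot.lift_mk]
  induction p using Polynomial.induction_on' with
  | add p q hp hq => rw [eval₂_add, hp, hq, Polynomial.map_add, map_add]
  | monomial n c =>
    rw [eval₂_monomial, map_monomial, ← C_mul_X_pow_eq_monomial, map_mul, map_pow, AdjoinRoot.mk_X]
    rfl

lemma torsMap_torsCoef (h : E →ₐ[k] E) (b : k[X]) :
    torsMap a h (torsCoef E a b) = torsCoef E a b := by
  rw [torsCoef_apply, torsMap_mk, map_map, h.comp_algebraMap]

lemma torsMap_of (h : E →ₐ[k] E) (x : E) :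
    torsMap a h (AdjoinRoot.of _ x) = AdjoinRoot.of _ (h x) := by
  rw [← AdjoinRoot.mk_C, torsMap_mk, map_C, AdjoinRoot.mk_C]; rfl

lemma torsMap_comp (h h' : E →ₐ[k] E) (e : TorsRing E a) :
    torsMap a h (torsMap a h' e) = torsMap a (h.comp h') e := by
  obtain ⟨p, rfl⟩ := AdjoinRoot.mk_surjective e
  rw [torsMap_mk, torsMap_mk, torsMap_mk, map_map]; rfl

lemma topCoeff_torsMap (ha : a.Monic) (h : E →ₐ[k] E) (e : TorsRing E a) :
    topCoeff ha (torsMap a h e) = h (topCoeff ha e) := by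
  obtain ⟨p, rfl⟩ := AdjoinRoot.mk_surjective e
  rw [torsMap_mk, topCoeff_mk, topCoeff_mk]
  have h1 : a.map (algebraMap k E) = (a.map (algebraMap k E)).map (h : E →+* E) := by
    rw [map_map, h.comp_algebraMap]
  conv_lhs => rw [h1]
  rw [← map_modByMonic _ (ha.map _), coeff_map]; rfl

end CoefficientRing

section Moore

variable {B : Type*} [CommRing B]

/-- The Moore matrix of a family with respect to an endomorphism. -/
def mooreMatrix (σ : B →+* B) {n : ℕ} (e : Fin n → B) : Matrix (Fin n) (Fin n) B :=
  Matrix.of fun i j => σ^[(i : ℕ)] (e j)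

lemma mooreMatrix_apply (σ : B →+* B) {n : ℕ} (e : Fin n → B) (i j : Fin n) :
    mooreMatrix σ e i j = σ^[(i : ℕ)] (e j) := rfl

lemma map_det_mooreMatrix {σ : B →+* B} {m : ℕ} (hm : Even m) (hm0 : 0 < m)
    {e : Fin (m + 1) → B} {c d : B} (h : ∀ j, c * σ^[m + 1] (e j) = d * e j - σ^[m] (e j)) :
    c * σ (mooreMatrix σ e).det = d * (mooreMatrix σ e).det := by
  set Ψ := mooreMatrix σ e with hΨ
  set M := σ.mapMatrix Ψ with hM
  have hMij (i j) : M i j = σ^[(i : ℕ) + 1] (e j) := by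
    rw [Function.iterate_succ_apply']; rfl
  have h1 : c * σ Ψ.det = (M.updateRow (Fin.last m) (c • M (Fin.last m))).det := by
    rw [Matrix.det_updateRow_smul, Matrix.updateRow_eq_self, RingHom.map_det]
  have h2 : c • M (Fin.last m) = d • e + (-1 : B) • M ⟨m - 1, by omega⟩ := by
    ext j
    have h3 : m - 1 + 1 = m := by omega
    simp only [Pi.smul_apply, Pi.add_apply, smul_eq_mul, hMij, Fin.val_last, h3]
    rw [h j]; ring
  have h3 : (M.updateRow (Fin.last m) (M ⟨m - 1, by omega⟩)).det = 0 := by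
    refine Matrix.det_zero_of_row_eq (i := Fin.last m) (j := ⟨m - 1, by omega⟩) ?_ ?_
    · intro h; rw [Fin.ext_iff] at h; simp at h; omega
    · rw [Matrix.updateRow_self, Matrix.updateRow_ne]
      intro h; rw [Fin.ext_iff] at h; simp at h; omega
  have h4 : M.updateRow (Fin.last m) e = Ψ.submatrix (finRotate (m + 1)) id := by
    ext i j
    rw [Matrix.submatrix_apply, id]
    by_cases hi : i = Fin.last m
    · rw [hi, Matrix.updateRow_self, finRotate_last, hΨ, mooreMatrix_apply]; rfl
    · rw [Matrix.updateRow_ne hi, hMij, hΨ, mooreMatrix_apply, coe_finRotate_of_ne_last hi]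
  rw [h1, h2, Matrix.det_updateRow_add, Matrix.det_updateRow_smul, Matrix.det_updateRow_smul, h3, h4,
    Matrix.det_permute, sign_finRotate]
  simp [hm.neg_one_pow]

end Moore

section Independence

variable {k : Type*} [Field k] [Fintype k] {E : Type*} [Field E] [Algebra k E] {r : ℕ} {θ : E}

local notation "q" => Fintype.card k

lemma natDegree_aeval_drin_X_pow (hr : 1 ≤ r) (hθ : θ ≠ 0) (j : ℕ) :
    (aeval (drin k r (C θ)) (X ^ j : k[X]) (X : E[X])).natDegree = q ^ (r * j) := by
  rw [natDegree_aeval_of_op (Nat.one_lt_pow (by omega) one_lt_card : 1 < q ^ r)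
    (fun P hP => natDegree_drin hr hθ hP) (pow_ne_zero _ X_ne_zero), natDegree_X_pow, pow_mul]

lemma eq_zero_of_sum_pow_tors [IsAlgClosed E] (hr : 2 ≤ r) (hθ : θ ≠ 0) {a : k[X]}
    (ha : aeval θ a ≠ 0) (c : Fin r → Fin a.natDegree → E)
    (h : ∀ y ∈ tors k r θ a,
      ∑ i, ∑ j, c i j * (aeval (drin k r θ) (X ^ (j : ℕ) : k[X]) y) ^ q ^ (i : ℕ) = 0) (i j) :
    c i j = 0 := by
  have hq := one_lt_card (k := k)
  have ha0 : a ≠ 0 := by rintro rfl; simp at ha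
  set f : Fin r × Fin a.natDegree → E[X] := fun s =>
    C (c s.1 s.2) * (aeval (drin k r (C θ)) (X ^ (s.2 : ℕ) : k[X]) (X : E[X])) ^ q ^ (s.1 : ℕ) with hf
  have hdeg0 (s : Fin r × Fin a.natDegree) : ((aeval (drin k r (C θ)) (X ^ (s.2 : ℕ) : k[X]) (X : E[X])) ^ q ^ (s.1 : ℕ)).natDegree
      = q ^ (r * (s.2 : ℕ) + s.1) := by
    rw [natDegree_pow, natDegree_aeval_drin_X_pow (by omega) hθ, pow_add, mul_comm]
  have hdeg (s : Fin r × Fin a.natDegree) (hs : c s.1 s.2 ≠ 0) :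
      (f s).natDegree = q ^ (r * (s.2 : ℕ) + s.1) := by
    rw [hf]; dsimp only; rw [natDegree_C_mul hs, hdeg0 s]
  have hc_of (s : Fin r × Fin a.natDegree) (hs : f s ≠ 0) : c s.1 s.2 ≠ 0 := fun h0 => hs (by rw [hf]; simp [h0])
  have hlt (s : Fin r × Fin a.natDegree) : r * (s.2 : ℕ) + s.1 < r * a.natDegree := by
    have h1 := s.1.2
    have h2 : (s.2 : ℕ) + 1 ≤ a.natDegree := s.2.2
    calc r * (s.2 : ℕ) + s.1 < r * ((s.2 : ℕ) + 1) := by rw [mul_add]; omega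
      _ ≤ _ := Nat.mul_le_mul_left _ h2
  have hsum : ∑ s, f s = 0 := by
    have := finite_tors (k := k) (by omega : 1 ≤ r) hθ ha0
    have hfin : (tors k r θ a : Set E).Finite := this
    refine eq_zero_of_degree_lt_of_eval_finset_eq_zero hfin.toFinset ?_ ?_
    · have hcard : hfin.toFinset.card = q ^ (r * a.natDegree) := by
        rw [← card_tors hr hθ ha, ← Set.ncard_eq_toFinset_card _ hfin]; rfl
      rw [hcard]
      refine (degree_sum_le _ _).trans_lt ?_
      refine (Finset.sup_lt_iff (WithBot.bot_lt_coe _)).2 fun s _ => ?_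
      by_cases hs : f s = 0
      · rw [hs, degree_zero]; exact WithBot.bot_lt_coe _
      · rw [degree_eq_natDegree hs, hdeg s (hc_of s hs)]
        exact_mod_cast Nat.pow_lt_pow_right hq (hlt s)
    · intro y hy
      rw [eval_finsetSum, Fintype.sum_prod_type]
      rw [← h y (hfin.mem_toFinset.1 hy)]
      refine Finset.sum_congr rfl fun i _ => Finset.sum_congr rfl fun j _ => ?_
      rw [hf]; simp only [eval_mul, eval_C, eval_pow, eval_aeval_drin]
  by_contra hne
  have h2 := degree_sum_eq_of_disjoint f Finset.univ (by
    rintro s ⟨_, hs⟩ t ⟨_, ht⟩ hst heq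
    have heq' : degree (f s) = degree (f t) := heq
    have h3 := natDegree_eq_of_degree_eq heq'
    rw [hdeg s (hc_of s hs), hdeg t (hc_of t ht)] at h3
    have h4 := Nat.pow_right_injective hq h3
    have h5 : (s.1 : ℕ) = t.1 := by
      have := congrArg (· % r) h4
      simpa [Nat.mod_eq_of_lt s.1.2, Nat.mod_eq_of_lt t.1.2] using this
    have h6 : (s.2 : ℕ) = t.2 := by
      rw [h5] at h4
      exact Nat.eq_of_mul_eq_mul_left (by omega) (Nat.add_right_cancel h4)
    exact hst (Prod.ext (Fin.ext h5) (Fin.ext h6)))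
  rw [hsum, degree_zero] at h2
  have h3 : (f (i, j)).degree ≤ ⊥ := h2 ▸ Finset.le_sup (f := fun s => (f s).degree) (Finset.mem_univ (i, j))
  have h4 : f (i, j) = 0 := degree_eq_bot.1 (le_bot_iff.1 h3)
  have h5 := hdeg (i, j) hne
  rw [h4, natDegree_zero] at h5
  exact absurd h5.symm (pow_ne_zero _ (by omega))

end Independence

section TorsionVectors

variable {k : Type*} [Field k] {E : Type*} [Field E] [Algebra k E] {a : k[X]}

lemma exists_torsVec (ha : a.Monic) (hd : 0 < a.natDegree) {T : Module.End k E} {x : E}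
    (hx : aeval T a x = 0) :
    ∃ e : TorsRing E a, ∀ b, topCoeff ha (torsCoef E a b * e) = aeval T b x := by
  obtain ⟨e, he⟩ := exists_topCoeff_eq ha hd fun j => aeval T (X ^ (j : ℕ) : k[X]) x
  exact ⟨e, topCoeff_torsCoef_mul ha hx fun j hj => he ⟨j, hj⟩⟩

lemma eq_of_topCoeff (ha : a.Monic) (hd : 0 < a.natDegree) {e e' : TorsRing E a}
    (h : ∀ b, topCoeff ha (torsCoef E a b * e) = topCoeff ha (torsCoef E a b * e')) : e = e' := by
  refine sub_eq_zero.1 (eq_zero_of_topCoeff ha hd fun j _ => ?_)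
  rw [mul_sub, map_sub, h, sub_self]

lemma topCoeff_of_mul (ha : a.Monic) (x : E) (e : TorsRing E a) :
    topCoeff ha (AdjoinRoot.of _ x * e) = x * topCoeff ha e := by
  rw [← AdjoinRoot.algebraMap_eq, ← Algebra.smul_def, map_smul, smul_eq_mul]

lemma topCoeff_torsMap_mul (ha : a.Monic) (g : E →ₐ[k] E) (b : k[X]) (e : TorsRing E a) :
    topCoeff ha (torsCoef E a b * torsMap a g e) = g (topCoeff ha (torsCoef E a b * e)) := by
  rw [← topCoeff_torsMap, RingHom.map_mul, torsMap_torsCoef]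

end TorsionVectors

section DeterminantTorsion

variable {k : Type*} [Field k] [Fintype k] {E : Type*} [Field E] [Algebra k E] {r : ℕ} {θ : E}
  {a : k[X]}

local notation "q" => Fintype.card k

variable (E a) in
/-- Frobenius on the coefficients of `E ⊗ k[X]/(a)`. -/
def torsFrob : TorsRing E a →+* TorsRing E a := torsMap a (FiniteField.frobeniusAlgHom k E)

lemma topCoeff_torsFrob (ha : a.Monic) (e : TorsRing E a) :
    topCoeff ha (torsFrob E a e) = topCoeff ha e ^ q := topCoeff_torsMap ha _ e

lemma torsFrob_of (x : E) : torsFrob E a (AdjoinRoot.of _ x) = AdjoinRoot.of _ (x ^ q) :=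
  torsMap_of _ x

lemma torsFrob_torsCoef (b : k[X]) : torsFrob E a (torsCoef E a b) = torsCoef E a b :=
  torsMap_torsCoef _ b

lemma torsFrob_iterate_torsCoef_mul (b : k[X]) (e : TorsRing E a) (n : ℕ) :
    (torsFrob E a)^[n] (torsCoef E a b * e) = torsCoef E a b * (torsFrob E a)^[n] e := by
  induction n with
  | zero => rfl
  | succ n ih =>
    rw [Function.iterate_succ_apply', ih, RingHom.map_mul, torsFrob_torsCoef,
      Function.iterate_succ_apply']

lemma topCoeff_torsCoef_mul_iterate (ha : a.Monic) (b : k[X]) (e : TorsRing E a) (n : ℕ) :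
    topCoeff ha (torsCoef E a b * (torsFrob E a)^[n] e) =
      topCoeff ha (torsCoef E a b * e) ^ q ^ n := by
  rw [← torsFrob_iterate_torsCoef_mul]
  induction n with
  | zero => simp
  | succ n ih =>
    rw [Function.iterate_succ_apply', topCoeff_torsFrob, ih, ← pow_mul, ← pow_succ]

lemma torsMap_torsFrob_iterate (g : E →ₐ[k] E) (e : TorsRing E a) (n : ℕ) :
    torsMap a g ((torsFrob E a)^[n] e) = (torsFrob E a)^[n] (torsMap a g e) := by
  induction n with
  | zero => rfl
  | succ n ih =>
    rw [Function.iterate_succ_apply', Function.iterate_succ_apply', ← ih, torsFrob, torsMap_comp,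
      torsMap_comp]
    congr 1
    congr 1
    ext x
    simp

/-- The relation satisfied by the vector of a torsion point. -/
lemma torsFrob_relation (ha : a.Monic) (hd : 0 < a.natDegree) {m : ℕ} {x : E} {e : TorsRing E a}
    (he : ∀ b, topCoeff ha (torsCoef E a b * e) = aeval (drin k (m + 1) θ) b x) :
    AdjoinRoot.of _ (θ ^ (q - 1)) * (torsFrob E a)^[m + 1] e =
      (torsCoef E a X - AdjoinRoot.of _ θ) * e - (torsFrob E a)^[m] e := by
  refine eq_of_topCoeff ha hd fun b => ?_
  rw [mul_left_comm, topCoeff_of_mul, topCoeff_torsCoef_mul_iterate, mul_sub, map_sub,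
    topCoeff_torsCoef_mul_iterate, sub_mul, mul_sub, map_sub, mul_left_comm _ (AdjoinRoot.of _ θ), topCoeff_of_mul,
    ← mul_assoc, ← RingHom.map_mul, he, he, mul_comm b X, map_mul (aeval (drin k (m + 1) θ)), aeval_X, Module.End.mul_apply,
    drin_apply, Nat.add_sub_cancel]
  ring

/-- A vector which Frobenius scales by `T - θ` gives a torsion point of the Carlitz module. -/
lemma topCoeff_torsCoef_mul_of_torsFrob (ha : a.Monic) {w : TorsRing E a}
    (hw : torsFrob E a w = (torsCoef E a X - AdjoinRoot.of _ θ) * w) (b : k[X]) :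
    topCoeff ha (torsCoef E a b * w) = aeval (carl k θ) b (topCoeff ha w) := by
  have hX (b : k[X]) : topCoeff ha (torsCoef E a (X * b) * w) =
      carl k θ (topCoeff ha (torsCoef E a b * w)) := by
    have h1 : torsCoef E a (X * b) * w =
        torsFrob E a (torsCoef E a b * w) + AdjoinRoot.of _ θ * (torsCoef E a b * w) := by
      rw [RingHom.map_mul, RingHom.map_mul, torsFrob_torsCoef, hw]; ring
    rw [h1, map_add, topCoeff_torsFrob, topCoeff_of_mul, carl_apply, add_comm]
  induction b using Polynomial.induction_on with
  | C c =>
    rw [torsCoef_C, topCoeff_of_mul, aeval_C, Module.algebraMap_end_apply, Algebra.smul_def]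
  | add p p' hp hp' =>
    rw [RingHom.map_add, add_mul, map_add, hp, hp', map_add (aeval (carl k θ)), LinearMap.add_apply]
  | monomial n c h =>
    rw [pow_succ', mul_left_comm, hX, h, map_mul (aeval (carl k θ)) X, aeval_X, Module.End.mul_apply]

lemma isUnit_mooreMatrix [IsAlgClosed E] (ha : a.Monic) (hd : 0 < a.natDegree) (hr : 2 ≤ r)
    (hθ : θ ≠ 0) (haθ : aeval θ a ≠ 0) {x : Fin r → E} {e : Fin r → TorsRing E a}
    (he : ∀ j b, topCoeff ha (torsCoef E a b * e j) = aeval (drin k r θ) b (x j))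
    (hx : ∀ y ∈ tors k r θ a, ∃ c : Fin r → k[X], y = ∑ i, aeval (drin k r θ) (c i) (x i)) :
    IsUnit (mooreMatrix (torsFrob E a) e).det := by
  have hfd := finiteDimensional_torsRing (E := E) ha
  set Ψ := mooreMatrix (torsFrob E a) e with hΨ
  have hinj : ∀ c : Fin r → TorsRing E a, Matrix.vecMul c Ψ = 0 → c = 0 := by
    intro c hc
    choose p hpd hp using fun i => exists_mk_eq ha (c i)
    have hp' (i) : c i = ∑ j : Fin a.natDegree,
        AdjoinRoot.of _ ((p i).coeff j) * torsCoef E a (X ^ (j : ℕ)) := by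
      have h1 : (p i) = ∑ j : Fin a.natDegree, C ((p i).coeff j) * X ^ (j : ℕ) := by
        rw [Fin.sum_univ_eq_sum_range (fun j => C ((p i).coeff j) * X ^ j)]
        refine (p i).as_sum_range_C_mul_X_pow' ?_
        rcases eq_or_ne (p i) 0 with h0 | h0
        · rwa [h0, natDegree_zero]
        · exact (natDegree_lt_iff_degree_lt h0).2 (hpd i)
      conv_lhs => rw [← hp i, h1]
      rw [map_sum]
      refine Finset.sum_congr rfl fun j _ => ?_
      rw [map_mul, AdjoinRoot.mk_C, torsCoef_apply, Polynomial.map_pow, map_X]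
    have h0 := eq_zero_of_sum_pow_tors (k := k) hr hθ haθ (fun i j => (p i).coeff j) ?_
    · ext i
      rw [hp' i]
      exact Finset.sum_eq_zero fun j _ => by rw [h0 i j, map_zero, zero_mul]
    intro y hy
    obtain ⟨b, hb⟩ := hx y hy
    have h1 : ∑ i, c i * (torsFrob E a)^[(i : ℕ)] (∑ l, torsCoef E a (b l) * e l) = 0 := by
      have h2 (i : Fin r) : (torsFrob E a)^[(i : ℕ)] (∑ l, torsCoef E a (b l) * e l) =
          ∑ l, torsCoef E a (b l) * Ψ i l := by
        rw [← RingHom.coe_pow, map_sum, RingHom.coe_pow]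
        exact Finset.sum_congr rfl fun l _ => torsFrob_iterate_torsCoef_mul _ _ _
      simp_rw [h2, Finset.mul_sum]
      rw [Finset.sum_comm]
      refine Finset.sum_eq_zero fun l _ => ?_
      have h3 := congrFun hc l
      rw [Matrix.vecMul, dotProduct] at h3
      simp_rw [mul_left_comm (c _), ← Finset.mul_sum]
      rw [h3]; simp
    have h4 (b' : k[X]) : topCoeff ha (torsCoef E a b' * ∑ l, torsCoef E a (b l) * e l) =
        aeval (drin k r θ) b' y := by
      rw [Finset.mul_sum, map_sum, hb, map_sum]
      refine Finset.sum_congr rfl fun l _ => ?_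
      rw [← mul_assoc, ← RingHom.map_mul, he, map_mul (aeval (drin k r θ)), Module.End.mul_apply]
    have h5 := congrArg (topCoeff ha) h1
    rw [map_zero, map_sum] at h5
    rw [← h5]
    refine Finset.sum_congr rfl fun i _ => ?_
    rw [hp' i, Finset.sum_mul, map_sum]
    refine Finset.sum_congr rfl fun j _ => ?_
    rw [mul_assoc, topCoeff_of_mul, topCoeff_torsCoef_mul_iterate, h4]
  let L : (Fin r → TorsRing E a) →ₗ[E] (Fin r → TorsRing E a) :=
    (Matrix.vecMulLinear Ψ).restrictScalars E
  have hL : Function.Injective L := (injective_iff_map_eq_zero L).2 hinj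
  have hsurj : Function.Surjective L := LinearMap.surjective_of_injective hL
  obtain ⟨B, hB⟩ := (Matrix.vecMul_surjective_iff_exists_left_inverse (A := Ψ)).1 hsurj
  have := congrArg Matrix.det hB
  rw [Matrix.det_mul, Matrix.det_one] at this
  exact IsUnit.of_mul_eq_one_right _ this

/-- The determinant of the torsion of `drin` is the torsion of the Carlitz module. -/
theorem exists_carlitz_torsion_det [IsAlgClosed E] (ha : a.Monic) (hd : 0 < a.natDegree)
    (hr : Odd r) (hr2 : 2 ≤ r) (hθ : θ ≠ 0) (haθ : aeval θ a ≠ 0) {x : Fin r → E}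
    (hxt : ∀ i, x i ∈ tors k r θ a)
    (hx : ∀ y ∈ tors k r θ a, ∃ c : Fin r → k[X], y = ∑ i, aeval (drin k r θ) (c i) (x i)) :
    ∃ z : E, aeval (carl k θ) a z = 0 ∧ (∀ b : k[X], aeval (carl k θ) b z = 0 → a ∣ b) ∧
      ∀ g : E →ₐ[k] E, g θ = θ → ∀ N : Matrix (Fin r) (Fin r) k[X],
        (∀ j, g (x j) = ∑ i, aeval (drin k r θ) (N i j) (x i)) →
        g z = aeval (carl k θ) N.det z := by
  choose e he using fun j => exists_torsVec ha hd (hxt j : aeval (drin k r θ) a (x j) = 0)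
  have hunit := isUnit_mooreMatrix ha hd hr2 hθ haθ he hx
  set Ψ := mooreMatrix (torsFrob E a) e with hΨ
  set w := AdjoinRoot.of _ θ * Ψ.det with hw
  have hθu : IsUnit (AdjoinRoot.of (a.map (algebraMap k E)) θ) := (Ne.isUnit hθ).map _
  have hwu : IsUnit w := hθu.mul hunit
  have hfrob : torsFrob E a w = (torsCoef E a X - AdjoinRoot.of _ θ) * w := by
    obtain ⟨m, rfl⟩ : ∃ m, r = m + 1 := ⟨r - 1, by omega⟩
    have hm : Even m := by rwa [Nat.odd_add_one, Nat.not_odd_iff_even] at hr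
    have h1 := map_det_mooreMatrix hm (by omega) fun j => torsFrob_relation ha hd (he j)
    have h2 : q = q - 1 + 1 := (Nat.sub_add_cancel (one_lt_card (k := k)).le).symm
    rw [hw, RingHom.map_mul, torsFrob_of, mul_left_comm, ← h1]
    conv_lhs => rw [h2, pow_succ', RingHom.map_mul]
    ring
  have hC := topCoeff_torsCoef_mul_of_torsFrob ha hfrob
  refine ⟨topCoeff ha w, ?_, fun b hb => ?_, fun g hg N hN => ?_⟩
  · rw [← hC, (torsCoef_eq_zero E).2 dvd_rfl, zero_mul, map_zero]
  · rw [← torsCoef_eq_zero E]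
    have h1 : torsCoef E a b * w = 0 := eq_zero_of_topCoeff ha hd fun j _ => by
      rw [← mul_assoc, ← RingHom.map_mul, hC, map_mul, Module.End.mul_apply, hb, map_zero]
    exact (hwu.mul_left_eq_zero).1 h1
  · rw [← hC, ← topCoeff_torsMap]
    have hge (j) : torsMap a g (e j) = ∑ i, torsCoef E a (N i j) * e i := by
      refine eq_of_topCoeff ha hd fun b => ?_
      rw [topCoeff_torsMap_mul, he, map_aeval_drin g r hg, hN, map_sum, Finset.mul_sum, map_sum]
      refine Finset.sum_congr rfl fun i _ => ?_
      rw [← mul_assoc, ← RingHom.map_mul, he, map_mul (aeval (drin k r θ)), Module.End.mul_apply]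
    have hgΨ : (torsMap a g).mapMatrix Ψ = Ψ * (torsCoef E a).mapMatrix N := by
      ext i j
      rw [RingHom.mapMatrix_apply, Matrix.map_apply, hΨ, mooreMatrix_apply, torsMap_torsFrob_iterate,
        hge, ← RingHom.coe_pow, map_sum, RingHom.coe_pow, Matrix.mul_apply]
      refine Finset.sum_congr rfl fun l _ => ?_
      rw [torsFrob_iterate_torsCoef_mul, mul_comm]; rfl
    rw [hw, RingHom.map_mul, torsMap_of, hg, RingHom.map_det, hgΨ, Matrix.det_mul, ← RingHom.map_det]
    congr 1; ring

end DeterminantTorsion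

section LeftEval

variable {k : Type*} [Field k] {K : Type*} [Field K] [Algebra k K]

/-- Evaluation of a polynomial over `K` at an additive operator, with coefficients on the left. -/
def leftEval (T : Module.End k K[X]) : K[X] →ₗ[K] Module.End k K[X] :=
  (Polynomial.basisMonomials K).constr K fun n => T ^ n

lemma leftEval_X_pow (T : Module.End k K[X]) (n : ℕ) : leftEval T (X ^ n) = T ^ n := by
  have h := (Polynomial.basisMonomials K).constr_basis K (fun n => T ^ n) n
  rw [Polynomial.coe_basisMonomials] at h
  rw [X_pow_eq_monomial]
  exact h

lemma leftEval_mul_X (T : Module.End k K[X]) (p : K[X]) : leftEval T (p * X) = leftEval T p * T := by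
  induction p using Polynomial.induction_on' with
  | add p p' h h' => rw [add_mul, map_add, h, h', map_add, add_mul]
  | monomial n c =>
    rw [← C_mul_X_pow_eq_monomial, mul_assoc, ← pow_succ, ← smul_eq_C_mul, ← smul_eq_C_mul, map_smul,
      map_smul, leftEval_X_pow, leftEval_X_pow, pow_succ]
    rfl

lemma leftEval_map (T : Module.End k K[X]) (f : k[X]) :
    leftEval T (f.map (algebraMap k K)) = aeval T f := by
  induction f using Polynomial.induction_on' with
  | add p p' h h' => rw [Polynomial.map_add, map_add, h, h', map_add]
  | monomial n c =>
    rw [map_monomial, ← C_mul_X_pow_eq_monomial, ← C_mul_X_pow_eq_monomial, ← smul_eq_C_mul, map_smul,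
      leftEval_X_pow, map_mul, aeval_C, map_pow, aeval_X]
    ext1 P
    simp

end LeftEval

section CarlitzReduction

variable {k : Type*} [Field k] [Fintype k] {K : Type*} [Field K] [Algebra k K] {θ : K}

local notation "q" => Fintype.card k

lemma pow_card_pow_injective [Finite K] (hgen : Function.Surjective (aeval θ : k[X] → K)) {d : ℕ}
    (hcard : Nat.card K = q ^ d) :
    Set.InjOn (fun j => θ ^ q ^ j) (Finset.range d : Set ℕ) := by
  have hq := one_lt_card (k := k)
  have key : ∀ i j, i < j → j < d → θ ^ q ^ i ≠ θ ^ q ^ j := by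
    intro i j hij hj h
    obtain ⟨m, rfl⟩ : ∃ m, j = i + m := ⟨j - i, by omega⟩
    have h1 (n : ℕ) (x : K) : x ^ q ^ n = (FiniteField.frobeniusAlgHom k K ^ n) x := by
      rw [← frob_pow_apply (k := k)]
      induction n generalizing x with
      | zero => rfl
      | succ n ih => rw [pow_succ, pow_succ, Module.End.mul_apply, ih]; rfl
    have h2 : θ = θ ^ q ^ m := by
      rw [pow_add, mul_comm, pow_mul, h1 i, h1 i (θ ^ q ^ m)] at h
      exact (FiniteField.frobeniusAlgHom k K ^ i).injective h
    have h3 (x : K) : x ^ q ^ m = x := by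
      obtain ⟨p, rfl⟩ := hgen x
      rw [h1, ← aeval_algHom_apply, ← h1, ← h2]
    have hm : 1 < q ^ m := Nat.one_lt_pow (by omega) hq
    have h4 := FiniteField.X_pow_card_sub_X_ne_zero K hm
    have := Fintype.ofFinite K
    refine h4 (eq_zero_of_natDegree_lt_card_of_eval_eq_zero _ Function.injective_id
      (fun x : K => by simp [h3]) ?_)
    rw [FiniteField.X_pow_card_sub_X_natDegree_eq K hm, ← Nat.card_eq_fintype_card (α := K), hcard]
    exact Nat.pow_lt_pow_right hq (by omega)
  intro i hi j hj h
  have hi' := Finset.mem_range.1 hi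
  have hj' := Finset.mem_range.1 hj
  rcases lt_trichotomy i j with h1 | h1 | h1
  · exact absurd h (key i j h1 hj')
  · exact h1
  · exact absurd h.symm (key j i h1 hi')

lemma map_eq_prod_X_sub_C_pow [Finite K] (hgen : Function.Surjective (aeval θ : k[X] → K)) {f : k[X]}
    (hf : f.Monic) (hθ : aeval θ f = 0) (hcard : Nat.card K = q ^ f.natDegree) :
    f.map (algebraMap k K) = ∏ j ∈ Finset.range f.natDegree, (X - C (θ ^ q ^ j)) := by
  have hf0 : f.map (algebraMap k K) ≠ 0 := (hf.map _).ne_zero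
  have hroot (j : ℕ) : (f.map (algebraMap k K)).IsRoot (θ ^ q ^ j) := by
    rw [IsRoot.def, eval_map_algebraMap]
    induction j with
    | zero => simpa using hθ
    | succ n ih =>
      rw [pow_succ, pow_mul]
      have := aeval_algHom_apply (FiniteField.frobeniusAlgHom k K) (θ ^ q ^ n) f
      rw [ih, map_zero] at this
      exact this
  have h1 : ∏ j ∈ Finset.range f.natDegree, (X - C (θ ^ q ^ j)) =
      (((Finset.range f.natDegree).val.map fun j => θ ^ q ^ j).map fun a => X - C a).prod := by
    rw [Multiset.map_map]; rfl
  have hmon : (∏ j ∈ Finset.range f.natDegree, (X - C (θ ^ q ^ j))).Monic :=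
    monic_prod_of_monic _ _ fun j _ => monic_X_sub_C _
  refine (eq_of_monic_of_dvd_of_natDegree_le hmon (hf.map _) ?_ ?_)
  · rw [h1, Multiset.prod_X_sub_C_dvd_iff_le_roots hf0, Multiset.le_iff_subset]
    · intro x hx
      obtain ⟨j, _, rfl⟩ := Multiset.mem_map.1 hx
      exact (mem_roots hf0).2 (hroot j)
    · exact Multiset.Nodup.map_on (fun i hi j hj h => pow_card_pow_injective hgen hcard hi hj h)
        (Finset.range _).nodup
  · rw [natDegree_map, natDegree_prod_of_monic _ _ fun j _ => monic_X_sub_C _]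
    simp_rw [natDegree_X_sub_C]
    simp

/-- The Carlitz polynomial of the prime `f` reduces modulo `f` to a power of Frobenius. -/
lemma aeval_carl_eq_X_pow [Finite K] (hgen : Function.Surjective (aeval θ : k[X] → K)) {f : k[X]}
    (hf : f.Monic) (hθ : aeval θ f = 0) (hcard : Nat.card K = q ^ f.natDegree) :
    aeval (carl k (C θ)) f (X : K[X]) = X ^ q ^ f.natDegree := by
  have key (i : ℕ) : leftEval (carl k (C θ)) (∏ j ∈ Finset.range i, (X - C (θ ^ q ^ j))) =
      frob k K[X] ^ i := by
    induction i with
    | zero => simpa using leftEval_X_pow (carl k (C θ)) 0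
    | succ i ih =>
      rw [Finset.prod_range_succ, mul_sub, map_sub, leftEval_mul_X, mul_comm _ (C _), ← smul_eq_C_mul,
        map_smul, ih]
      ext1 P
      rw [LinearMap.sub_apply, Module.End.mul_apply, carl_apply, map_add, LinearMap.smul_apply,
        frob_pow_apply, frob_pow_apply, frob_pow_apply, frob_pow_apply, mul_pow, ← pow_mul, ← pow_succ',
        ← C_pow, smul_eq_C_mul, add_sub_cancel_left]
  rw [← leftEval_map, map_eq_prod_X_sub_C_pow hgen hf hθ hcard, key, frob_pow_apply]

end CarlitzReduction

section CarlitzIrreducible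

variable {k : Type*} [Field k] [Fintype k] {E : Type*} [Field E] [Algebra k[X] E] [Algebra k E]
  [IsScalarTower k k[X] E]

local notation "q" => Fintype.card k

variable (k) in
/-- The polynomial of the Carlitz module over `k[X]`. -/
def carlPoly (a : k[X]) : k[X][X] := aeval (carl k (C X : k[X][X])) a (X : k[X][X])

lemma monic_carlPoly {a : k[X]} (ha : a.Monic) : (carlPoly k a).Monic :=
  monic_aeval_carl (S := k[X]) X ha

lemma aeval_carlPoly (a : k[X]) (y : E) :
    aeval y (carlPoly k a) = aeval (carl k (algebraMap k[X] E X)) a y := by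
  have := map_aeval_carl (k := k) ((aeval y : k[X][X] →ₐ[k[X]] E).restrictScalars k)
    (θ := C X) (θ' := algebraMap k[X] E X) (by simp) a X
  simpa [carlPoly] using this

lemma map_carlPoly {K : Type*} [Field K] [Algebra k K] (θ : K) (a : k[X]) :
    (carlPoly k a).map (aeval θ : k[X] →ₐ[k] K).toRingHom = aeval (carl k (C θ)) a X := by
  have := map_aeval_carl (k := k) (Polynomial.mapAlgHom (aeval θ : k[X] →ₐ[k] K))
    (θ := C X) (θ' := C θ) (by simp) a X
  simpa [carlPoly] using this

lemma separable_aeval_carl {K : Type*} [Field K] [Algebra k K] {θ : K} {a : k[X]}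
    (ha : aeval θ a ≠ 0) : (aeval (carl k (C θ)) a (X : K[X])).Separable := by
  rw [Polynomial.separable_def, derivative_aeval_of_op (fun P => derivative_carl θ P), derivative_X, mul_one]
  exact (isCoprime_one_right (x := aeval (carl k (C θ)) a (X : K[X]))).of_isCoprime_of_dvd_right
    ((isUnit_C.2 (Ne.isUnit ha)).dvd)

lemma isIntegral_of_carl_torsion {a : k[X]} (ha : a.Monic) {y : E}
    (hy : aeval (carl k (algebraMap k[X] E X)) a y = 0) : IsIntegral k[X] y :=
  ⟨carlPoly k a, monic_carlPoly ha, by rw [← aeval_def, aeval_carlPoly, hy]⟩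

lemma minpoly_aeval_carl_of_irreducible [Module.IsTorsionFree k[X] E] {a f : k[X]} (ha : a.Monic)
    (hf : f.Monic) (hirr : Irreducible f) (hfa : ¬ f ∣ a) {y : E}
    (hy : aeval (carl k (algebraMap k[X] E X)) a y = 0) :
    minpoly k[X] y = minpoly k[X] (aeval (carl k (algebraMap k[X] E X)) f y) := by
  set y' := aeval (carl k (algebraMap k[X] E X)) f y with hy'
  have hya : aeval (carl k (algebraMap k[X] E X)) a y' = 0 := by
    rw [hy', ← Module.End.mul_apply, ← map_mul, mul_comm, map_mul, Module.End.mul_apply, hy, map_zero]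
  have hi := isIntegral_of_carl_torsion ha hy
  have hi' := isIntegral_of_carl_torsion ha hya
  set P := minpoly k[X] y with hP
  set Q := minpoly k[X] y' with hQ
  have hPa : P ∣ carlPoly k a := minpoly.isIntegrallyClosed_dvd hi (by rw [aeval_carlPoly, hy])
  have hQa : Q ∣ carlPoly k a := minpoly.isIntegrallyClosed_dvd hi' (by rw [aeval_carlPoly, hya])
  have hPQ : P ∣ Q.comp (carlPoly k f) := minpoly.isIntegrallyClosed_dvd hi (by
    rw [aeval_comp, aeval_carlPoly, ← hy', hQ, minpoly.aeval])
  have hPp : Prime P := minpoly.prime_of_isIntegrallyClosed hi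
  have hQp : Prime Q := minpoly.prime_of_isIntegrallyClosed hi'
  by_contra hne
  have hprod : P * Q ∣ carlPoly k a := by
    obtain ⟨S, hS⟩ := hQa
    rw [hS] at hPa ⊢
    rcases hPp.dvd_or_dvd hPa with h | h
    · have := (hPp.irreducible.dvd_irreducible_iff_associated hQp.irreducible).1 h
      exact absurd (eq_of_monic_of_associated (minpoly.monic hi) (minpoly.monic hi') this) hne
    · rw [mul_comm]; exact mul_dvd_mul_left _ h
  have : Fact (Irreducible f) := ⟨hirr⟩
  have hfin : Module.Finite k (AdjoinRoot f) := hf.finite_adjoinRoot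
  have : Finite (AdjoinRoot f) := Module.finite_of_finite k
  have := Fintype.ofFinite (AdjoinRoot f)
  set θ := AdjoinRoot.root f with hθdef
  have hmk (p : k[X]) : aeval θ p = AdjoinRoot.mk f p := AdjoinRoot.aeval_eq p
  have hgen : Function.Surjective (aeval θ : k[X] → AdjoinRoot f) := fun x => by
    obtain ⟨p, rfl⟩ := AdjoinRoot.mk_surjective x
    exact ⟨p, hmk p⟩
  have hθ : aeval θ f = 0 := by rw [hmk, AdjoinRoot.mk_self]
  have haθ : aeval θ a ≠ 0 := by rwa [hmk, Ne, AdjoinRoot.mk_eq_zero]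
  have hcard : Nat.card (AdjoinRoot f) = q ^ f.natDegree := by
    have h1 : Module.finrank k (AdjoinRoot f) = f.natDegree := finrank_quotient_span_eq_natDegree
    rw [← h1, ← Nat.card_eq_fintype_card]
    exact Module.natCard_eq_pow_finrank
  set h := (aeval θ : k[X] →ₐ[k] AdjoinRoot f).toRingHom with hh
  have h1 : P.map h * Q.map h ∣ aeval (carl k (C θ)) a X := by
    rw [← Polynomial.map_mul, ← map_carlPoly]
    exact Polynomial.map_dvd h hprod
  have hcop : IsCoprime (P.map h) (Q.map h) := ((separable_aeval_carl haθ).of_dvd h1).isCoprime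
  have h2 : P.map h ∣ (Q.map h) ^ q ^ f.natDegree := by
    have h3 := Polynomial.map_dvd h hPQ
    rw [map_comp, map_carlPoly, aeval_carl_eq_X_pow hgen hf hθ hcard, ← expand_eq_comp_X_pow,
      ← hcard, Nat.card_eq_fintype_card, FiniteField.expand_card, ← Nat.card_eq_fintype_card, hcard] at h3
    exact h3
  have h3 : IsUnit (P.map h) := hcop.pow_right.isUnit_of_dvd' dvd_rfl h2
  have h4 := natDegree_eq_zero_of_isUnit h3
  rw [(minpoly.monic hi).natDegree_map] at h4
  exact (minpoly.natDegree_pos hi).ne' h4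

lemma minpoly_aeval_carl_of_monic [Module.IsTorsionFree k[X] E] {a u : k[X]} (ha : a.Monic)
    (hu : u.Monic) (hua : IsCoprime u a) {y : E}
    (hy : aeval (carl k (algebraMap k[X] E X)) a y = 0) :
    minpoly k[X] y = minpoly k[X] (aeval (carl k (algebraMap k[X] E X)) u y) := by
  induction hn : u.natDegree using Nat.strong_induction_on generalizing u with
  | _ n ih =>
    by_cases h0 : IsUnit u
    · rw [hu.isUnit_iff.1 h0, map_one, Module.End.one_apply]
    obtain ⟨f, hf, hirr, v, rfl⟩ := exists_monic_irreducible_factor u h0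
    have hv : v.Monic := hf.of_mul_monic_left hu
    have hfa : ¬ f ∣ a := fun h => hirr.not_isUnit (hua.of_mul_left_left.isUnit_of_dvd' dvd_rfl h)
    have hlt : v.natDegree < n := by
      rw [← hn, hf.natDegree_mul hv]
      have := hirr.natDegree_pos
      omega
    rw [ih _ hlt hv hua.of_mul_left_right rfl, map_mul, Module.End.mul_apply]
    refine minpoly_aeval_carl_of_irreducible ha hf hirr hfa ?_
    rw [← Module.End.mul_apply, ← map_mul, mul_comm, map_mul, Module.End.mul_apply, hy, map_zero]

/-- The Galois group acts on Carlitz torsion through all units. -/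
theorem exists_galois_aeval_carl {F : Type*} [Field F] [Algebra k[X] F] [IsFractionRing k[X] F]
    [Algebra F E] [IsScalarTower k[X] F E] [Normal F E] {a u : k[X]} (ha : a.Monic)
    (hua : IsCoprime u a) {y : E} (hy : aeval (carl k (algebraMap k[X] E X)) a y = 0) :
    ∃ σ : E ≃ₐ[F] E, σ y = aeval (carl k (algebraMap k[X] E X)) u y := by
  have hinj : Function.Injective (algebraMap k[X] E) := by
    rw [IsScalarTower.algebraMap_eq k[X] F E]
    exact (algebraMap F E).injective.comp (IsFractionRing.injective k[X] F)
  have : FaithfulSMul k[X] E := (faithfulSMul_iff_algebraMap_injective _ _).2 hinj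
  set u' := u + X ^ (u.natDegree + 1) * a with hu'
  have hmon : u'.Monic := by
    refine ((monic_X_pow _).mul ha).add_of_right ?_
    rw [ha.degree_mul, degree_X_pow, degree_eq_natDegree ha.ne_zero]
    refine degree_le_natDegree.trans_lt ?_
    norm_cast
    omega
  have hcop : IsCoprime u' a := IsCoprime.add_mul_right_left_iff.2 hua
  have h1 : aeval (carl k (algebraMap k[X] E X)) u y = aeval (carl k (algebraMap k[X] E X)) u' y := by
    rw [hu', map_add, map_mul, LinearMap.add_apply, Module.End.mul_apply, hy, map_zero, add_zero]
  have hy' : aeval (carl k (algebraMap k[X] E X)) a (aeval (carl k (algebraMap k[X] E X)) u' y) = 0 := by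
    rw [← Module.End.mul_apply, ← map_mul, mul_comm, map_mul, Module.End.mul_apply, hy, map_zero]
  have h2 := minpoly_aeval_carl_of_monic ha hmon hcop hy
  rw [h1]
  refine isConjRoot_iff_exists_algEquiv.1 ?_
  rw [isConjRoot_def, minpoly.isIntegrallyClosed_eq_field_fractions' F (isIntegral_of_carl_torsion ha hy),
    minpoly.isIntegrallyClosed_eq_field_fractions' F (isIntegral_of_carl_torsion ha hy'), h2]

end CarlitzIrreducible

lemma map_one_add_vecMulVec {k : Type*} [Field k] {n : Type*} [DecidableEq n] {a : k[X]} (c d : n → k[X]) : (1 + Matrix.vecMulVec d c).map (AdjoinRoot.mk a) =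
    1 + Matrix.vecMulVec (AdjoinRoot.mk a ∘ d) (AdjoinRoot.mk a ∘ c) := by
  ext i j
  simp [Matrix.one_apply, Matrix.vecMulVec_apply, apply_ite]

section TorsionMatrices

open Matrix

variable {k : Type*} [Field k] {E : Type*} [AddCommGroup E] [Module k E] {n : Type*} [Fintype n]

/-- The combination `∑ cᵢ • xᵢ` for the `k[X]`-module structure defined by `T`. -/
def comb (T : Module.End k E) (x : n → E) (c : n → k[X]) : E := ∑ i, aeval T (c i) (x i)

variable {T : Module.End k E} {x : n → E}

lemma comb_add (c d : n → k[X]) : comb T x (c + d) = comb T x c + comb T x d := by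
  simp [comb, Finset.sum_add_distrib]

lemma comb_sub (c d : n → k[X]) : comb T x (c - d) = comb T x c - comb T x d := by
  simp [comb, Finset.sum_sub_distrib]

lemma comb_smul (b : k[X]) (c : n → k[X]) : comb T x (b • c) = aeval T b (comb T x c) := by
  simp [comb, map_sum]

lemma comb_single [DecidableEq n] (i : n) : comb T x (Pi.single i 1) = x i := by
  rw [comb, Finset.sum_eq_single i (fun j _ hj => by rw [Pi.single_eq_of_ne hj]; simp) (by simp)]
  simp

lemma comb_sum {ι : Type*} (s : Finset ι) (c : ι → n → k[X]) :
    comb T x (∑ i ∈ s, c i) = ∑ i ∈ s, comb T x (c i) := by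
  simp only [comb, Finset.sum_apply, map_sum, LinearMap.sum_apply]
  exact Finset.sum_comm

lemma comb_eq_iff {a : k[X]} (hx : ∀ i, x i ∈ LinearMap.ker (aeval T a))
    (hind : ∀ c : n → k[X], comb T x c = 0 → ∀ i, a ∣ c i) {c d : n → k[X]} :
    comb T x c = comb T x d ↔ AdjoinRoot.mk a ∘ c = AdjoinRoot.mk a ∘ d := by
  have h1 : AdjoinRoot.mk a ∘ c = AdjoinRoot.mk a ∘ d ↔ ∀ i, a ∣ (c - d) i := by
    rw [funext_iff]
    refine forall_congr' fun i => ?_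
    rw [Pi.sub_apply, ← AdjoinRoot.mk_eq_mk]; rfl
  rw [h1, ← sub_eq_zero, ← comb_sub]
  refine ⟨hind _, fun h => Finset.sum_eq_zero fun i _ => ?_⟩
  obtain ⟨e, he⟩ := h i
  rw [he, mul_comm, map_mul, Module.End.mul_apply, LinearMap.mem_ker.1 (hx i), map_zero]

/-- The matrix `N` represents `h` in the generators `x`. -/
def Represents (T : Module.End k E) (x : n → E) (h : E → E) (N : Matrix n n k[X]) : Prop :=
  ∀ j, h (x j) = comb T x (N.col j)

/-- Compatibility with the module structure on the kernel of `a`. -/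
structure IsTorsionHom (T : Module.End k E) (a : k[X]) (h : E → E) : Prop where
  map_add : ∀ x ∈ LinearMap.ker (aeval T a), ∀ y ∈ LinearMap.ker (aeval T a), h (x + y) = h x + h y
  map_aeval : ∀ b : k[X], ∀ x ∈ LinearMap.ker (aeval T a), h (aeval T b x) = aeval T b (h x)

lemma Represents.apply_comb {a : k[X]} (hx : ∀ i, x i ∈ LinearMap.ker (aeval T a)) {h : E → E}
    (hh : IsTorsionHom T a h) {N : Matrix n n k[X]} (hN : Represents T x h N) (c : n → k[X]) :
    h (comb T x c) = comb T x (N *ᵥ c) := by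
  let g : LinearMap.ker (aeval T a) →+ E :=
    AddMonoidHom.mk' (fun y => h y) fun y z => hh.map_add y y.2 z z.2
  have hmem (i) : aeval T (c i) (x i) ∈ LinearMap.ker (aeval T a) := by
    rw [LinearMap.mem_ker, ← Module.End.mul_apply, ← map_mul, mul_comm, map_mul, Module.End.mul_apply,
      LinearMap.mem_ker.1 (hx i), map_zero]
  have h1 : h (comb T x c) = g (∑ i, ⟨aeval T (c i) (x i), hmem i⟩) := by
    change _ = h (Submodule.subtype _ _)
    rw [map_sum]; rfl
  rw [h1, map_sum, mulVec_eq_sum, comb_sum]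
  refine Finset.sum_congr rfl fun j _ => ?_
  change h (aeval T (c j) (x j)) = _
  rw [hh.map_aeval _ _ (hx j), hN j, op_smul_eq_smul, comb_smul]; rfl

lemma Represents.mul {a : k[X]} (hx : ∀ i, x i ∈ LinearMap.ker (aeval T a)) {h h' : E → E}
    (hh : IsTorsionHom T a h) {N N' : Matrix n n k[X]} (hN : Represents T x h N)
    (hN' : Represents T x h' N') : Represents T x (h ∘ h') (N * N') := fun j => by
  rw [Function.comp_apply, hN' j, hN.apply_comb hx hh]; rfl

lemma represents_id [DecidableEq n] : Represents T x id 1 := fun j => by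
  rw [id, show (1 : Matrix n n k[X]).col j = Pi.single j 1 from ?_, comb_single]
  ext i
  rw [col_apply, one_apply, Pi.single_apply]

lemma Represents.map_eq {a : k[X]} (hx : ∀ i, x i ∈ LinearMap.ker (aeval T a))
    (hind : ∀ c : n → k[X], comb T x c = 0 → ∀ i, a ∣ c i) {h : E → E} {N N' : Matrix n n k[X]}
    (hN : Represents T x h N) (hN' : Represents T x h N') :
    N.map (AdjoinRoot.mk a) = N'.map (AdjoinRoot.mk a) := by
  ext i j
  exact congrFun ((comb_eq_iff hx hind).1 ((hN j).symm.trans (hN' j))) i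

lemma exists_represents {a : k[X]} (hgen : ∀ y ∈ LinearMap.ker (aeval T a), ∃ c : n → k[X], y = comb T x c)
    {h : E → E} (hh : ∀ j, h (x j) ∈ LinearMap.ker (aeval T a)) :
    ∃ N, Represents T x h N := by
  choose c hc using fun j => hgen _ (hh j)
  exact ⟨Matrix.of fun i j => c j i, hc⟩

end TorsionMatrices

section GaloisMatrices

open Matrix

variable {k F E : Type*} [Field k] [Fintype k] [Field F] [Field E] [Algebra k F] [Algebra F E]
  [Algebra k E] [IsScalarTower k F E] {t : F} {θ : E} {r : ℕ} {a : k[X]} {n : Type*} [Fintype n]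
  {x : n → E}

lemma isTorsionHom_galois (hθt : algebraMap F E t = θ) (σ : E ≃ₐ[F] E) :
    IsTorsionHom (drin k r θ) a σ :=
  ⟨fun _ _ _ _ => map_add σ _ _, fun b y _ => galois_aeval_drin hθt σ r b y⟩

variable {U : Submodule k E} {y : E} {c : n → k[X]}

lemma comb_mem_iff_dotProduct (hUφ : ∀ b : k[X], ∀ x ∈ U, aeval (drin k r θ) b x ∈ U)
    (hy : y ∈ tors k r θ a) (hyU : ∀ b : k[X], aeval (drin k r θ) b y ∈ U → a ∣ b)
    (hc : ∀ j, x j - aeval (drin k r θ) (c j) y ∈ U) (d : n → k[X]) :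
    comb (drin k r θ) x d ∈ U ↔ (AdjoinRoot.mk a ∘ c) ⬝ᵥ (AdjoinRoot.mk a ∘ d) = 0 := by
  have h1 : comb (drin k r θ) x d - aeval (drin k r θ) (c ⬝ᵥ d) y ∈ U := by
    rw [comb, dotProduct, map_sum, LinearMap.sum_apply, ← Finset.sum_sub_distrib]
    refine Submodule.sum_mem _ fun i _ => ?_
    rw [mul_comm, map_mul, Module.End.mul_apply, ← map_sub]
    exact hUφ _ _ (hc i)
  have h2 : (AdjoinRoot.mk a ∘ c) ⬝ᵥ (AdjoinRoot.mk a ∘ d) = AdjoinRoot.mk a (c ⬝ᵥ d) :=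
    (RingHom.map_dotProduct _ _ _).symm
  rw [h2, AdjoinRoot.mk_eq_zero]
  refine ⟨fun h => hyU _ ?_, fun ⟨e, he⟩ => ?_⟩
  · simpa using U.sub_mem h h1
  · rw [he, mul_comm, map_mul, Module.End.mul_apply, LinearMap.mem_ker.1 hy, map_zero, sub_zero] at h1
    exact h1

variable [DecidableEq n]

/-- The matrices modulo `a` of the Galois action on the `a`-torsion. -/
def galoisMatrices (hθt : algebraMap F E t = θ) (hx : ∀ i, x i ∈ tors k r θ a) :
    Submonoid (Matrix n n (AdjoinRoot a)) where
  carrier := {g | ∃ (σ : E ≃ₐ[F] E) (N : Matrix n n k[X]),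
    Represents (drin k r θ) x σ N ∧ N.map (AdjoinRoot.mk a) = g}
  one_mem' := ⟨1, 1, represents_id, Matrix.map_one _ (map_zero _) (map_one _)⟩
  mul_mem' := by
    rintro _ _ ⟨σ, N, h, rfl⟩ ⟨σ', N', h', rfl⟩
    exact ⟨σ * σ', N * N', Represents.mul hx (isTorsionHom_galois hθt σ) h h', Matrix.map_mul⟩

lemma isUnit_of_mem_galoisMatrices (hθt : algebraMap F E t = θ) (hx : ∀ i, x i ∈ tors k r θ a)
    (hind : ∀ c : n → k[X], comb (drin k r θ) x c = 0 → ∀ i, a ∣ c i)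
    (hgen : ∀ y ∈ tors k r θ a, ∃ c : n → k[X], y = comb (drin k r θ) x c)
    {g : Matrix n n (AdjoinRoot a)} (hg : g ∈ galoisMatrices hθt hx) : IsUnit g := by
  obtain ⟨σ, N, h, rfl⟩ := hg
  obtain ⟨N', h'⟩ := exists_represents (h := ⇑(σ⁻¹ : E ≃ₐ[F] E)) hgen
    fun j => galois_mem_tors hθt σ⁻¹ (hx j)
  have h1 := h.mul hx (isTorsionHom_galois hθt σ) h'
  have h2 : (σ ∘ (σ⁻¹ : E ≃ₐ[F] E) : E → E) = id := funext fun y => σ.apply_symm_apply y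
  rw [h2] at h1
  have h3 := h1.map_eq hx hind represents_id
  rw [Matrix.map_mul, Matrix.map_one _ (map_zero _) (map_one _)] at h3
  exact IsUnit.of_mul_eq_one _ h3

lemma apply_eq_comb_of_translation (hθt : algebraMap F E t = θ)
    (hc : ∀ j, x j - aeval (drin k r θ) (c j) y ∈ U) {σ : E ≃ₐ[F] E} {d : n → k[X]}
    {f : k[X]} (hσU : ∀ x ∈ U, aeval (drin k r θ) f (σ x) = aeval (drin k r θ) f x)
    (hσy : σ y = y + comb (drin k r θ) x d) (j : n) :
    aeval (drin k r θ) f (σ (x j)) =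
      aeval (drin k r θ) f (comb (drin k r θ) x ((1 + vecMulVec d c).col j)) := by
  have h1 := hσU _ (hc j)
  rw [map_sub, map_sub, map_sub, galois_aeval_drin hθt, hσy, map_add, map_add] at h1
  have h2 : (1 + vecMulVec d c).col j = Pi.single j 1 + c j • d := by
    ext i
    simp [one_apply, Pi.single_apply, vecMulVec_apply, mul_comm]
  rw [h2, comb_add, comb_single, comb_smul, map_add]
  linear_combination h1

lemma span_vecMul_galoisMatrices (hθt : algebraMap F E t = θ) (hx : ∀ i, x i ∈ tors k r θ a)
    (hind : ∀ c : n → k[X], comb (drin k r θ) x c = 0 → ∀ i, a ∣ c i)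
    (hgen : ∀ y ∈ tors k r θ a, ∃ c : n → k[X], y = comb (drin k r θ) x c)
    (hend : ∀ i j, ∃ f ∈ Submodule.span k (Set.range (galEnd (F := F) (E := E) k)),
      ∀ m, f (x m) = if m = j then x i else 0)
    {f b : n → AdjoinRoot a} (hf : f ⬝ᵥ b = 1) :
    Submodule.span (AdjoinRoot a) {y | ∃ g ∈ galoisMatrices hθt hx, f ᵥ* g = y} = ⊤ := by
  set W := Submodule.span (AdjoinRoot a) {y | ∃ g ∈ galoisMatrices hθt hx, f ᵥ* g = y} with hW
  have key : ∀ h ∈ Submodule.span k (Set.range (galEnd (F := F) (E := E) k)),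
      ∃ N : Matrix n n k[X], Represents (drin k r θ) x h N ∧ f ᵥ* N.map (AdjoinRoot.mk a) ∈ W := by
    intro h hh
    induction hh using Submodule.span_induction with
    | mem h hh =>
      obtain ⟨σ, rfl⟩ := hh
      obtain ⟨N, hN⟩ := exists_represents (h := σ) hgen fun j => galois_mem_tors hθt σ (hx j)
      exact ⟨N, hN, Submodule.subset_span ⟨_, ⟨σ, N, hN, rfl⟩, rfl⟩⟩
    | zero =>
      refine ⟨0, fun j => ?_, ?_⟩
      · simp [comb]
      · rw [Matrix.map_zero _ (map_zero _), vecMul_zero]; exact W.zero_mem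
    | add h h' _ _ ih ih' =>
      obtain ⟨N, hN, hNW⟩ := ih
      obtain ⟨N', hN', hNW'⟩ := ih'
      refine ⟨N + N', fun j => ?_, ?_⟩
      · rw [LinearMap.add_apply, hN j, hN' j, ← comb_add]; rfl
      · rw [Matrix.map_add _ (map_add _), vecMul_add]; exact W.add_mem hNW hNW'
    | smul s h _ ih =>
      obtain ⟨N, hN, hNW⟩ := ih
      refine ⟨C s • N, fun j => ?_, ?_⟩
      · rw [LinearMap.smul_apply, hN j, show (C s • N).col j = C s • N.col j from rfl, comb_smul,
          aeval_C]
        rfl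
      · have h1 : (C s • N).map (AdjoinRoot.mk a) = AdjoinRoot.mk a (C s) • N.map (AdjoinRoot.mk a) := by
          ext i j; simp
        rw [h1, vecMul_smul]; exact W.smul_mem _ hNW
  have hsingle (i j) : Pi.single j (f i) ∈ W := by
    obtain ⟨h, hh, hhx⟩ := hend i j
    obtain ⟨N, hN, hNW⟩ := key h hh
    have h1 : Represents (drin k r θ) x h (Matrix.single i j 1) := fun m => by
      rw [hhx]
      split_ifs with hm
      · subst hm
        rw [show (Matrix.single i m (1 : k[X])).col m = Pi.single i 1 from ?_, comb_single]
        ext l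
        simp [Matrix.single_apply, Pi.single_apply, eq_comm]
      · rw [show (Matrix.single i j (1 : k[X])).col m = 0 from ?_]
        · simp [comb]
        · ext l
          simp [Ne.symm hm]
    rw [hN.map_eq hx hind h1] at hNW
    convert hNW using 1
    ext m
    rcases eq_or_ne j m with rfl | hjm
    · simp [vecMul, dotProduct, Matrix.single_apply, apply_ite]
    · simp [vecMul, dotProduct, hjm, hjm.symm]
  have hone (j) : Pi.single j 1 ∈ W := by
    have h1 : (Pi.single j 1 : n → AdjoinRoot a) = ∑ i, b i • Pi.single j (f i) := by
      ext m
      rcases eq_or_ne m j with rfl | hm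
      · simp [← hf, dotProduct, mul_comm]
      · simp [hm]
    rw [h1]
    exact Submodule.sum_mem _ fun i _ => W.smul_mem _ (hsingle i j)
  refine eq_top_iff.2 fun w _ => ?_
  have h1 : w = ∑ j, w j • Pi.single j 1 := by
    simp [← Pi.single_smul, Finset.univ_sum_single]
  rw [h1]
  exact Submodule.sum_mem _ fun j _ => W.smul_mem _ (hone j)

/-- Matrices of determinant one come from the Galois action. -/
lemma mem_galoisMatrices_of_det_eq_one (hθt : algebraMap F E t = θ) (ha : a.Monic)
    (hn : 3 ≤ Fintype.card n) (hx : ∀ i, x i ∈ tors k r θ a)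
    (hind : ∀ c : n → k[X], comb (drin k r θ) x c = 0 → ∀ i, a ∣ c i)
    (hgen : ∀ y ∈ tors k r θ a, ∃ c : n → k[X], y = comb (drin k r θ) x c)
    (hend : ∀ i j, ∃ f ∈ Submodule.span k (Set.range (galEnd (F := F) (E := E) k)),
      ∀ m, f (x m) = if m = j then x i else 0)
    (hUφ : ∀ b : k[X], ∀ x ∈ U, aeval (drin k r θ) b x ∈ U)
    (hy : y ∈ tors k r θ a) (hyU : ∀ b : k[X], aeval (drin k r θ) b y ∈ U → a ∣ b)
    (hgenU : ∀ x ∈ tors k r θ a, ∃ b : k[X], x - aeval (drin k r θ) b y ∈ U)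
    {e : k[X]} (he : a ∣ e * e - e)
    (hσ : ∀ u ∈ U, aeval (drin k r θ) e u = u →
      ∃ σ : E ≃ₐ[F] E, (∀ x ∈ U, σ x = x) ∧ σ y = y + u)
    (hσ' : ∀ u ∈ U, ∃ σ : E ≃ₐ[F] E,
      (∀ x ∈ U, aeval (drin k r θ) (1 - e) (σ x) = aeval (drin k r θ) (1 - e) x) ∧ σ y = y + u)
    {g : Matrix n n (AdjoinRoot a)} (hg : g.det = 1) : g ∈ galoisMatrices hθt hx := by
  have : Module.Finite k (AdjoinRoot a) := ha.finite_adjoinRoot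
  have : Finite (AdjoinRoot a) := Module.finite_of_finite k
  choose c hc using fun j => hgenU _ (hx j)
  have hlift (v : n → AdjoinRoot a) : ∃ d : n → k[X], AdjoinRoot.mk a ∘ d = v := by
    choose d hd using fun i => AdjoinRoot.mk_surjective (v i)
    exact ⟨d, funext hd⟩
  have hU := comb_mem_iff_dotProduct hUφ hy hyU hc
  refine mem_of_transvections hn (fun _ => isUnit_of_mem_galoisMatrices hθt hx hind hgen)
    (e := AdjoinRoot.mk a e) ?_ (AdjoinRoot.mk a ∘ c) ?_ ?_ ?_ hg
  · rw [IsIdempotentElem, ← map_mul, AdjoinRoot.mk_eq_mk]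
    exact he
  · intro v hv hev
    obtain ⟨d, rfl⟩ := hlift v
    obtain ⟨σ, hσU, hσy⟩ := hσ _ ((hU d).2 hv) (by
      rw [← comb_smul, comb_eq_iff hx hind, ← hev]
      ext i
      simp)
    refine ⟨σ, 1 + vecMulVec d c, fun j => ?_, map_one_add_vecMulVec c d⟩
    simpa using apply_eq_comb_of_translation (f := 1) hθt hc (fun x hx => by rw [hσU x hx]) hσy j
  · intro v hv
    obtain ⟨d, rfl⟩ := hlift v
    obtain ⟨σ, hσU, hσy⟩ := hσ' _ ((hU d).2 hv)
    obtain ⟨N, hN⟩ := exists_represents (h := σ) hgen fun j => galois_mem_tors hθt σ (hx j)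
    refine ⟨_, ⟨σ, N, hN, rfl⟩, ?_⟩
    rw [← map_one_add_vecMulVec]
    ext i j
    have h1 := apply_eq_comb_of_translation hθt hc hσU hσy j
    rw [hN j, ← comb_smul, ← comb_smul, comb_eq_iff hx hind] at h1
    simpa using congrFun h1 i
  · obtain ⟨b, hb⟩ := hgen y hy
    refine span_vecMul_galoisMatrices hθt hx hind hgen hend (b := AdjoinRoot.mk a ∘ b) ?_
    have h1 : (AdjoinRoot.mk a ∘ c) ⬝ᵥ (AdjoinRoot.mk a ∘ b) = AdjoinRoot.mk a (c ⬝ᵥ b) :=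
      (RingHom.map_dotProduct _ _ _).symm
    rw [h1, ← map_one (AdjoinRoot.mk a), AdjoinRoot.mk_eq_mk, ← dvd_neg, neg_sub]
    refine hyU _ ?_
    have h2 : aeval (drin k r θ) (1 - c ⬝ᵥ b) y =
        ∑ i, aeval (drin k r θ) (b i) (x i - aeval (drin k r θ) (c i) y) := by
      simp only [map_sub, Finset.sum_sub_distrib, map_one, LinearMap.sub_apply, Module.End.one_apply]
      congr 1
      simp only [dotProduct, map_sum, LinearMap.sum_apply, mul_comm (c _), map_mul,
        Module.End.mul_apply]
    rw [h2]
    exact Submodule.sum_mem _ fun i _ => hUφ _ _ (hc i)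

end GaloisMatrices

section Surjectivity

variable {k F E : Type*} [Field k] [Fintype k] [Field F] [Field E] [Algebra k[X] F]
  [IsFractionRing k[X] F] [Algebra F E] [IsAlgClosure F E] [Algebra k F] [Algebra k E]
  [Algebra k[X] E] [IsScalarTower k F E] [IsScalarTower k[X] F E] [IsScalarTower k k[X] E]
  {r : ℕ} {a : k[X]} {g : E → E}

local notation "q" => Fintype.card k

theorem exists_galois_eqOn_tors_of_monic (hr : r.Prime) (hr3 : 3 ≤ r) (hq : 2 < q) (ha : a.Monic)
    (hd : 0 < a.natDegree)
    (hg : Set.BijOn g (tors k r (algebraMap k[X] E X) a) (tors k r (algebraMap k[X] E X) a))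
    (hgh : IsTorsionHom (drin k r (algebraMap k[X] E X)) a g) :
    ∃ σ : E ≃ₐ[F] E, ∀ x ∈ tors k r (algebraMap k[X] E X) a, σ x = g x := by
  have : IsAlgClosed E := IsAlgClosure.isAlgClosed F
  have : Normal F E := IsAlgClosure.normal F E
  have hinj : Function.Injective (algebraMap k[X] E) := by
    rw [IsScalarTower.algebraMap_eq k[X] F E]
    exact (algebraMap F E).injective.comp (IsFractionRing.injective k[X] F)
  set θ := algebraMap k[X] E X with hθ
  have hθt : algebraMap F E (algebraMap k[X] F X) = θ :=
    (IsScalarTower.algebraMap_apply k[X] F E X).symm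
  have hθ0 : θ ≠ 0 := (map_ne_zero_iff _ hinj).2 X_ne_zero
  have haθ : aeval θ a ≠ 0 := by
    have h1 : aeval θ a = algebraMap k[X] E a := by
      rw [hθ, aeval_algebraMap_apply, aeval_X_left_apply]
    rw [h1]
    exact (map_ne_zero_iff _ hinj).2 ha.ne_zero
  have hr2 : 2 ≤ r := by omega
  obtain ⟨v, Γ, hp, hv, hres⟩ := exists_place_zero F E k
  rw [hθt] at hv
  obtain ⟨U, y, e, -, hUφ, hy, hgenU, hyU, he, hσ, hσ'⟩ :=
    exists_zero_place_structure hθt hp hr2 hq hθ0 hv hres haθ hd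
  obtain ⟨v', Γ', hp', hv', hres'⟩ := exists_place_infty F E k
  rw [hθt] at hv'
  obtain ⟨x, hx, hind, hgen, hend⟩ := exists_infty_place_structure hθt hp' hr hr3 hq hv'
    (fun x h1 h2 h3 => by
      obtain ⟨c, hc⟩ := hres' x h1 h2 h3
      refine ⟨c, ?_⟩
      rwa [← IsScalarTower.algebraMap_apply k[X] F E, ← algebraMap_eq,
        ← IsScalarTower.algebraMap_apply k k[X] E] at hc) haθ hd
  have hSL {M : Matrix (Fin r) (Fin r) (AdjoinRoot a)} (hM : M.det = 1) :
      M ∈ galoisMatrices hθt hx :=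
    mem_galoisMatrices_of_det_eq_one hθt ha (by simpa using hr3) hx hind hgen hend hUφ hy hyU
      hgenU he hσ hσ' hM
  have : Module.Finite k (AdjoinRoot a) := ha.finite_adjoinRoot
  have : Finite (AdjoinRoot a) := Module.finite_of_finite k
  obtain ⟨N, hN⟩ := exists_represents (h := g) hgen fun j => hg.mapsTo (hx j)
  -- `det N` is invertible modulo `a`
  have hcop : IsCoprime N.det a := by
    choose s hs hsx using fun j => hg.surjOn (hx j)
    choose d hd using fun j => hgen _ (hs j)
    have h1 : Represents (drin k r θ) x id (N * Matrix.of fun i j => d j i) := fun j => by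
      have h2 := hN.apply_comb hx hgh (d j)
      rw [← show s j = comb (drin k r θ) x (d j) from hd j, hsx j] at h2
      exact h2
    have h3 := congrArg Matrix.det (h1.map_eq hx hind represents_id)
    rw [← RingHom.mapMatrix_apply, ← RingHom.mapMatrix_apply, ← RingHom.map_det, ← RingHom.map_det,
      Matrix.det_one, Matrix.det_mul, AdjoinRoot.mk_eq_mk] at h3
    obtain ⟨m, hm⟩ := h3
    exact ⟨(Matrix.of fun i j => d j i).det, -m, by linear_combination hm⟩
  obtain ⟨z, hz, hzind, hzdet⟩ := exists_carlitz_torsion_det ha hd (hr.odd_of_ne_two (by omega)) hr2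
    hθ0 haθ hx hgen
  obtain ⟨σ, hσz⟩ := exists_galois_aeval_carl (F := F) ha hcop hz
  obtain ⟨N', hN'⟩ := exists_represents (h := σ) hgen fun j => galois_mem_tors hθt σ (hx j)
  have hdet : (N'.map (AdjoinRoot.mk a)).det = (N.map (AdjoinRoot.mk a)).det := by
    have h1 := hzdet ((σ.restrictScalars k : E ≃ₐ[k] E) : E →ₐ[k] E)
      (by rw [← hθt]; exact σ.commutes _) N' hN'
    have h2 : a ∣ N'.det - N.det := hzind _ (by
      rw [map_sub, LinearMap.sub_apply, sub_eq_zero, ← h1]; exact hσz)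
    rw [← RingHom.mapMatrix_apply, ← RingHom.mapMatrix_apply, ← RingHom.map_det, ← RingHom.map_det,
      AdjoinRoot.mk_eq_mk]
    exact h2
  have hmem : N'.map (AdjoinRoot.mk a) ∈ galoisMatrices hθt hx := ⟨σ, N', hN', rfl⟩
  obtain ⟨M, hM, hNM, hMN⟩ := exists_inverse_mem
    (fun _ => isUnit_of_mem_galoisMatrices hθt hx hind hgen) hmem
  have hmemN : N.map (AdjoinRoot.mk a) ∈ galoisMatrices hθt hx := by
    have h1 : M * N.map (AdjoinRoot.mk a) ∈ galoisMatrices hθt hx := hSL (by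
      rw [Matrix.det_mul, ← hdet, ← Matrix.det_mul, hMN, Matrix.det_one])
    have h2 := (galoisMatrices hθt hx).mul_mem hmem h1
    rwa [← mul_assoc, hNM, one_mul] at h2
  obtain ⟨τ, K, hK, hKN⟩ := hmemN
  refine ⟨τ, fun w hw => ?_⟩
  obtain ⟨c, rfl⟩ := hgen w hw
  change τ (comb (drin k r θ) x c) = g (comb (drin k r θ) x c)
  rw [hK.apply_comb hx (isTorsionHom_galois hθt τ), hN.apply_comb hx hgh, comb_eq_iff hx hind]
  ext i
  have h1 (M : Matrix (Fin r) (Fin r) k[X]) : AdjoinRoot.mk a ((M.mulVec c) i) =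
      ((M.map (AdjoinRoot.mk a)).mulVec (AdjoinRoot.mk a ∘ c)) i := RingHom.map_mulVec _ _ _ _
  rw [Function.comp_apply, Function.comp_apply, h1, h1, hKN]

theorem exists_galois_eqOn_tors (hr : r.Prime) (hr3 : 3 ≤ r) (hq : 2 < q) (ha : a ≠ 0)
    (hg : Set.BijOn g (tors k r (algebraMap k[X] E X) a) (tors k r (algebraMap k[X] E X) a))
    (hgh : IsTorsionHom (drin k r (algebraMap k[X] E X)) a g) :
    ∃ σ : E ≃ₐ[F] E, ∀ x ∈ tors k r (algebraMap k[X] E X) a, σ x = g x := by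
  set θ := algebraMap k[X] E X
  have hlc : a.leadingCoeff⁻¹ ≠ 0 := inv_ne_zero (leadingCoeff_ne_zero.2 ha)
  have hmul (b : k[X]) {c : k} (hc : c ≠ 0) : tors k r θ (b * C c) = tors k r θ b := by
    ext x
    rw [LinearMap.mem_ker, LinearMap.mem_ker, mul_comm, ← smul_eq_C_mul, map_smul,
      LinearMap.smul_apply, smul_eq_zero_iff_right hc]
  rcases Nat.eq_zero_or_pos a.natDegree with hd | hd
  · refine ⟨1, fun x hx => ?_⟩
    have h1 (x) (hx : x ∈ tors k r θ a) : x = 0 := by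
      rw [eq_C_of_natDegree_eq_zero hd, ← one_mul (C _), hmul _ fun h => ha <| by
        rw [eq_C_of_natDegree_eq_zero hd, h, C_0]] at hx
      simpa using hx
    rw [h1 _ (hg.mapsTo hx), h1 x hx, map_zero]
  · have h1 := hmul a hlc
    have hgh' : IsTorsionHom (drin k r θ) (a * C a.leadingCoeff⁻¹) g :=
      ⟨fun x hx y hy => hgh.map_add x (h1.le hx) y (h1.le hy),
        fun b x hx => hgh.map_aeval b x (h1.le hx)⟩
    have h2 := exists_galois_eqOn_tors_of_monic (F := F) (g := g) hr hr3 hq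
      (monic_mul_leadingCoeff_inv ha) (by rwa [natDegree_mul_C hlc]) (by rwa [h1]) hgh'
    rwa [h1] at h2

end Surjectivity

lemma IsDrinfeldPhi.apply_eq_aeval {Fq : Type} [Field Fq] [Fintype Fq] {r : ℕ}
    {φ : Polynomial Fq →+* AddMonoid.End (Kbar Fq)} (hφ : IsDrinfeldPhi Fq (Fintype.card Fq) r φ)
    (b : Fq[X]) (x : Kbar Fq) :
    φ b x = aeval (drin Fq r (algebraMap Fq[X] (Kbar Fq) X)) b x := by
  have hX : algebraMap Fq[X] (Kbar Fq) X = algebraMap (RatFunc Fq) (Kbar Fq) RatFunc.X := by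
    rw [IsScalarTower.algebraMap_apply Fq[X] (RatFunc Fq) (Kbar Fq), RatFunc.algebraMap_X]
  induction b using Polynomial.induction_on generalizing x with
  | C c =>
    rw [hφ.1, aeval_C, Module.algebraMap_end_apply, Algebra.smul_def,
      IsScalarTower.algebraMap_apply Fq (RatFunc Fq) (Kbar Fq), RatFunc.algebraMap_eq_C]
  | add f g hf hg =>
    rw [map_add, map_add, LinearMap.add_apply, ← hf, ← hg]
    rfl
  | monomial n c ih =>
    rw [pow_succ, ← mul_assoc, map_mul φ, map_mul (aeval _), Module.End.mul_apply, ← ih,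
      aeval_X, drin_apply, hX, ← hφ.2]
    rfl

end DrinfeldAdelic

open DrinfeldAdelic

/-- Adelic surjectivity: there is `c = c(r)` such that for `p > c` and `q ≡ 1 (mod r)`,
every `A/𝔞`-module automorphism of `φ[𝔞]` is the restriction of some `σ ∈ Gal(F̄/F)`. -/
theorem adelic_galois_representation_surjective (r : ℕ) (hr : r.Prime) (hr3 : 3 ≤ r) :
    ∃ c : ℕ, ∀ (p e q : ℕ), p.Prime → 5 ≤ p → c < p → 0 < e → q = p ^ e → q % r = 1 →
    ∀ (Fq : Type) [Field Fq] [Fintype Fq], Fintype.card Fq = q →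
    ∀ φ : Polynomial Fq →+* AddMonoid.End (Kbar Fq), IsDrinfeldPhi Fq q r φ →
    ∀ a : Polynomial Fq, a ≠ 0 →
    ∀ g : Kbar Fq → Kbar Fq, IsTorsionAut Fq φ a g →
    ∃ σ : Kbar Fq ≃ₐ[RatFunc Fq] Kbar Fq, ∀ x ∈ phiTorsion Fq φ a, σ x = g x := by
  refine ⟨0, fun p e q hp hp5 _ he hq _ Fq _ _ hcard φ hφ a ha g hg => ?_⟩
  subst hcard
  have hq2 : 2 < Fintype.card Fq := by
    have := Nat.le_self_pow he.ne' p
    omega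
  have htors : phiTorsion Fq φ a = tors Fq r (algebraMap Fq[X] (Kbar Fq) X) a := by
    ext x
    change φ a x = 0 ↔ _
    rw [hφ.apply_eq_aeval]
    rfl
  obtain ⟨h1, h2, h3⟩ := hg
  rw [htors] at h1 h2 h3 ⊢
  refine exists_galois_eqOn_tors (F := RatFunc Fq) hr hr3 hq2 ha h1 ⟨h2, fun b x hx => ?_⟩
  rw [← hφ.apply_eq_aeval, ← hφ.apply_eq_aeval]
  exact h3 b x hx
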